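/- arXiv:2204.11607 — 3 statements merged into one kernel-verified Lean document; each statement's English description precedes it below -/
import Mathlib

section
/- Let F ∈ ℤ[x,y,z] be a non-singular homogeneous form of degree k ≥ 5 and let 0 ≤ γ ≤ k−2 with τ = k−γ. Assume that ν_F = 3, i.e. no complex line meets the curve C_F at any of its points with order of contact at least 4. If either 5 ≤ k ≤ 9 and τ > 9/2, or k > 9 and τ > (3/2)·√k, then N_γ(F,B) = o(B) as B → ∞. -/
open MvPolynomial

/-- The one-variable polynomial `t ↦ F(p + t v)` restricted to a line, over `ℂ`;
its root multiplicity at `t = 0` is the order of contact of the line with `C_F` at `p`. -/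
noncomputable def contactOrder (F : MvPolynomial (Fin 3) ℤ) (p v : Fin 3 → ℂ) : ℕ :=
  Polynomial.rootMultiplicity 0
    (MvPolynomial.aeval (fun i => Polynomial.C (p i) + Polynomial.C (v i) * Polynomial.X) F)

/-- `p` is an inflection point of `C_F` with tangent direction `v`. -/
def IsInflTangent (F : MvPolynomial (Fin 3) ℤ) (p v : Fin 3 → ℂ) : Prop :=
  p ≠ 0 ∧ MvPolynomial.aeval p F = 0 ∧ (∀ c : ℂ, v ≠ c • p) ∧
    (∑ i, v i * MvPolynomial.aeval p (MvPolynomial.pderiv i F)) = 0 ∧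
    3 ≤ contactOrder F p v

/-- The integer point `x` lies on a tangent line of `C_F` at an inflection point,
viewed as a two-dimensional linear subspace of `ℂ³`. -/
def OnInflTangent (F : MvPolynomial (Fin 3) ℤ) (x : Fin 3 → ℤ) : Prop :=
  ∃ p v : Fin 3 → ℂ, IsInflTangent F p v ∧
    (fun i => (x i : ℂ)) ∈ Submodule.span ℂ ({p, v} : Set (Fin 3 → ℂ))

/-- `x` is a primitive triple counted by `N_γ(F,B)`. -/
def Counted (F : MvPolynomial (Fin 3) ℤ) (γ B : ℝ) (x : Fin 3 → ℤ) : Prop :=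
  Int.gcd (x 0) (Int.gcd (x 1) (x 2)) = 1 ∧
    ((|MvPolynomial.eval x F| : ℤ) : ℝ) ≤ B ^ γ ∧
    B / 2 < max |(x 0 : ℝ)| (max |(x 1 : ℝ)| |(x 2 : ℝ)|) ∧
    max |(x 0 : ℝ)| (max |(x 1 : ℝ)| |(x 2 : ℝ)|) ≤ B

section

open Filter Topology

/-- Either a finite family of reals is small, or it contains many well-spaced members. -/
lemma card_le_or_exists_spaced {ι : Type*} [DecidableEq ι] (u : ι → ℝ) (L : ℝ) (M n : ℕ)
    (S : Finset ι)
    (hM : ∀ T ⊆ S, (∀ x ∈ T, ∀ y ∈ T, |u x - u y| < L) → T.card ≤ M) :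
    S.card ≤ n * M ∨ ∃ p : ℕ → ι, (∀ i ≤ n, p i ∈ S) ∧
      ∀ i j, i < j → j ≤ n → u (p i) + L ≤ u (p j) := by
  induction n generalizing S with
  | zero =>
    rcases S.eq_empty_or_nonempty with rfl | ⟨x, hx⟩
    · left; simp
    · right; exact ⟨fun _ => x, fun _ _ => hx, fun i j hij hj => by omega⟩
  | succ n ih =>
    rcases S.eq_empty_or_nonempty with rfl | hne
    · left; simp
    obtain ⟨x, hxS, hx⟩ := S.exists_min_image u hne
    set T := S.filter (fun y => u y < u x + L) with hT
    have hTc : T.card ≤ M := by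
      refine hM T (Finset.filter_subset _ _) fun y hy z hz => ?_
      simp only [hT, Finset.mem_filter] at hy hz
      have := hx y hy.1
      have := hx z hz.1
      rw [abs_lt]; constructor <;> linarith
    have hsub : S \ T ⊆ S := Finset.sdiff_subset
    rcases ih (S \ T) (fun T' hT' => hM T' (hT'.trans hsub)) with h | ⟨p, hp, hsep⟩
    · left
      have : (S \ T).card + T.card = S.card :=
        Finset.card_sdiff_add_card_eq_card (Finset.filter_subset _ _)
      have : (n + 1) * M = n * M + M := by ring
      omega
    · right
      refine ⟨fun i => Nat.casesOn i x p, ?_, ?_⟩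
      · rintro (_ | i) hi
        · exact hxS
        · exact hsub (hp i (by omega))
      · rintro (_ | i) (_ | j) hij hj
        · omega
        · have := hp j (by omega)
          simp only [hT, Finset.mem_sdiff, Finset.mem_filter, not_and, not_lt] at this
          exact this.2 this.1
        · omega
        · exact hsep i j (by omega) (by omega)

/-- If short intervals contain few members of a family in `[a, b]`, the family is small. -/
lemma card_le_of_local_bound {ι : Type*} [DecidableEq ι] (u : ι → ℝ) {L a b : ℝ} (hL : 0 < L)
    (hab : a ≤ b) (M : ℕ) (S : Finset ι) (hS : ∀ x ∈ S, u x ∈ Set.Icc a b)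
    (hM : ∀ T ⊆ S, (∀ x ∈ T, ∀ y ∈ T, |u x - u y| < L) → T.card ≤ M) :
    (S.card : ℝ) ≤ M * ((b - a) / L + 1) := by
  have h0 : 0 ≤ (b - a) / L := div_nonneg (by linarith) hL.le
  set n := ⌊(b - a) / L⌋₊ with hn
  have hn1 : (n : ℝ) ≤ (b - a) / L := Nat.floor_le h0
  have hn2 : (b - a) / L < n + 1 := Nat.lt_floor_add_one _
  rcases card_le_or_exists_spaced u L M (n + 1) S hM with h | ⟨p, hp, hsep⟩
  · calc (S.card : ℝ) ≤ ((n + 1) * M : ℕ) := by exact_mod_cast h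
      _ = M * ((n : ℝ) + 1) := by push_cast; ring
      _ ≤ _ := by gcongr
  · exfalso
    have key : ∀ i ≤ n + 1, a + i * L ≤ u (p i) := by
      intro i hi
      induction i with
      | zero => simpa using (hS _ (hp 0 (by omega))).1
      | succ i ih =>
        have := hsep i (i + 1) (by omega) hi
        have := ih (by omega)
        push_cast; linarith
    have h1 := key (n + 1) le_rfl
    have h2 := (hS _ (hp (n + 1) le_rfl)).2
    rw [div_lt_iff₀ hL] at hn2
    push_cast at h1
    linarith

/-- Sublevel estimate: a function with large `n`-th derivative cannot be small at `2 ^ n`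
well-spaced points. The derivatives are given as a tower `h 0, h 1, …`. -/
lemma sublevel_estimate (n : ℕ) (h : ℕ → ℝ → ℝ) {J : Set ℝ} (hJ : J.OrdConnected) {σ ε η : ℝ}
    (hσ : 0 < σ)
    (hd : ∀ j < n, ∀ s ∈ J, HasDerivAt (h j) (h (j + 1) s) s)
    (p : ℕ → ℝ) (hp : ∀ i < 2 ^ n, p i ∈ J)
    (hsep : ∀ i j, i < j → j < 2 ^ n → p i + σ ≤ p j)
    (hε : ∀ i < 2 ^ n, |h 0 (p i)| ≤ ε) (hη : ∀ s ∈ J, η ≤ |h n s|) :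
    η ≤ ε * (2 / σ) ^ n := by
  induction n generalizing h p ε with
  | zero => simpa using (hη _ (hp 0 (by simp))).trans (hε 0 (by simp))
  | succ n ih =>
    have hpow : 2 ^ (n + 1) = 2 * 2 ^ n := by ring
    have hmvt : ∀ i, ∃ ξ, i < 2 ^ n → ξ ∈ Set.Ioo (p (2 * i)) (p (2 * i + 1)) ∧
        |h 1 ξ| ≤ ε * (2 / σ) := by
      intro i
      by_cases hi : i < 2 ^ n
      · have hlt := hsep (2 * i) (2 * i + 1) (by omega) (by omega)
        have hsub : Set.Icc (p (2 * i)) (p (2 * i + 1)) ⊆ J :=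
          hJ.out (hp _ (by omega)) (hp _ (by omega))
        obtain ⟨ξ, hξ, he⟩ := exists_hasDerivAt_eq_slope (h 0) (h 1)
          (show p (2 * i) < p (2 * i + 1) by linarith)
          (fun s hs => (hd 0 (by omega) s (hsub hs)).continuousAt.continuousWithinAt)
          (fun s hs => hd 0 (by omega) s (hsub (Set.Ioo_subset_Icc_self hs)))
        refine ⟨ξ, fun _ => ⟨hξ, ?_⟩⟩
        have e1 := abs_le.1 (hε (2 * i) (by omega))
        have e2 := abs_le.1 (hε (2 * i + 1) (by omega))
        have hpos : 0 < p (2 * i + 1) - p (2 * i) := by linarith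
        have hε0 : 0 ≤ ε := (abs_nonneg _).trans (hε 0 (by positivity))
        rw [he, abs_div, abs_of_pos hpos, div_le_iff₀ hpos]
        calc |h 0 (p (2 * i + 1)) - h 0 (p (2 * i))| ≤ 2 * ε := by
              rw [abs_le]; constructor <;> linarith [e1.1, e1.2, e2.1, e2.2]
          _ = ε * (2 / σ) * σ := by field_simp
          _ ≤ _ := by
              gcongr
              linarith
      · exact ⟨0, fun h => absurd h hi⟩
    choose q hq using hmvt
    have := ih (fun j => h (j + 1)) (ε := ε * (2 / σ)) (fun j hj => hd (j + 1) (by omega)) q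
      (fun i hi => hJ.out (hp (2 * i) (by omega)) (hp (2 * i + 1) (by omega))
        (Set.Ioo_subset_Icc_self (hq i hi).1))
      (fun i j hij hj => by
        have h1 := (hq i (by omega)).1.2
        have h2 := (hq j hj).1.1
        have h3 := hsep (2 * i + 1) (2 * j) (by omega) (by omega)
        linarith)
      (fun i hi => (hq i hi).2) hη
    calc η ≤ ε * (2 / σ) * (2 / σ) ^ n := this
      _ = _ := by ring

/-- Taylor's inequality for a tower of derivatives. -/
lemma taylor_tower (n : ℕ) (h : ℕ → ℝ → ℝ) {J : Set ℝ} (hJ : J.OrdConnected) {C : ℝ}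
    (hd : ∀ j < n, ∀ s ∈ J, HasDerivAt (h j) (h (j + 1) s) s)
    (hC : ∀ s ∈ J, |h n s| ≤ C) {s u : ℝ} (hs : s ∈ J) (hu : u ∈ J) :
    |h 0 u - ∑ a ∈ Finset.range n, h a s / (a.factorial : ℝ) * (u - s) ^ a| ≤ C * |u - s| ^ n := by
  induction n generalizing h u with
  | zero => simpa using hC u hu
  | succ n ih =>
    set φ : ℝ → ℝ := fun v =>
      h 0 v - ∑ a ∈ Finset.range (n + 1), h a s / (a.factorial : ℝ) * (v - s) ^ a with hφ
    have hC0 : 0 ≤ C := (abs_nonneg _).trans (hC s hs)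
    have hφs : φ s = 0 := by
      simp [hφ, Finset.sum_range_succ']
    have hder : ∀ v ∈ J, HasDerivAt φ (h 1 v - ∑ a ∈ Finset.range n,
        h (a + 1) s / (a.factorial : ℝ) * (v - s) ^ a) v := by
      intro v hv
      refine (hd 0 (by omega) v hv).sub ?_
      have : (fun v => ∑ a ∈ Finset.range (n + 1), h a s / (a.factorial : ℝ) * (v - s) ^ a) =
          fun v => (∑ a ∈ Finset.range n, h (a + 1) s / ((a + 1).factorial : ℝ) * (v - s) ^ (a + 1))
            + h 0 s := by
        ext v; simp [Finset.sum_range_succ']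
      rw [this]
      refine HasDerivAt.add_const _ ?_
      refine HasDerivAt.fun_sum fun a _ => ?_
      have h1 := ((((hasDerivAt_id v).sub_const s).pow (a + 1)).const_mul
        (h (a + 1) s / ((a + 1).factorial : ℝ)))
      refine h1.congr_deriv ?_
      have : (a.factorial : ℝ) ≠ 0 := by positivity
      have h2 : ((a + 1 : ℕ) : ℝ) ≠ 0 := by positivity
      rw [Nat.factorial_succ]
      push_cast at h2 ⊢
      field_simp
      simp
    have hsub : Set.uIcc s u ⊆ J := hJ.uIcc_subset hs hu
    have hb : ∀ v ∈ Set.uIcc s u, ‖h 1 v - ∑ a ∈ Finset.range n,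
        h (a + 1) s / (a.factorial : ℝ) * (v - s) ^ a‖ ≤ C * |u - s| ^ n := by
      intro v hv
      refine (ih (fun j => h (j + 1)) (fun j hj => hd (j + 1) (by omega)) hC (hsub hv)).trans ?_
      have : |v - s| ≤ |u - s| := Set.abs_sub_left_of_mem_uIcc hv
      gcongr
    have := (convex_uIcc s u).norm_image_sub_le_of_norm_hasDerivWithin_le
      (fun v hv => (hder v (hsub hv)).hasDerivWithinAt) hb Set.left_mem_uIcc Set.right_mem_uIcc
    rw [hφs, sub_zero, Real.norm_eq_abs, Real.norm_eq_abs] at this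
    calc _ ≤ C * |u - s| ^ n * |u - s| := this
      _ = _ := by ring

lemma sum_ge_of_injective_below (r : Fin 6 → Fin 6)
    (hr : ∀ j j', r j = r j' → r j ≠ 5 → j = j') : 15 ≤ ∑ j, (r j : ℕ) := by
  have h1 : ∑ j, (5 - (r j : ℕ)) ≤ 15 := by
    rw [← Finset.sum_fiberwise Finset.univ r]
    calc ∑ a, ∑ j with r j = a, (5 - (r j : ℕ)) ≤ ∑ a : Fin 6, (5 - (a : ℕ)) := by
          refine Finset.sum_le_sum fun a _ => ?_
          by_cases ha : a = 5
          · refine (Finset.sum_eq_zero fun j hj => ?_).trans_le (Nat.zero_le _)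
            simp only [Finset.mem_filter] at hj
            rw [hj.2, ha]; rfl
          · have hc : (Finset.univ.filter fun j => r j = a).card ≤ 1 := by
              rw [Finset.card_le_one]
              intro j hj j' hj'
              simp only [Finset.mem_filter] at hj hj'
              exact hr j j' (hj.2.trans hj'.2.symm) (hj.2 ▸ ha)
            calc ∑ j with r j = a, (5 - (r j : ℕ)) = ∑ j with r j = a, (5 - (a : ℕ)) :=
                  Finset.sum_congr rfl fun j hj => by
                    simp only [Finset.mem_filter] at hj; rw [hj.2]
              _ = (Finset.univ.filter fun j => r j = a).card * (5 - (a : ℕ)) := by simp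
              _ ≤ 1 * (5 - (a : ℕ)) := Nat.mul_le_mul_right _ hc
              _ = _ := one_mul _
      _ = 15 := by decide
  have h2 : ∑ j, ((r j : ℕ) + (5 - (r j : ℕ))) = 30 := by
    calc _ = ∑ _j : Fin 6, 5 := Finset.sum_congr rfl fun j _ => by have := (r j).isLt; omega
      _ = 30 := by simp
  rw [Finset.sum_add_distrib] at h2
  omega

lemma det_of_sum_rows {n α : Type*} [Fintype n] [DecidableEq n] [Fintype α] [DecidableEq α]
    (V : n → α → n → ℝ) :
    Matrix.det (Matrix.of fun j i => ∑ a, V j a i) =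
      ∑ r : n → α, Matrix.det (Matrix.of fun j i => V j (r j) i) := by
  have h := (Matrix.detRowAlternating (n := n) (R := ℝ)).toMultilinearMap.map_sum
    (fun j a => V j a)
  have h' : (Matrix.of fun j i => ∑ a, V j a i) = Matrix.of fun j => ∑ a, V j a := by
    ext j i; simp
  rw [h']
  exact h

/-- A `6 × 6` determinant whose rows agree with a common polynomial expansion in `δ` up to order
`5` is `O(δ ^ 15)`. -/
lemma abs_det_le_of_expansion {δ C : ℝ} (hδ : 0 ≤ δ) (hδ1 : δ ≤ 1) (θ : Fin 6 → Fin 6 → ℝ)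
    (R : Fin 6 → Fin 6 → Fin 6 → ℝ) (hθ : ∀ j a, |θ j a| ≤ 1) (hR : ∀ j a i, |R j a i| ≤ C)
    (hcomm : ∀ j j' a, a ≠ 5 → R j a = R j' a) :
    |Matrix.det (Matrix.of fun j i => ∑ a : Fin 6, δ ^ (a : ℕ) * θ j a * R j a i)| ≤
      6 ^ 6 * (720 * C ^ 6) * δ ^ 15 := by
  have hexp : Matrix.det (Matrix.of fun j i => ∑ a : Fin 6, δ ^ (a : ℕ) * θ j a * R j a i) =
      ∑ r : Fin 6 → Fin 6, (∏ j, (δ ^ (r j : ℕ) * θ j (r j))) *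
        Matrix.det (Matrix.of fun j => R j (r j)) := by
    rw [det_of_sum_rows fun (j a i : Fin 6) => δ ^ (a : ℕ) * θ j a * R j a i]
    refine Finset.sum_congr rfl fun r _ => ?_
    exact Matrix.det_mul_column (fun j => δ ^ (r j : ℕ) * θ j (r j)) (Matrix.of fun j => R j (r j))
  have hC : 0 ≤ C := (abs_nonneg _).trans (hR 0 0 0)
  rw [hexp]
  refine (Finset.abs_sum_le_sum_abs _ _).trans ?_
  have hterm : ∀ r ∈ (Finset.univ : Finset (Fin 6 → Fin 6)),
      |(∏ j, (δ ^ (r j : ℕ) * θ j (r j))) * Matrix.det (Matrix.of fun j => R j (r j))| ≤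
        720 * C ^ 6 * δ ^ 15 := by
    intro r _
    by_cases hr : ∀ j j', r j = r j' → r j ≠ 5 → j = j'
    · have hdet : |Matrix.det (Matrix.of fun j => R j (r j))| ≤ 720 * C ^ 6 := by
        have := Matrix.det_le (A := Matrix.of fun j => R j (r j))
          (abv := IsAbsoluteValue.toAbsoluteValue (abs : ℝ → ℝ)) (x := C)
          (fun i j => hR i (r i) j)
        simpa [Nat.factorial] using this
      have hprod : |∏ j, (δ ^ (r j : ℕ) * θ j (r j))| ≤ δ ^ 15 := by
        rw [Finset.abs_prod]
        calc ∏ j, |δ ^ (r j : ℕ) * θ j (r j)| ≤ ∏ j, δ ^ (r j : ℕ) := by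
              refine Finset.prod_le_prod (fun _ _ => abs_nonneg _) fun j _ => ?_
              rw [abs_mul, abs_of_nonneg (pow_nonneg hδ _)]
              exact mul_le_of_le_one_right (pow_nonneg hδ _) (hθ _ _)
          _ = δ ^ ∑ j, (r j : ℕ) := Finset.prod_pow_eq_pow_sum _ _ _
          _ ≤ δ ^ 15 := pow_le_pow_of_le_one hδ hδ1 (sum_ge_of_injective_below r hr)
      rw [abs_mul, mul_comm]
      gcongr
    · push Not at hr
      obtain ⟨j, j', h1, h2, h3⟩ := hr
      rw [Matrix.det_zero_of_row_eq h3 (show R j (r j) = R j' (r j') by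
        rw [hcomm j j' (r j) h2, h1]), mul_zero, abs_zero]
      positivity
  refine (Finset.sum_le_card_nsmul _ _ _ hterm).trans (le_of_eq ?_)
  simp; ring

/-- If every six vectors of a family in `ℝ⁶` are dependent, the family lies in a hyperplane. -/
lemma exists_common_annihilator {ι : Type*} (S : Finset ι) (w : ι → Fin 6 → ℝ)
    (h : ∀ x : Fin 6 → ι, (∀ j, x j ∈ S) → Matrix.det (Matrix.of fun j => w (x j)) = 0) :
    ∃ c : Fin 6 → ℝ, ‖c‖ = 1 ∧ ∀ x ∈ S, ∑ i, c i * w x i = 0 := by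
  have hne : Submodule.span ℝ (w '' (S : Set ι)) ≠ ⊤ := by
    intro htop
    obtain ⟨b, hbs, hspan, hli⟩ := exists_linearIndependent ℝ (w '' (S : Set ι))
    rw [htop] at hspan
    let B := Module.Basis.mk hli (by rw [Subtype.range_coe]; exact hspan.ge)
    have hfin : Finite b := ((S.finite_toSet.image w).subset hbs).to_subtype
    have : Fintype b := Fintype.ofFinite b
    have hcard : Fintype.card b = 6 := by
      have := Module.finrank_eq_card_basis B
      simpa using this.symm
    let e : Fin 6 ≃ b := (Fintype.equivFinOfCardEq hcard).symm
    have hx : ∀ j, ∃ x ∈ S, w x = e j := fun j => hbs (e j).2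
    choose x hxS hxw using hx
    have h0 := h x hxS
    have hli' : LinearIndependent ℝ (Matrix.of fun j => w (x j)).row := by
      have : (Matrix.of fun j => w (x j)).row = fun j => ((e j : b) : Fin 6 → ℝ) := by
        funext j; exact hxw j
      rw [this]
      exact hli.comp e e.injective
    rw [Matrix.linearIndependent_rows_iff_isUnit, Matrix.isUnit_iff_isUnit_det, h0] at hli'
    simp at hli'
  obtain ⟨f, hf0, hf⟩ := Submodule.exists_le_ker_of_lt_top _ (lt_top_iff_ne_top.2 hne)
  let c : Fin 6 → ℝ := fun i => f (Pi.single i 1)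
  have hfc : ∀ v, f v = ∑ i, c i * v i := by
    intro v
    conv_lhs => rw [pi_eq_sum_univ' v]
    rw [map_sum]
    refine Finset.sum_congr rfl fun i _ => ?_
    rw [map_smul, smul_eq_mul, mul_comm]
  have hc : c ≠ 0 := by
    intro hc
    refine hf0 (LinearMap.ext fun v => ?_)
    rw [hfc, hc]
    simp
  refine ⟨‖c‖⁻¹ • c, norm_smul_inv_norm hc, fun x hx => ?_⟩
  have : f (w x) = 0 := hf (Submodule.subset_span ⟨x, hx, rfl⟩)
  rw [hfc] at this
  simp only [Pi.smul_apply, smul_eq_mul, mul_assoc, ← Finset.mul_sum, this, mul_zero]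

/-- First affine coordinate of the projective point `(x 0 : x 1 : x 2)`. -/
noncomputable def affU (x : Fin 3 → ℤ) : ℝ := (x 1 : ℝ) / x 0

/-- Second affine coordinate of the projective point `(x 0 : x 1 : x 2)`. -/
noncomputable def affV (x : Fin 3 → ℤ) : ℝ := (x 2 : ℝ) / x 0

/-- `x` is a primitive integer vector with `|x 0| ≤ B` whose affine point is within vertical
distance `ε` of the graph of `g` over `[a, b]`. -/
def NearGraph (g : ℝ → ℝ) (ε B a b : ℝ) (x : Fin 3 → ℤ) : Prop :=
  (∃ d : Fin 3 → ℤ, ∑ i, d i * x i = 1) ∧ x 0 ≠ 0 ∧ |(x 0 : ℝ)| ≤ B ∧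
    affU x ∈ Set.Icc a b ∧ |affV x - g (affU x)| ≤ ε

lemma NearGraph.mono {g : ℝ → ℝ} {ε B a b a' b' : ℝ} {x : Fin 3 → ℤ} (h : NearGraph g ε B a b x)
    (hx : affU x ∈ Set.Icc a' b') : NearGraph g ε B a' b' x :=
  ⟨h.1, h.2.1, h.2.2.1, hx, h.2.2.2.2⟩

/-- Proportional primitive vectors agree up to sign. -/
lemma eq_or_eq_neg_of_proportional {x y : Fin 3 → ℤ} (hx : ∃ d : Fin 3 → ℤ, ∑ i, d i * x i = 1)
    (hy : ∃ d : Fin 3 → ℤ, ∑ i, d i * y i = 1) (h : ∀ i j, x i * y j = x j * y i) :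
    x = y ∨ x = -y := by
  obtain ⟨d, hd⟩ := hx
  obtain ⟨e, he⟩ := hy
  set m := ∑ i, d i * y i with hm
  have hyx : ∀ j, y j = m * x j := by
    intro j
    calc y j = (∑ i, d i * x i) * y j := by rw [hd, one_mul]
      _ = ∑ i, d i * (x i * y j) := by rw [Finset.sum_mul]; simp [mul_assoc]
      _ = ∑ i, d i * (x j * y i) := by simp only [h _ j]
      _ = m * x j := by rw [hm, Finset.sum_mul]; exact Finset.sum_congr rfl fun i _ => by ring
  have hunit : IsUnit m := by
    refine IsUnit.of_mul_eq_one (∑ i, e i * x i) ?_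
    rw [Finset.mul_sum, ← he]
    exact Finset.sum_congr rfl fun i _ => by rw [hyx i]; ring
  rcases Int.isUnit_iff.1 hunit with h1 | h1
  · left; funext j; rw [hyx j, h1, one_mul]
  · right; funext j; simp [hyx j, h1]

/-- Distinct fractions of height at most `B` are at least `1 / B ^ 2` apart. -/
lemma cross_mul_eq_of_abs_sub_lt {p q p' q' : ℤ} {B : ℝ} (hq : q ≠ 0) (hq' : q' ≠ 0)
    (hqB : |(q : ℝ)| ≤ B) (hqB' : |(q' : ℝ)| ≤ B)
    (h : |(p : ℝ) / q - (p' : ℝ) / q'| < 1 / B ^ 2) : p * q' = p' * q := by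
  have hq0 : (q : ℝ) ≠ 0 := by exact_mod_cast hq
  have hq0' : (q' : ℝ) ≠ 0 := by exact_mod_cast hq'
  have hB : 0 < B := (abs_pos.2 hq0).trans_le hqB
  have e : (p : ℝ) / q - (p' : ℝ) / q' = ((p * q' - p' * q : ℤ) : ℝ) / (q * q') := by
    push_cast; field_simp
  rw [e, abs_div, div_lt_iff₀ (abs_pos.2 (mul_ne_zero hq0 hq0')), abs_mul] at h
  have h1 : |(q : ℝ)| * |(q' : ℝ)| ≤ B ^ 2 := by
    rw [sq]; exact mul_le_mul hqB hqB' (abs_nonneg _) hB.le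
  have h2 : 1 / B ^ 2 * (|(q : ℝ)| * |(q' : ℝ)|) ≤ 1 := by
    rw [one_div, inv_mul_le_iff₀ (by positivity)]; simpa using h1
  have h3 : |((p * q' - p' * q : ℤ) : ℝ)| < 1 := h.trans_le h2
  have h4 : p * q' - p' * q = 0 := by
    rw [← Int.abs_lt_one_iff]; exact_mod_cast h3
  linarith

/-- Points near the graph with very close first coordinates agree up to sign. -/
lemma eq_or_eq_neg_of_close {g : ℝ → ℝ} {ε B a b : ℝ} (hε : 2 * ε * B ^ 2 < 1) {x y : Fin 3 → ℤ}
    (hx : NearGraph g ε B a b x) (hy : NearGraph g ε B a b y)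
    (h : |affU x - affU y| < 1 / B ^ 2) : x = y ∨ x = -y := by
  have hx0 : (x 0 : ℝ) ≠ 0 := by exact_mod_cast hx.2.1
  have hy0 : (y 0 : ℝ) ≠ 0 := by exact_mod_cast hy.2.1
  have hB : 0 < B := (abs_pos.2 hx0).trans_le hx.2.2.1
  have h01 : x 1 * y 0 = y 1 * x 0 :=
    cross_mul_eq_of_abs_sub_lt hx.2.1 hy.2.1 hx.2.2.1 hy.2.2.1 h
  have hu : affU x = affU y := by
    unfold affU; rw [div_eq_div_iff hx0 hy0]; exact_mod_cast h01
  have hv : |affV x - affV y| < 1 / B ^ 2 := by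
    have e1 := abs_le.1 hx.2.2.2.2
    have e2 := abs_le.1 hy.2.2.2.2
    rw [hu] at e1
    refine lt_of_le_of_lt (b := 2 * ε) ?_ ?_
    · rw [abs_le]; constructor <;> linarith [e1.1, e1.2, e2.1, e2.2]
    · rwa [lt_div_iff₀ (by positivity)]
  have h02 : x 2 * y 0 = y 2 * x 0 :=
    cross_mul_eq_of_abs_sub_lt hx.2.1 hy.2.1 hx.2.2.1 hy.2.2.1 hv
  have h12 : x 1 * y 2 = x 2 * y 1 := by
    have hx0' := hx.2.1
    have hy0' := hy.2.1
    have : x 0 * y 0 * (x 1 * y 2) = x 0 * y 0 * (x 2 * y 1) := by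
      linear_combination (y 2 * x 0) * h01 - (y 1 * x 0) * h02
    exact mul_left_cancel₀ (mul_ne_zero hx0' hy0') this
  refine eq_or_eq_neg_of_proportional hx.1 hy.1 fun i j => ?_
  fin_cases i <;> fin_cases j <;> simp <;> linarith

lemma card_le_two_of_close {g : ℝ → ℝ} {ε B a b : ℝ} (hε : 2 * ε * B ^ 2 < 1)
    (T : Finset (Fin 3 → ℤ)) (hT : ∀ x ∈ T, NearGraph g ε B a b x)
    (hc : ∀ x ∈ T, ∀ y ∈ T, |affU x - affU y| < 1 / B ^ 2) : T.card ≤ 2 := by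
  classical
  rcases T.eq_empty_or_nonempty with rfl | ⟨y, hy⟩
  · simp
  have : T ⊆ {y, -y} := fun x hx => by
    simpa using eq_or_eq_neg_of_close hε (hT x hx) (hT y hy) (hc x hx y hy)
  exact (Finset.card_le_card this).trans Finset.card_le_two

/-- Points on which a function with large `n`-th derivative is small. -/
lemma card_le_of_sublevel {ι : Type*} [DecidableEq ι] (u : ι → ℝ) (T : Finset ι) (n M : ℕ)
    (h : ℕ → ℝ → ℝ) {J : Set ℝ} (hJ : J.OrdConnected) {σ ε η : ℝ} (hσ : 0 < σ)
    (hd : ∀ j < n, ∀ s ∈ J, HasDerivAt (h j) (h (j + 1) s) s)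
    (hη : ∀ s ∈ J, η ≤ |h n s|) (hTJ : ∀ x ∈ T, u x ∈ J) (hTε : ∀ x ∈ T, |h 0 (u x)| ≤ ε)
    (hM : ∀ T' ⊆ T, (∀ x ∈ T', ∀ y ∈ T', |u x - u y| < σ) → T'.card ≤ M)
    (hlt : ε * (2 / σ) ^ n < η) : T.card ≤ (2 ^ n - 1) * M := by
  rcases card_le_or_exists_spaced u σ M (2 ^ n - 1) T hM with h1 | ⟨p, hp, hsep⟩
  · exact h1
  · exfalso
    have hpos : 0 < 2 ^ n := by positivity
    have := sublevel_estimate n h hJ hσ hd (fun i => u (p i))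
      (fun i hi => hTJ _ (hp i (by omega))) (fun i j hij hj => hsep i j hij (by omega))
      (fun i hi => hTε _ (hp i (by omega))) hη
    linarith

/-- Integer points in a short stretch near a smooth graph are coplanar. -/
lemma affine_relation_of_close {gd : ℕ → ℝ → ℝ} {ε B a b C δ : ℝ}
    (hd : ∀ j < 2, ∀ s ∈ Set.Icc a b, HasDerivAt (gd j) (gd (j + 1) s) s)
    (hC : ∀ s ∈ Set.Icc a b, |gd 2 s| ≤ C) (hε : 0 ≤ ε)
    (hB : B ^ 3 * (3 * δ * (C * δ ^ 2 + ε)) < 1) {x y z : Fin 3 → ℤ}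
    (hx : NearGraph (gd 0) ε B a b x) (hy : NearGraph (gd 0) ε B a b y)
    (hz : NearGraph (gd 0) ε B a b z) (hxy : |affU x - affU y| < δ) (hxz : |affU x - affU z| < δ)
    (hyz : |affU y - affU z| < δ) :
    (affU y - affU x) * (affV z - affV x) = (affU z - affU x) * (affV y - affV x) := by
  have hx0 : (x 0 : ℝ) ≠ 0 := by exact_mod_cast hx.2.1
  have hy0 : (y 0 : ℝ) ≠ 0 := by exact_mod_cast hy.2.1
  have hz0 : (z 0 : ℝ) ≠ 0 := by exact_mod_cast hz.2.1
  have hB0 : 0 < B := (abs_pos.2 hx0).trans_le hx.2.2.1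
  have hδ : 0 < δ := (abs_nonneg _).trans_lt hxy
  have hC0 : 0 ≤ C := (abs_nonneg _).trans (hC _ hx.2.2.2.1)
  have hrem : ∀ w, NearGraph (gd 0) ε B a b w → |affU x - affU w| < δ →
      |affV w - (gd 0 (affU x) + gd 1 (affU x) * (affU w - affU x))| ≤ C * δ ^ 2 + ε := by
    intro w hw hxw
    have h1 := taylor_tower 2 gd Set.ordConnected_Icc hd hC hx.2.2.2.1 hw.2.2.2.1
    have h2 := hw.2.2.2.2
    have h3 : |affU w - affU x| ^ 2 ≤ δ ^ 2 := by
      rw [abs_sub_comm]; gcongr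
    have h4 : C * |affU w - affU x| ^ 2 ≤ C * δ ^ 2 := by gcongr
    simp only [Finset.sum_range_succ, Finset.sum_range_zero, Nat.factorial, pow_zero, pow_one] at h1
    rw [abs_le] at h1 h2 ⊢
    norm_num at h1
    rw [sq_abs] at h4
    constructor <;> linarith [h1.1, h1.2, h2.1, h2.2]
  have rx := hrem x hx (by simpa using hδ)
  have ry := hrem y hy hxy
  have rz := hrem z hz hxz
  set K := C * δ ^ 2 + ε with hK
  have hK0 : 0 ≤ K := by positivity
  set D := (affU y - affU x) * (affV z - affV x) - (affU z - affU x) * (affV y - affV x) with hD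
  have hDK : |D| ≤ 3 * δ * K := by
    set ex := affV x - (gd 0 (affU x) + gd 1 (affU x) * (affU x - affU x))
    set ey := affV y - (gd 0 (affU x) + gd 1 (affU x) * (affU y - affU x))
    set ez := affV z - (gd 0 (affU x) + gd 1 (affU x) * (affU z - affU x))
    have : D = (affU z - affU y) * ex + (affU x - affU z) * ey + (affU y - affU x) * ez := by
      simp only [hD, ex, ey, ez]; ring
    rw [this]
    have t1 : |(affU z - affU y) * ex| ≤ δ * K := by
      rw [abs_mul, abs_sub_comm]; gcongr
    have t2 : |(affU x - affU z) * ey| ≤ δ * K := by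
      rw [abs_mul]; gcongr
    have t3 : |(affU y - affU x) * ez| ≤ δ * K := by
      rw [abs_mul, abs_sub_comm]; gcongr
    have := abs_add_three ((affU z - affU y) * ex) ((affU x - affU z) * ey)
      ((affU y - affU x) * ez)
    linarith
  set N : ℤ := x 0 * (y 1 * z 2 - y 2 * z 1) - x 1 * (y 0 * z 2 - y 2 * z 0)
    + x 2 * (y 0 * z 1 - y 1 * z 0) with hN
  have hND : (N : ℝ) = x 0 * y 0 * z 0 * D := by
    simp only [hN, hD, affU, affV]
    push_cast
    field_simp
    ring
  have hN1 : |(N : ℝ)| < 1 := by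
    refine lt_of_le_of_lt ?_ hB
    rw [hND, abs_mul, abs_mul, abs_mul]
    have : |(x 0 : ℝ)| * |(y 0 : ℝ)| * |(z 0 : ℝ)| ≤ B * B * B := by
      gcongr
      exacts [hx.2.2.1, hy.2.2.1, hz.2.2.1]
    calc _ ≤ (B * B * B) * (3 * δ * K) := by gcongr
      _ = _ := by ring
  have hN0 : N = 0 := by
    rw [← Int.abs_lt_one_iff]; exact_mod_cast hN1
  rw [hN0] at hND
  have : D = 0 := by
    have h := hND.symm
    simpa [hx0, hy0, hz0] using h
  rw [hD] at this
  linarith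

/-- Under the smallness conditions, close points near a graph lie on a common non-vertical
line. -/
lemma exists_affine_of_close {gd : ℕ → ℝ → ℝ} {ε B a b C δ : ℝ}
    (hd : ∀ j < 2, ∀ s ∈ Set.Icc a b, HasDerivAt (gd j) (gd (j + 1) s) s)
    (hC : ∀ s ∈ Set.Icc a b, |gd 2 s| ≤ C) (hε : 0 ≤ ε) (hε2 : 2 * ε * B ^ 2 < 1)
    (hB : B ^ 3 * (3 * δ * (C * δ ^ 2 + ε)) < 1) (T : Finset (Fin 3 → ℤ))
    (hT : ∀ x ∈ T, NearGraph (gd 0) ε B a b x)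
    (hTδ : ∀ x ∈ T, ∀ y ∈ T, |affU x - affU y| < δ) :
    ∃ α β : ℝ, ∀ x ∈ T, affV x = α + β * affU x := by
  by_cases h : ∃ x ∈ T, ∃ y ∈ T, affU x ≠ affU y
  · obtain ⟨x, hx, y, hy, hxy⟩ := h
    have hne : affU y - affU x ≠ 0 := sub_ne_zero.2 hxy.symm
    refine ⟨affV x - (affV y - affV x) / (affU y - affU x) * affU x,
      (affV y - affV x) / (affU y - affU x), fun z hz => ?_⟩
    have := affine_relation_of_close hd hC hε hB (hT x hx) (hT y hy) (hT z hz) (hTδ x hx y hy)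
      (hTδ x hx z hz) (hTδ y hy z hz)
    field_simp
    linarith
  · push Not at h
    rcases T.eq_empty_or_nonempty with rfl | ⟨y, hy⟩
    · exact ⟨0, 0, by simp⟩
    refine ⟨affV y, 0, fun x hx => ?_⟩
    have hx0 : (x 0 : ℝ) ≠ 0 := by exact_mod_cast (hT x hx).2.1
    have hB0 : 0 < B := (abs_pos.2 hx0).trans_le (hT x hx).2.2.1
    rcases eq_or_eq_neg_of_close hε2 (hT x hx) (hT y hy)
      (by rw [h x hx y hy, sub_self, abs_zero]; positivity) with rfl | rfl
    · simp
    · simp [affV]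

/-- The number of close points near a graph with a large derivative of order `n + 2`. -/
lemma card_le_of_close {gd : ℕ → ℝ → ℝ} {ε B a b C δ η σ : ℝ} (n M : ℕ)
    (hd : ∀ j < n + 2, ∀ s ∈ Set.Icc a b, HasDerivAt (gd j) (gd (j + 1) s) s)
    (hC : ∀ s ∈ Set.Icc a b, |gd 2 s| ≤ C) (hε : 0 ≤ ε) (hε2 : 2 * ε * B ^ 2 < 1)
    (hB : B ^ 3 * (3 * δ * (C * δ ^ 2 + ε)) < 1) (T : Finset (Fin 3 → ℤ))
    (hT : ∀ x ∈ T, NearGraph (gd 0) ε B a b x)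
    (hTδ : ∀ x ∈ T, ∀ y ∈ T, |affU x - affU y| < δ) {J : Set ℝ} (hJ : J.OrdConnected)
    (hJI : J ⊆ Set.Icc a b) (hTJ : ∀ x ∈ T, affU x ∈ J) (hη : ∀ s ∈ J, η ≤ |gd (n + 2) s|)
    (hσ : 0 < σ)
    (hM : ∀ T' ⊆ T, (∀ x ∈ T', ∀ y ∈ T', |affU x - affU y| < σ) → T'.card ≤ M)
    (hlt : ε * (2 / σ) ^ (n + 2) < η) : T.card ≤ (2 ^ (n + 2) - 1) * M := by
  classical
  obtain ⟨α, β, hαβ⟩ := exists_affine_of_close (fun j hj => hd j (by omega)) hC hε hε2 hB T hT hTδ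
  let h : ℕ → ℝ → ℝ := fun j => match j with
    | 0 => fun s => gd 0 s - (α + β * s)
    | 1 => fun s => gd 1 s - β
    | j + 2 => gd (j + 2)
  refine card_le_of_sublevel affU T (n + 2) M h hJ hσ ?_ hη hTJ ?_ hM hlt
  · rintro (_ | _ | j) hj s hs
    · refine (hd 0 (by omega) s (hJI hs)).sub ?_
      simpa using ((hasDerivAt_id s).const_mul β).const_add α
    · exact (hd 1 (by omega) s (hJI hs)).sub_const β
    · exact hd (j + 2) hj s (hJI hs)
  · intro x hx
    have := (hT x hx).2.2.2.2
    rw [abs_sub_comm, hαβ x hx] at this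
    exact this

lemma eventually_mul_rpow_lt (K : ℝ) {κ e : ℝ} (he : e < 0) (hκ : 0 < κ) :
    ∀ᶠ B : ℝ in atTop, K * B ^ e < κ := by
  have h : Tendsto (fun B : ℝ => K * B ^ e) atTop (𝓝 (K * 0)) := by
    have := tendsto_rpow_neg_atTop (y := -e) (by linarith)
    rw [neg_neg] at this
    exact this.const_mul K
  rw [mul_zero] at h
  exact h.eventually_lt_const hκ

lemma eventually_mul_rpow_le_mul (K : ℝ) {κ e : ℝ} (he : e < 1) (hκ : 0 < κ) :
    ∀ᶠ B : ℝ in atTop, K * B ^ e ≤ κ * B := by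
  filter_upwards [eventually_mul_rpow_lt K (e := e - 1) (by linarith) hκ, eventually_gt_atTop 0]
    with B hB hB0
  have : B ^ e = B ^ (e - 1) * B := by
    rw [← Real.rpow_add_one hB0.ne']; ring_nf
  rw [this, ← mul_assoc]
  gcongr

/-- Numerical conditions under which the counting in short cells of length `δ` works. -/
structure CellParams (C ε B δ ρ : ℝ) : Prop where
  B_pos : 0 < B
  δ_pos : 0 < δ
  ε_nonneg : 0 ≤ ε
  ε_small : 2 * ε * B ^ 2 < 1
  cell : B ^ 3 * (3 * δ * (C * δ ^ 2 + ε)) < 1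
  ρ_large : C * δ ≤ ρ / 2
  ρ_gap : ε * (2 / (1 / B ^ 2)) ^ 2 < ρ / 2

lemma eventually_cellParams {C C₀ τ : ℝ} (hC : 0 ≤ C) (hC₀ : 0 ≤ C₀) (hτ : 9 / 2 < τ)
    (hτ5 : τ < 5) : ∀ᶠ B : ℝ in atTop,
      CellParams C (C₀ * B ^ (-τ)) B (1 / (6 * (C + 1)) / B) ((8 * C₀ + 1) * B ^ (4 - τ)) := by
  set c := 1 / (6 * (C + 1)) with hc
  have hc0 : 0 < c := by positivity
  have hcC : 6 * c * C + 6 * c = 1 := by rw [hc]; field_simp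
  have hc1 : c ≤ 1 := by nlinarith
  filter_upwards [eventually_mul_rpow_lt (2 * C₀) (e := 2 - τ) (κ := 1) (by linarith) one_pos,
    eventually_mul_rpow_lt (3 * c * C₀) (e := 2 - τ) (κ := 1 / 2) (by linarith) (by norm_num),
    eventually_mul_rpow_lt (2 * C * c) (e := τ - 5) (κ := 1) (by linarith) one_pos,
    eventually_gt_atTop 0] with B h1 h2 h3 hB
  have e2 : B ^ (2 - τ) = B ^ 2 * B ^ (-τ) := by
    rw [sub_eq_add_neg, Real.rpow_add hB, Real.rpow_two]
  have e4 : B ^ (4 - τ) = B ^ 4 * B ^ (-τ) := by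
    rw [sub_eq_add_neg, Real.rpow_add hB]; norm_cast
  have hpos : 0 < B ^ (-τ) := Real.rpow_pos_of_pos hB _
  refine ⟨hB, by positivity, by positivity, ?_, ?_, ?_, ?_⟩
  · rw [e2] at h1; linarith
  · have : B ^ 3 * (3 * (c / B) * (C * (c / B) ^ 2 + C₀ * B ^ (-τ))) =
        3 * c ^ 3 * C + 3 * c * C₀ * B ^ (2 - τ) := by
      rw [e2]; field_simp
    rw [this]
    have : 3 * c ^ 3 * C ≤ 1 / 2 := by
      have : c ^ 3 ≤ c := by
        calc c ^ 3 = c * (c * c) := by ring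
          _ ≤ c * (1 * 1) := by gcongr
          _ = c := by ring
      nlinarith
    linarith
  · have e5 : B ^ (4 - τ) = (B ^ (τ - 5))⁻¹ * (1 / B) := by
      rw [← Real.rpow_neg hB.le, one_div, ← Real.rpow_neg_one, ← Real.rpow_add hB]
      congr 1; ring
    rw [e5]
    have hq : 0 < B ^ (τ - 5) := Real.rpow_pos_of_pos hB _
    have h4 : 2 * C * c ≤ (B ^ (τ - 5))⁻¹ := by
      rw [← one_div, le_div_iff₀ hq]; exact h3.le
    have : C * (c / B) = (2 * C * c) * (1 / B) / 2 := by ring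
    rw [this]
    have h6 : (2 * C * c) * (1 / B) ≤ (8 * C₀ + 1) * ((B ^ (τ - 5))⁻¹ * (1 / B)) := by
      have : (2 * C * c) * (1 / B) ≤ (B ^ (τ - 5))⁻¹ * (1 / B) := by gcongr
      have h7 : 0 ≤ (B ^ (τ - 5))⁻¹ * (1 / B) := by positivity
      nlinarith
    linarith
  · rw [e4]
    have : C₀ * B ^ (-τ) * (2 / (1 / B ^ 2)) ^ 2 = 4 * C₀ * (B ^ 4 * B ^ (-τ)) := by
      field_simp; ring
    rw [this]
    have : 0 < B ^ 4 * B ^ (-τ) := by positivity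
    nlinarith

/-- Cells of regular points are bounded. -/
lemma CellParams.card_le_six {gd : ℕ → ℝ → ℝ} {ε B a b C δ ρ : ℝ} (hp : CellParams C ε B δ ρ)
    (hd : ∀ j, ∀ s ∈ Set.Icc a b, HasDerivAt (gd j) (gd (j + 1) s) s)
    (hC : ∀ s ∈ Set.Icc a b, |gd 2 s| ≤ C) (hC3 : ∀ s ∈ Set.Icc a b, |gd 3 s| ≤ C)
    (T : Finset (Fin 3 → ℤ)) (hT : ∀ x ∈ T, NearGraph (gd 0) ε B a b x)
    (hreg : ∀ x ∈ T, ρ ≤ |gd 2 (affU x)|)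
    (hTδ : ∀ x ∈ T, ∀ y ∈ T, |affU x - affU y| < δ) : T.card ≤ 6 := by
  rcases T.eq_empty_or_nonempty with rfl | ⟨y, hy⟩
  · simp
  have hB := hp.B_pos
  have hyI := (hT y hy).2.2.2.1
  have := card_le_of_close (η := ρ / 2) (σ := 1 / B ^ 2) 0 2 (fun j _ => hd j) hC hp.ε_nonneg
    hp.ε_small hp.cell T hT hTδ
    (J := Set.Icc a b ∩ Set.Icc (affU y - δ) (affU y + δ))
    (Set.ordConnected_Icc.inter Set.ordConnected_Icc) Set.inter_subset_left
    (fun x hx => ⟨(hT x hx).2.2.2.1, by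
      have := abs_lt.1 (hTδ x hx y hy)
      constructor <;> linarith [this.1, this.2]⟩) ?_ (by positivity) ?_ hp.ρ_gap
  · simpa using this
  · rintro s ⟨hs, hs'⟩
    have h1 := taylor_tower 1 (fun j => gd (j + 2)) Set.ordConnected_Icc
      (fun j _ => hd (j + 2)) hC3 hyI hs
    simp only [Finset.sum_range_one, Nat.factorial, pow_zero, pow_one] at h1
    have h2 : |s - affU y| ≤ δ := by
      rw [abs_le]; constructor <;> linarith [hs'.1, hs'.2]
    have hC0 : 0 ≤ C := (abs_nonneg _).trans (hC s hs)
    have h3 : C * |s - affU y| ≤ C * δ := by gcongr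
    have h4 := abs_sub_abs_le_abs_sub (gd 2 (affU y)) (gd 2 s)
    have h5 := hreg y hy
    rw [abs_sub_comm] at h4
    norm_num at h1
    simp only [Nat.zero_add]
    linarith [hp.ρ_large]
  · intro T' hT' hclose
    exact card_le_two_of_close hp.ε_small T' (fun x hx => hT x (hT' hx)) hclose

/-- Regular points over an interval. -/
lemma CellParams.card_regular_le {gd : ℕ → ℝ → ℝ} {ε B a b C δ ρ a' b' : ℝ}
    (hp : CellParams C ε B δ ρ)
    (hd : ∀ j, ∀ s ∈ Set.Icc a b, HasDerivAt (gd j) (gd (j + 1) s) s)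
    (hC : ∀ s ∈ Set.Icc a b, |gd 2 s| ≤ C) (hC3 : ∀ s ∈ Set.Icc a b, |gd 3 s| ≤ C)
    (hab : a' ≤ b')
    (T : Finset (Fin 3 → ℤ)) (hT : ∀ x ∈ T, NearGraph (gd 0) ε B a b x)
    (hreg : ∀ x ∈ T, ρ ≤ |gd 2 (affU x)|) (hT' : ∀ x ∈ T, affU x ∈ Set.Icc a' b') :
    (T.card : ℝ) ≤ 6 * ((b' - a') / δ + 1) := by
  classical
  exact_mod_cast card_le_of_local_bound affU hp.δ_pos hab 6 T hT' fun T' hTT' hclose =>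
    hp.card_le_six hd hC hC3 T' (fun x hx => hT x (hTT' hx)) (fun x hx => hreg x (hTT' hx)) hclose

/-- A set of pairwise close points lies in a short interval. -/
lemma card_le_of_local_bound_close {ι : Type*} [DecidableEq ι] (u : ι → ℝ) {L r : ℝ} (hL : 0 < L)
    (hr : 0 < r) (M : ℕ) (S : Finset ι) (hS : ∀ x ∈ S, ∀ y ∈ S, |u x - u y| < r)
    (hM : ∀ T ⊆ S, (∀ x ∈ T, ∀ y ∈ T, |u x - u y| < L) → T.card ≤ M) :
    (S.card : ℝ) ≤ M * (2 * r / L + 1) := by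
  rcases S.eq_empty_or_nonempty with rfl | ⟨y, hy⟩
  · simp; positivity
  have := card_le_of_local_bound u hL (a := u y - r) (b := u y + r) (by linarith) M S
    (fun x hx => by
      have := abs_lt.1 (hS x hx y hy)
      constructor <;> linarith [this.1, this.2]) hM
  convert this using 4
  ring

/-- Exceptional points, where the curvature is small, are few when the third derivative is
bounded below. -/
lemma CellParams.card_exceptional_le {gd : ℕ → ℝ → ℝ} {ε B a b C δ ρ η σ : ℝ}
    (hp : CellParams C ε B δ ρ) (hρ : 0 < ρ)
    (hd : ∀ j, ∀ s ∈ Set.Icc a b, HasDerivAt (gd j) (gd (j + 1) s) s)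
    (hC : ∀ s ∈ Set.Icc a b, |gd 2 s| ≤ C) (hη0 : 0 < η) (hη : ∀ s ∈ Set.Icc a b, η ≤ |gd 3 s|)
    (hσ : 0 < σ) (hlt : ε * (2 / σ) ^ 3 < η)
    (T : Finset (Fin 3 → ℤ)) (hT : ∀ x ∈ T, NearGraph (gd 0) ε B a b x)
    (hex : ∀ x ∈ T, |gd 2 (affU x)| ≤ ρ) :
    (T.card : ℝ) ≤ (14 * (2 * σ * B ^ 2 + 1)) * (6 * ρ / (η * δ) + 1) := by
  classical
  have hB := hp.B_pos
  have hδ := hp.δ_pos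
  set M₁ := ⌊2 * (2 * σ * B ^ 2 + 1)⌋₊ with hM₁
  have hM₁le : (M₁ : ℝ) ≤ 2 * (2 * σ * B ^ 2 + 1) := Nat.floor_le (by positivity)
  have hcell : ∀ T' ⊆ T, (∀ x ∈ T', ∀ y ∈ T', |affU x - affU y| < δ) → T'.card ≤ 7 * M₁ := by
    intro T' hT' hclose
    refine card_le_of_close (η := η) (σ := σ) 1 M₁ (fun j _ => hd j) hC hp.ε_nonneg
      hp.ε_small hp.cell T' (fun x hx => hT x (hT' hx)) hclose Set.ordConnected_Icc subset_rfl
      (fun x hx => (hT x (hT' hx)).2.2.2.1) hη hσ ?_ hlt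
    intro T'' hT'' hclose'
    refine Nat.le_floor ?_
    have := card_le_of_local_bound_close affU (L := 1 / B ^ 2) (by positivity) hσ 2 T'' hclose'
      fun U hU hUc => card_le_two_of_close hp.ε_small U
        (fun x hx => hT x (hT' (hT'' (hU hx)))) hUc
    have e : 2 * σ / (1 / B ^ 2) = 2 * σ * B ^ 2 := by field_simp
    rw [e] at this
    exact_mod_cast this
  set L := 3 * ρ / η with hL
  have hL0 : 0 < L := by positivity
  set M₂ := ⌊(7 * M₁ : ℕ) * (2 * L / δ + 1)⌋₊ with hM₂
  have h1 : T.card ≤ (2 ^ 1 - 1) * M₂ := by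
    refine card_le_of_sublevel (η := η) affU T 1 M₂ (fun j => gd (j + 2)) Set.ordConnected_Icc hL0
      (fun j _ => hd (j + 2)) hη (fun x hx => (hT x hx).2.2.2.1) hex ?_ ?_
    · intro T' hT' hclose
      exact Nat.le_floor (card_le_of_local_bound_close affU hδ hL0 _ T' hclose
        fun U hU => hcell U (hU.trans hT'))
    · rw [hL, pow_one]
      field_simp
      norm_num
  calc (T.card : ℝ) ≤ M₂ := by exact_mod_cast (by simpa using h1)
    _ ≤ (7 * M₁ : ℕ) * (2 * L / δ + 1) := Nat.floor_le (by positivity)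
    _ ≤ (14 * (2 * σ * B ^ 2 + 1)) * (2 * L / δ + 1) := by
        gcongr
        push_cast
        linarith
    _ = _ := by rw [hL]; congr 2; field_simp; norm_num

/-- Exceptional points are negligible. -/
lemma eventually_card_exceptional_le {gd : ℕ → ℝ → ℝ} {a b C C₀ τ η κ : ℝ}
    (hC0 : 0 ≤ C) (hC₀ : 0 ≤ C₀) (hτ : 9 / 2 < τ) (hτ5 : τ < 5) (hκ : 0 < κ)
    (hd : ∀ j, ∀ s ∈ Set.Icc a b, HasDerivAt (gd j) (gd (j + 1) s) s)
    (hC : ∀ s ∈ Set.Icc a b, |gd 2 s| ≤ C) (hη0 : 0 < η)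
    (hη : (∀ s ∈ Set.Icc a b, η ≤ |gd 2 s|) ∨ ∀ s ∈ Set.Icc a b, η ≤ |gd 3 s|) :
    ∀ᶠ B : ℝ in atTop, ∀ T : Finset (Fin 3 → ℤ),
      (∀ x ∈ T, NearGraph (gd 0) (C₀ * B ^ (-τ)) B a b x) →
      (∀ x ∈ T, |gd 2 (affU x)| < (8 * C₀ + 1) * B ^ (4 - τ)) → (T.card : ℝ) ≤ κ * B := by
  rcases hη with hη | hη
  · filter_upwards [eventually_mul_rpow_lt (8 * C₀ + 1) (e := 4 - τ) (by linarith) hη0,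
      eventually_gt_atTop 0] with B hB hB0 T hT hex
    rcases T.eq_empty_or_nonempty with rfl | ⟨y, hy⟩
    · simp; positivity
    · linarith [hη _ (hT y hy).2.2.2.1, hex y hy]
  · set c := 1 / (6 * (C + 1)) with hc
    have hc0 : 0 < c := by positivity
    set K := 8 * C₀ / η + 1 with hK
    have hK1 : 1 ≤ K := by rw [hK]; have : 0 ≤ 8 * C₀ / η := by positivity
                           linarith
    set K₁ := 14 * (2 * K + 1)
    set K₂ := 6 * (8 * C₀ + 1) / (η * c) + 1
    filter_upwards [eventually_cellParams hC0 hC₀ hτ hτ5,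
      eventually_mul_rpow_le_mul (K₁ * K₂) (e := 7 - 4 * τ / 3) (by linarith) hκ,
      eventually_ge_atTop 1] with B hp h2 hB1 T hT hex
    have hB := hp.B_pos
    have hσ3 : (B ^ (-τ / 3)) ^ 3 = B ^ (-τ) := by
      rw [← Real.rpow_natCast, ← Real.rpow_mul hB.le]; congr 1; push_cast; ring
    have hpos : 0 < B ^ (-τ / 3) := Real.rpow_pos_of_pos hB _
    have hpos' : 0 < B ^ (-τ) := Real.rpow_pos_of_pos hB _
    refine (hp.card_exceptional_le (σ := K * B ^ (-τ / 3)) (by positivity) hd hC hη0 hη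
      (by positivity) ?_ T hT fun x hx => (hex x hx).le).trans (le_trans ?_ h2)
    · have : C₀ * B ^ (-τ) * (2 / (K * B ^ (-τ / 3))) ^ 3 = 8 * C₀ / K ^ 3 := by
        rw [div_pow, mul_pow, hσ3]; field_simp; norm_num
      rw [this, div_lt_iff₀ (by positivity)]
      have h3 : K ≤ K ^ 3 := le_self_pow₀ hK1 (by norm_num)
      have h4 : 8 * C₀ = η * (K - 1) := by rw [hK]; field_simp; ring
      nlinarith
    · have e : B ^ (7 - 4 * τ / 3) = B ^ (2 - τ / 3) * B ^ (5 - τ) := by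
        rw [← Real.rpow_add hB]; congr 1; ring
      have e1 : B ^ (2 - τ / 3) = B ^ (-τ / 3) * B ^ 2 := by
        rw [← Real.rpow_two, ← Real.rpow_add hB]; congr 1; ring
      have e2 : B ^ (5 - τ) = B ^ (4 - τ) * B := by
        rw [← Real.rpow_add_one hB.ne']; congr 1; ring
      have g1 : 1 ≤ B ^ (2 - τ / 3) := Real.one_le_rpow hB1 (by linarith)
      have g2 : 1 ≤ B ^ (5 - τ) := Real.one_le_rpow hB1 (by linarith)
      have b1 : 14 * (2 * (K * B ^ (-τ / 3)) * B ^ 2 + 1) ≤ K₁ * B ^ (2 - τ / 3) := by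
        have : 2 * (K * B ^ (-τ / 3)) * B ^ 2 = 2 * K * B ^ (2 - τ / 3) := by rw [e1]; ring
        rw [this]; simp only [K₁]; nlinarith
      have b2 : 6 * ((8 * C₀ + 1) * B ^ (4 - τ)) / (η * (c / B)) + 1 ≤ K₂ * B ^ (5 - τ) := by
        have : 6 * ((8 * C₀ + 1) * B ^ (4 - τ)) / (η * (c / B)) =
            6 * (8 * C₀ + 1) / (η * c) * B ^ (5 - τ) := by rw [e2]; field_simp
        rw [this]; simp only [K₂]; nlinarith
      rw [e]
      calc _ ≤ (K₁ * B ^ (2 - τ / 3)) * (K₂ * B ^ (5 - τ)) := by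
            gcongr
        _ = _ := by ring

/-- The quadratic monomials in affine coordinates. -/
noncomputable def quadMon (u v : ℝ) : Fin 6 → ℝ := ![1, u, v, u ^ 2, u * v, v ^ 2]

/-- A tower of derivatives of the quadratic monomials along the graph of `g`. -/
structure QuadTower (g : ℝ → ℝ) (fd : Fin 6 → ℕ → ℝ → ℝ) (a b C : ℝ) : Prop where
  deriv : ∀ i j, ∀ s ∈ Set.Icc a b, HasDerivAt (fd i j) (fd i (j + 1) s) s
  zero : ∀ i, ∀ s ∈ Set.Icc a b, fd i 0 s = quadMon s (g s) i
  bound : ∀ i, ∀ j ≤ 6, ∀ s ∈ Set.Icc a b, |fd i j s| ≤ C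

lemma QuadTower.one_le {g : ℝ → ℝ} {fd : Fin 6 → ℕ → ℝ → ℝ} {a b C : ℝ}
    (h : QuadTower g fd a b C) {s : ℝ} (hs : s ∈ Set.Icc a b) : 1 ≤ C ∧ |s| ≤ C ∧ |g s| ≤ C := by
  refine ⟨?_, ?_, ?_⟩
  · simpa [h.zero 0 s hs, quadMon] using h.bound 0 0 (by norm_num) s hs
  · simpa [h.zero 1 s hs, quadMon] using h.bound 1 0 (by norm_num) s hs
  · simpa [h.zero 2 s hs, quadMon] using h.bound 2 0 (by norm_num) s hs

lemma QuadTower.abs_quadMon_sub_le {g : ℝ → ℝ} {fd : Fin 6 → ℕ → ℝ → ℝ} {a b C : ℝ}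
    (h : QuadTower g fd a b C) {u v ε : ℝ} (hu : u ∈ Set.Icc a b) (hv : |v - g u| ≤ ε)
    (hε1 : ε ≤ 1) (i : Fin 6) : |quadMon u v i - fd i 0 u| ≤ (2 * C + 1) * ε := by
  obtain ⟨hC1, huC, hgC⟩ := h.one_le hu
  have hε : 0 ≤ ε := (abs_nonneg _).trans hv
  rw [h.zero i u hu]
  have hpos : 0 ≤ (2 * C + 1) * ε := by positivity
  fin_cases i <;> simp only [quadMon] <;> simp
  · exact hpos
  · exact hpos
  · nlinarith
  · exact hpos
  · rw [← mul_sub, abs_mul]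
    calc |u| * |v - g u| ≤ C * ε := by gcongr
      _ ≤ _ := by nlinarith
  · have e : v ^ 2 - g u ^ 2 = (2 * g u + (v - g u)) * (v - g u) := by ring
    rw [e, abs_mul]
    have : |2 * g u + (v - g u)| ≤ 2 * C + 1 := by
      refine (abs_add_le _ _).trans ?_
      rw [abs_mul, abs_two]
      linarith
    gcongr

/-- The quadratic monomials of an integer point. -/
def intQuadMon (x : Fin 3 → ℤ) : Fin 6 → ℤ :=
  ![x 0 ^ 2, x 0 * x 1, x 0 * x 2, x 1 ^ 2, x 1 * x 2, x 2 ^ 2]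

lemma intQuadMon_eq {x : Fin 3 → ℤ} (hx : x 0 ≠ 0) (i : Fin 6) :
    (intQuadMon x i : ℝ) = (x 0 : ℝ) ^ 2 * quadMon (affU x) (affV x) i := by
  have hx0 : (x 0 : ℝ) ≠ 0 := by exact_mod_cast hx
  fin_cases i <;> simp [intQuadMon, quadMon, affU, affV] <;> field_simp

/-- Six points in a short arc have linearly dependent quadratic monomials. -/
lemma QuadTower.det_eq_zero {g : ℝ → ℝ} {fd : Fin 6 → ℕ → ℝ → ℝ} {a b C ε B δ : ℝ}
    (h : QuadTower g fd a b C) (hδ : 0 < δ) (hδ1 : δ ≤ 1) (hεδ : ε ≤ δ ^ 5)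
    (hB : B ^ 12 * (6 ^ 6 * (720 * (3 * C + 1) ^ 6) * δ ^ 15) < 1)
    (x : Fin 6 → Fin 3 → ℤ) (hx : ∀ j, NearGraph g ε B a b (x j))
    (hxδ : ∀ j j', |affU (x j) - affU (x j')| < δ) :
    Matrix.det (Matrix.of fun j i => (intQuadMon (x j) i : ℝ)) = 0 := by
  set s := affU (x 0) with hs
  have hsI : s ∈ Set.Icc a b := (hx 0).2.2.2.1
  obtain ⟨hC1, -, -⟩ := h.one_le hsI
  have hε1 : ε ≤ 1 := hεδ.trans (pow_le_one₀ hδ.le hδ1)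
  let P : Fin 6 → Fin 6 → ℝ := fun j i =>
    ∑ a ∈ Finset.range 5, fd i a s / (a.factorial : ℝ) * (affU (x j) - s) ^ a
  let θ : Fin 6 → Fin 6 → ℝ := fun j a => if a = 5 then 1 else ((affU (x j) - s) / δ) ^ (a : ℕ)
  let R : Fin 6 → Fin 6 → Fin 6 → ℝ := fun j a i =>
    if a = 5 then (quadMon (affU (x j)) (affV (x j)) i - P j i) / δ ^ 5
    else fd i a s / ((a : ℕ).factorial : ℝ)
  have hexp : ∀ j i, quadMon (affU (x j)) (affV (x j)) i =
      ∑ a : Fin 6, δ ^ (a : ℕ) * θ j a * R j a i := by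
    intro j i
    rw [Fin.sum_univ_castSucc]
    have h5 : (Fin.last 5 : Fin 6) = 5 := rfl
    have e1 : ∑ a : Fin 5, δ ^ ((Fin.castSucc a : Fin 6) : ℕ) * θ j (Fin.castSucc a) *
        R j (Fin.castSucc a) i = P j i := by
      simp only [P]
      rw [Finset.sum_range]
      refine Finset.sum_congr rfl fun a _ => ?_
      have hne : (Fin.castSucc a : Fin 6) ≠ 5 := by
        rw [← h5]; exact (Fin.castSucc_lt_last a).ne
      simp only [θ, R, hne, if_false, Fin.val_castSucc, div_pow]
      field_simp
    rw [e1, h5]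
    simp only [θ, R, if_true]
    have : ((5 : Fin 6) : ℕ) = 5 := rfl
    rw [this]
    field_simp
    ring
  have hdet := abs_det_le_of_expansion (C := 3 * C + 1) hδ.le hδ1 θ R ?_ ?_ ?_
  rotate_left
  · intro j a
    by_cases ha : a = 5
    · simp [θ, ha]
    · simp only [θ, ha, if_false, abs_pow]
      refine pow_le_one₀ (abs_nonneg _) ?_
      rw [abs_div, abs_of_pos hδ, div_le_one hδ]
      exact (hxδ j 0).le
  · intro j a i
    by_cases ha : a = 5
    · simp only [R, ha, if_true]
      rw [abs_div, abs_of_pos (by positivity : 0 < δ ^ 5), div_le_iff₀ (by positivity)]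
      have h1 := taylor_tower 5 (fd i) Set.ordConnected_Icc (fun j _ => h.deriv i j)
        (h.bound i 5 (by norm_num)) hsI (hx j).2.2.2.1
      have h2 := h.abs_quadMon_sub_le (hx j).2.2.2.1 (hx j).2.2.2.2 hε1 i
      have h3 : C * |affU (x j) - s| ^ 5 ≤ C * δ ^ 5 := by
        have := (hxδ j 0).le
        gcongr
      have h4 : (2 * C + 1) * ε ≤ (2 * C + 1) * δ ^ 5 := by gcongr
      have h5 := abs_sub_le (quadMon (affU (x j)) (affV (x j)) i) (fd i 0 (affU (x j))) (P j i)
      linarith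
    · simp only [R, ha, if_false]
      rw [abs_div]
      have h1 := h.bound i a (by omega) s hsI
      have h2 : (1 : ℝ) ≤ |((a : ℕ).factorial : ℝ)| := by
        rw [abs_of_pos (by positivity)]
        exact_mod_cast Nat.one_le_iff_ne_zero.2 (Nat.factorial_ne_zero _)
      calc _ ≤ |fd i a s| := div_le_self (abs_nonneg _) h2
        _ ≤ _ := by linarith
  · intro j j' a ha
    simp [R, ha]
  have hcol : Matrix.det (Matrix.of fun j i => (intQuadMon (x j) i : ℝ)) =
      (∏ j, (x j 0 : ℝ) ^ 2) * Matrix.det (Matrix.of fun j i => ∑ a : Fin 6,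
        δ ^ (a : ℕ) * θ j a * R j a i) := by
    rw [← Matrix.det_mul_column]
    congr 1
    ext j i
    simp only [Matrix.of_apply, ← hexp, intQuadMon_eq (hx j).2.1]
  have hprod : |∏ j, (x j 0 : ℝ) ^ 2| ≤ B ^ 12 := by
    rw [Finset.abs_prod]
    calc ∏ j, |(x j 0 : ℝ) ^ 2| ≤ ∏ _j : Fin 6, B ^ 2 := by
          refine Finset.prod_le_prod (fun _ _ => abs_nonneg _) fun j _ => ?_
          rw [abs_pow]
          have := (hx j).2.2.1
          gcongr
      _ = B ^ 12 := by simp; ring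
  have hB12 : 0 ≤ B ^ 12 := (abs_nonneg _).trans hprod
  have hcast : Matrix.det (Matrix.of fun j i => (intQuadMon (x j) i : ℝ)) =
      ((Matrix.det (Matrix.of fun j i => intQuadMon (x j) i) : ℤ) : ℝ) := by
    exact ((Int.castRingHom ℝ).map_det (Matrix.of fun j i => intQuadMon (x j) i)).symm
  have hlt : |Matrix.det (Matrix.of fun j i => (intQuadMon (x j) i : ℝ))| < 1 := by
    refine lt_of_le_of_lt ?_ hB
    rw [hcol, abs_mul]
    gcongr
  rw [hcast] at hlt ⊢
  have : Matrix.det (Matrix.of fun j i => intQuadMon (x j) i) = 0 := by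
    rw [← Int.abs_lt_one_iff]; exact_mod_cast hlt
  rw [this]; norm_num

/-- Points in a short arc lie on a common conic, along which the pulled back equation is small. -/
lemma QuadTower.exists_conic {g : ℝ → ℝ} {fd : Fin 6 → ℕ → ℝ → ℝ} {a b C ε B δ : ℝ}
    (h : QuadTower g fd a b C) (hδ : 0 < δ) (hδ1 : δ ≤ 1) (hεδ : ε ≤ δ ^ 5)
    (hB : B ^ 12 * (6 ^ 6 * (720 * (3 * C + 1) ^ 6) * δ ^ 15) < 1)
    (T : Finset (Fin 3 → ℤ)) (hT : ∀ x ∈ T, NearGraph g ε B a b x)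
    (hTδ : ∀ x ∈ T, ∀ y ∈ T, |affU x - affU y| < δ) :
    ∃ c : Fin 6 → ℝ, ‖c‖ = 1 ∧
      ∀ x ∈ T, |∑ i, c i * fd i 0 (affU x)| ≤ 6 * (2 * C + 1) * ε := by
  obtain ⟨c, hc, hcT⟩ := exists_common_annihilator T (fun x i => (intQuadMon x i : ℝ))
    fun x hx => h.det_eq_zero hδ hδ1 hεδ hB x (fun j => hT _ (hx j))
      fun j j' => hTδ _ (hx j) _ (hx j')
  refine ⟨c, hc, fun x hx => ?_⟩
  have hε1 : ε ≤ 1 := hεδ.trans (pow_le_one₀ hδ.le hδ1)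
  have hx0 : (x 0 : ℝ) ≠ 0 := by exact_mod_cast (hT x hx).2.1
  have h0 : ∑ i, c i * quadMon (affU x) (affV x) i = 0 := by
    have := hcT x hx
    simp only [intQuadMon_eq (hT x hx).2.1, mul_left_comm _ ((x 0 : ℝ) ^ 2)] at this
    rw [← Finset.mul_sum] at this
    exact (mul_eq_zero.1 this).resolve_left (pow_ne_zero _ hx0)
  have e : ∑ i, c i * fd i 0 (affU x) =
      -∑ i, c i * (quadMon (affU x) (affV x) i - fd i 0 (affU x)) := by
    simp only [mul_sub, Finset.sum_sub_distrib, h0]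
    ring
  rw [e, abs_neg]
  calc _ ≤ ∑ i, |c i * (quadMon (affU x) (affV x) i - fd i 0 (affU x))| :=
        Finset.abs_sum_le_sum_abs _ _
    _ ≤ ∑ _i : Fin 6, (2 * C + 1) * ε := by
        refine Finset.sum_le_sum fun i _ => ?_
        rw [abs_mul]
        have h1 : |c i| ≤ 1 := by
          rw [← hc]; exact norm_le_pi_norm c i
        have h2 := h.abs_quadMon_sub_le (hT x hx).2.2.2.1 (hT x hx).2.2.2.2 hε1 i
        calc _ ≤ 1 * |quadMon (affU x) (affV x) i - fd i 0 (affU x)| := by gcongr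
          _ ≤ _ := by linarith
    _ = _ := by simp; ring

/-- Where the Wronskian does not vanish, every normalized combination has a large derivative of
order at most five near each point, uniformly. -/
lemma QuadTower.exists_uniform_lower {g : ℝ → ℝ} {fd : Fin 6 → ℕ → ℝ → ℝ} {a b C a' b' : ℝ}
    (h : QuadTower g fd a b C) (hK : Set.Icc a' b' ⊆ Set.Icc a b) (hab : a' ≤ b')
    (hW : ∀ s ∈ Set.Icc a' b', Matrix.det (Matrix.of fun i j : Fin 6 => fd i j s) ≠ 0) :
    ∃ η > 0, ∃ r > 0, ∀ c : Fin 6 → ℝ, ‖c‖ = 1 → ∀ s ∈ Set.Icc a' b', ∃ j ≤ 5,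
      ∀ t ∈ Set.Icc a' b', |t - s| < r → η ≤ |∑ i, c i * fd i j t| := by
  have haI : a' ∈ Set.Icc a b := hK (Set.left_mem_Icc.2 hab)
  obtain ⟨hC1, -, -⟩ := h.one_le haI
  let Φ : (Fin 6 → ℝ) × ℝ → Fin 6 → ℝ := fun q j => ∑ i, q.1 i * fd i j q.2
  have hΦ : ContinuousOn (fun q => ‖Φ q‖) (Metric.sphere 0 1 ×ˢ Set.Icc a' b') := by
    refine ContinuousOn.norm (continuousOn_pi.2 fun j => ?_)
    refine continuousOn_finsetSum _ fun i _ => ContinuousOn.mul (by fun_prop) ?_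
    have : ContinuousOn (fd i j) (Set.Icc a b) := fun s hs =>
      (h.deriv i j s hs).continuousAt.continuousWithinAt
    exact this.comp (by fun_prop) fun q hq => hK hq.2
  have hcomp : IsCompact (Metric.sphere (0 : Fin 6 → ℝ) 1 ×ˢ Set.Icc a' b') :=
    (isCompact_sphere _ _).prod isCompact_Icc
  have hne : (Metric.sphere (0 : Fin 6 → ℝ) 1 ×ˢ Set.Icc a' b').Nonempty :=
    ((NormedSpace.sphere_nonempty (x := (0 : Fin 6 → ℝ)).2 zero_le_one)).prod ⟨a', by simp [hab]⟩
  obtain ⟨q, hq, hmin⟩ := hcomp.exists_isMinOn hne hΦ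
  have hpos : 0 < ‖Φ q‖ := by
    rw [norm_pos_iff]
    intro h0
    refine hW q.2 hq.2 (Matrix.exists_vecMul_eq_zero_iff.1 ⟨q.1, ?_, ?_⟩)
    · intro h1
      have := hq.1
      rw [h1] at this
      simp at this
    · funext j
      exact congrFun h0 j
  refine ⟨‖Φ q‖ / 2, by positivity, ‖Φ q‖ / (12 * C), by positivity, fun c hc s hs => ?_⟩
  have hcs : ‖Φ q‖ ≤ ‖Φ (c, s)‖ := hmin ⟨by simpa using hc, hs⟩
  obtain ⟨j, hj⟩ : ∃ j, ‖Φ q‖ ≤ ‖Φ (c, s) j‖ := by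
    by_contra! hlt
    exact absurd hcs (not_le.2 ((pi_norm_lt_iff hpos).2 hlt))
  refine ⟨j, by omega, fun t ht hts => ?_⟩
  have hdiff : |∑ i, c i * fd i j t - ∑ i, c i * fd i j s| ≤ 6 * (C * |t - s|) := by
    rw [← Finset.sum_sub_distrib]
    calc _ ≤ ∑ i, |c i * fd i j t - c i * fd i j s| := Finset.abs_sum_le_sum_abs _ _
      _ ≤ ∑ _i : Fin 6, C * |t - s| := by
          refine Finset.sum_le_sum fun i _ => ?_
          have h1 := taylor_tower 1 (fun m => fd i (j + m)) Set.ordConnected_Icc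
            (fun m _ => h.deriv i (j + m)) (h.bound i (j + 1) (by omega)) (hK hs) (hK ht)
          norm_num at h1
          rw [← mul_sub, abs_mul]
          have h2 : |c i| ≤ 1 := by
            rw [← hc]; exact norm_le_pi_norm c i
          calc _ ≤ 1 * |fd i j t - fd i j s| := by gcongr
            _ ≤ _ := by linarith
      _ = _ := by simp
  have h6 : 6 * (C * |t - s|) ≤ ‖Φ q‖ / 2 := by
    rw [lt_div_iff₀ (by positivity)] at hts
    linarith
  have h7 : ‖Φ q‖ ≤ |∑ i, c i * fd i j s| := hj
  have h8 := abs_sub_abs_le_abs_sub (∑ i, c i * fd i j s) (∑ i, c i * fd i j t)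
  rw [abs_sub_comm] at h8
  linarith

/-- Regular points over a short arc where the Wronskian does not vanish. -/
lemma QuadTower.card_regular_arc_le {gd : ℕ → ℝ → ℝ} {fd : Fin 6 → ℕ → ℝ → ℝ}
    {a b C ε B δ₀ ρ δ η r σ a' b' : ℝ}
    (h : QuadTower (gd 0) fd a b C) (hp : CellParams C ε B δ₀ ρ)
    (hd : ∀ j, ∀ s ∈ Set.Icc a b, HasDerivAt (gd j) (gd (j + 1) s) s)
    (hC : ∀ s ∈ Set.Icc a b, |gd 2 s| ≤ C) (hC3 : ∀ s ∈ Set.Icc a b, |gd 3 s| ≤ C)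
    (hK : Set.Icc a' b' ⊆ Set.Icc a b)
    (hW : ∀ c : Fin 6 → ℝ, ‖c‖ = 1 → ∀ s ∈ Set.Icc a' b', ∃ j ≤ 5,
      ∀ t ∈ Set.Icc a' b', |t - s| < r → η ≤ |∑ i, c i * fd i j t|)
    (hδ : 0 < δ) (hδ1 : δ ≤ 1) (hδr : δ ≤ r) (hεδ : ε ≤ δ ^ 5)
    (hB : B ^ 12 * (6 ^ 6 * (720 * (3 * C + 1) ^ 6) * δ ^ 15) < 1)
    (hσ : 0 < σ) (hσ2 : σ ≤ 2) (hlt : 6 * (2 * C + 1) * ε * (2 / σ) ^ 5 < η)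
    (T : Finset (Fin 3 → ℤ)) (hT : ∀ x ∈ T, NearGraph (gd 0) ε B a b x)
    (hreg : ∀ x ∈ T, ρ ≤ |gd 2 (affU x)|) (hT' : ∀ x ∈ T, affU x ∈ Set.Icc a' b')
    (hTδ : ∀ x ∈ T, ∀ y ∈ T, |affU x - affU y| < δ) :
    (T.card : ℝ) ≤ 186 * (2 * σ / δ₀ + 1) := by
  classical
  have hδ₀ := hp.δ_pos
  rcases T.eq_empty_or_nonempty with rfl | ⟨y, hy⟩
  · simp; positivity
  have hC1 := (h.one_le (hT y hy).2.2.2.1).1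
  obtain ⟨c, hc, hcT⟩ := h.exists_conic hδ hδ1 hεδ hB T hT hTδ
  obtain ⟨j, hj5, hj⟩ := hW c hc (affU y) (hT' y hy)
  set M := ⌊6 * (2 * σ / δ₀ + 1)⌋₊ with hM
  have hcard : T.card ≤ (2 ^ j - 1) * M := by
    refine card_le_of_sublevel (η := η) affU T j M (fun m s => ∑ i, c i * fd i m s)
      (J := Set.Icc a' b' ∩ Set.Ioo (affU y - r) (affU y + r))
      (Set.ordConnected_Icc.inter Set.ordConnected_Ioo) hσ ?_ ?_ ?_ hcT ?_ ?_
    · intro m _ s hs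
      exact HasDerivAt.fun_sum fun i _ => (h.deriv i m s (hK hs.1)).const_mul (c i)
    · rintro s ⟨hs, hs'⟩
      refine hj s hs ?_
      rw [abs_lt]; constructor <;> linarith [hs'.1, hs'.2]
    · intro x hx
      have := abs_lt.1 (hTδ x hx y hy)
      exact ⟨hT' x hx, by constructor <;> linarith [this.1, this.2]⟩
    · intro T' hTT' hclose
      refine Nat.le_floor ?_
      exact_mod_cast card_le_of_local_bound_close affU hδ₀ hσ 6 T' hclose
        fun U hU hUc => hp.card_le_six hd hC hC3 U (fun x hx => hT x (hTT' (hU hx)))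
          (fun x hx => hreg x (hTT' (hU hx))) hUc
    · refine lt_of_le_of_lt ?_ hlt
      have : 1 ≤ 2 / σ := by rw [le_div_iff₀ hσ]; linarith
      have := hp.ε_nonneg
      gcongr
  have h31 : 2 ^ j - 1 ≤ 31 := by
    have : 2 ^ j ≤ 2 ^ 5 := Nat.pow_le_pow_right (by norm_num) hj5
    omega
  calc (T.card : ℝ) ≤ ((31 * M : ℕ) : ℝ) := by
        exact_mod_cast hcard.trans (Nat.mul_le_mul_right M h31)
    _ = 31 * (M : ℝ) := by push_cast; ring
    _ ≤ 31 * (6 * (2 * σ / δ₀ + 1)) := by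
        gcongr
        exact Nat.floor_le (by positivity)
    _ = _ := by ring

set_option maxHeartbeats 1000000 in
/-- Regular points over an interval where the Wronskian does not vanish are negligible. -/
lemma QuadTower.eventually_card_regular_le {gd : ℕ → ℝ → ℝ} {fd : Fin 6 → ℕ → ℝ → ℝ}
    {a b C C₀ τ κ a' b' : ℝ}
    (h : QuadTower (gd 0) fd a b C) (hC₀ : 0 ≤ C₀) (hτ : 9 / 2 < τ) (hτ5 : τ < 5) (hκ : 0 < κ)
    (hd : ∀ j, ∀ s ∈ Set.Icc a b, HasDerivAt (gd j) (gd (j + 1) s) s)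
    (hC : ∀ s ∈ Set.Icc a b, |gd 2 s| ≤ C) (hC3 : ∀ s ∈ Set.Icc a b, |gd 3 s| ≤ C)
    (hK : Set.Icc a' b' ⊆ Set.Icc a b) (hab : a' ≤ b')
    (hW : ∀ s ∈ Set.Icc a' b', Matrix.det (Matrix.of fun i j : Fin 6 => fd i j s) ≠ 0) :
    ∀ᶠ B : ℝ in atTop, ∀ T : Finset (Fin 3 → ℤ),
      (∀ x ∈ T, NearGraph (gd 0) (C₀ * B ^ (-τ)) B a b x) →
      (∀ x ∈ T, (8 * C₀ + 1) * B ^ (4 - τ) ≤ |gd 2 (affU x)|) →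
      (∀ x ∈ T, affU x ∈ Set.Icc a' b') → (T.card : ℝ) ≤ κ * B := by
  classical
  obtain ⟨hC1, -, -⟩ := h.one_le (hK (Set.left_mem_Icc.2 hab))
  have hC0 : 0 ≤ C := zero_le_one.trans hC1
  obtain ⟨η, hη, r, hr, hunif⟩ := h.exists_uniform_lower hK hab hW
  set c := 1 / (6 * (C + 1)) with hc
  have hc0 : 0 < c := by positivity
  set α := (4 + τ) / 10 with hα
  set K := 192 * (2 * C + 1) * C₀ / η + 1 with hKdef
  have hK1 : 1 ≤ K := by
    rw [hKdef]; have : 0 ≤ 192 * (2 * C + 1) * C₀ / η := by positivity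
    linarith
  set K₁ := 186 * (2 * K / c + 1) with hK₁
  set K₂ := (b' - a') + 1 with hK₂
  have hba : 0 ≤ b' - a' := by linarith
  filter_upwards [eventually_cellParams hC0 hC₀ hτ hτ5,
    eventually_mul_rpow_le_mul (K₁ * K₂) (e := 1 - τ / 5 + α) (by rw [hα]; linarith) hκ,
    eventually_mul_rpow_le_mul (K₁ * K₂) (e := α) (by rw [hα]; linarith) hκ,
    eventually_mul_rpow_lt 1 (e := -α) (by rw [hα]; linarith) hr,
    eventually_mul_rpow_lt C₀ (e := 5 * α - τ) (κ := 1) (by rw [hα]; linarith) one_pos,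
    eventually_mul_rpow_lt (6 ^ 6 * (720 * (3 * C + 1) ^ 6)) (e := 12 - 15 * α) (κ := 1)
      (by rw [hα]; linarith) one_pos,
    eventually_mul_rpow_lt K (e := -τ / 5) (κ := 2) (by linarith) two_pos,
    eventually_ge_atTop 1] with B hp h1 h1' h2 h3 h4 h5 hB1 T hT hreg hT'
  have hB := hp.B_pos
  have hpα : 0 < B ^ (-α) := Real.rpow_pos_of_pos hB _
  have hpτ : 0 < B ^ (-τ) := Real.rpow_pos_of_pos hB _
  have hpτ5 : 0 < B ^ (-τ / 5) := Real.rpow_pos_of_pos hB _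
  have hδ1 : B ^ (-α) ≤ 1 := Real.rpow_le_one_of_one_le_of_nonpos hB1 (by rw [hα]; linarith)
  have e5 : (B ^ (-α)) ^ 5 = B ^ (-(5 * α)) := by
    rw [← Real.rpow_natCast, ← Real.rpow_mul hB.le]; congr 1; push_cast; ring
  have e15 : (B ^ (-α)) ^ 15 = B ^ (-(15 * α)) := by
    rw [← Real.rpow_natCast, ← Real.rpow_mul hB.le]; congr 1; push_cast; ring
  have eσ : (B ^ (-τ / 5)) ^ 5 = B ^ (-τ) := by
    rw [← Real.rpow_natCast, ← Real.rpow_mul hB.le]; congr 1; push_cast; ring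
  set M := ⌊186 * (2 * (K * B ^ (-τ / 5)) / (c / B) + 1)⌋₊ with hM
  have hcard := card_le_of_local_bound affU hpα hab M T hT' fun U hU hUc => by
    refine Nat.le_floor (h.card_regular_arc_le (r := r) (η := η) (σ := K * B ^ (-τ / 5)) hp hd hC hC3
      hK hunif hpα hδ1 (by linarith) ?_ ?_ (by positivity) h5.le ?_ U
      (fun x hx => hT x (hU hx)) (fun x hx => hreg x (hU hx)) (fun x hx => hT' x (hU hx)) hUc)
    · rw [e5]
      have : B ^ (-τ) = B ^ (5 * α - τ) * B ^ (-(5 * α)) := by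
        rw [← Real.rpow_add hB]; congr 1; ring
      rw [this, ← mul_assoc]
      have hp5 : 0 < B ^ (-(5 * α)) := Real.rpow_pos_of_pos hB _
      nlinarith
    · rw [e15]
      have : B ^ (12 - 15 * α) = B ^ 12 * B ^ (-(15 * α)) := by
        rw [sub_eq_add_neg, Real.rpow_add hB]; norm_cast
      rw [this] at h4
      linarith
    · have : 6 * (2 * C + 1) * (C₀ * B ^ (-τ)) * (2 / (K * B ^ (-τ / 5))) ^ 5 =
          192 * (2 * C + 1) * C₀ / K ^ 5 := by
        rw [div_pow, mul_pow, eσ]; field_simp; ring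
      rw [this, div_lt_iff₀ (by positivity)]
      have h6 : K ≤ K ^ 5 := le_self_pow₀ hK1 (by norm_num)
      have h7 : 192 * (2 * C + 1) * C₀ = η * (K - 1) := by rw [hKdef]; field_simp; ring
      nlinarith
  have hMle : (M : ℝ) ≤ 186 * (2 * K / c * B ^ (1 - τ / 5) + 1) := by
    refine (Nat.floor_le (by positivity)).trans (le_of_eq ?_)
    have : B ^ (1 - τ / 5) = B ^ (-τ / 5) * B := by
      rw [← Real.rpow_add_one hB.ne']; congr 1; ring
    have e6 : 2 * (K * B ^ (-τ / 5)) / (c / B) = 2 * K / c * (B ^ (-τ / 5) * B) := by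
      rw [div_div_eq_mul_div]; ring
    rw [this, e6]
  have hlen : (b' - a') / B ^ (-α) + 1 ≤ K₂ * B ^ α := by
    have : 1 ≤ B ^ α := Real.one_le_rpow hB1 (by rw [hα]; linarith)
    rw [Real.rpow_neg hB.le, div_inv_eq_mul]
    rw [hK₂]; nlinarith
  have hMmax : (M : ℝ) ≤ K₁ * max (B ^ (1 - τ / 5)) 1 := by
    have h6 : 2 * K / c * B ^ (1 - τ / 5) ≤ 2 * K / c * max (B ^ (1 - τ / 5)) 1 := by
      gcongr; exact le_max_left _ _
    have h7 := le_max_right (B ^ (1 - τ / 5)) 1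
    rw [hK₁]; linarith
  have hBα : 0 < B ^ α := Real.rpow_pos_of_pos hB _
  calc (T.card : ℝ) ≤ _ := hcard
    _ ≤ (K₁ * max (B ^ (1 - τ / 5)) 1) * (K₂ * B ^ α) := by gcongr
    _ = K₁ * K₂ * max (B ^ (1 - τ / 5 + α)) (B ^ α) := by
        rw [Real.rpow_add hB, mul_mul_mul_comm, max_mul_of_nonneg _ _ hBα.le, one_mul]
    _ ≤ κ * B := by
        rcases max_choice (B ^ (1 - τ / 5 + α)) (B ^ α) with h6 | h6 <;> rw [h6] <;> assumption

/-- The number of primitive integer points in a thin neighbourhood of a graph is `o(B)` provided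
one of the second and third derivatives does not vanish and the Wronskian of the quadratic
monomials vanishes at one point at most. -/
theorem QuadTower.eventually_card_le {gd : ℕ → ℝ → ℝ} {fd : Fin 6 → ℕ → ℝ → ℝ}
    {s₀ r C C₀ τ κ η : ℝ} (hr : 0 < r)
    (h : QuadTower (gd 0) fd (s₀ - r) (s₀ + r) C) (hC₀ : 0 ≤ C₀) (hτ : 9 / 2 < τ) (hτ5 : τ < 5)
    (hκ : 0 < κ)
    (hd : ∀ j, ∀ s ∈ Set.Icc (s₀ - r) (s₀ + r), HasDerivAt (gd j) (gd (j + 1) s) s)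
    (hC : ∀ s ∈ Set.Icc (s₀ - r) (s₀ + r), |gd 2 s| ≤ C)
    (hC3 : ∀ s ∈ Set.Icc (s₀ - r) (s₀ + r), |gd 3 s| ≤ C) (hη0 : 0 < η)
    (hη : (∀ s ∈ Set.Icc (s₀ - r) (s₀ + r), η ≤ |gd 2 s|) ∨
      ∀ s ∈ Set.Icc (s₀ - r) (s₀ + r), η ≤ |gd 3 s|)
    (hW : ∀ s ∈ Set.Icc (s₀ - r) (s₀ + r), s ≠ s₀ →
      Matrix.det (Matrix.of fun i j : Fin 6 => fd i j s) ≠ 0) :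
    ∀ᶠ B : ℝ in atTop, ∀ T : Finset (Fin 3 → ℤ),
      (∀ x ∈ T, NearGraph (gd 0) (C₀ * B ^ (-τ)) B (s₀ - r) (s₀ + r) x) →
      (T.card : ℝ) ≤ κ * B := by
  classical
  have hC0 : 0 ≤ C := zero_le_one.trans
    (h.one_le (Set.left_mem_Icc.2 (by linarith : s₀ - r ≤ s₀ + r))).1
  set c := 1 / (6 * (C + 1)) with hc
  have hc0 : 0 < c := by positivity
  set e := min (κ * c / 60) r with he
  have he0 : 0 < e := lt_min (by positivity) hr
  have her : e ≤ r := min_le_right _ _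
  have heκ : e ≤ κ * c / 60 := min_le_left _ _
  have hκ5 : 0 < κ / 5 := by positivity
  filter_upwards [eventually_cellParams hC0 hC₀ hτ hτ5,
    eventually_card_exceptional_le hC0 hC₀ hτ hτ5 hκ5 hd hC hη0 hη,
    h.eventually_card_regular_le (a' := s₀ - r) (b' := s₀ - e) hC₀ hτ hτ5 hκ5 hd hC hC3
      (Set.Icc_subset_Icc_right (by linarith)) (by linarith)
      (fun s hs => hW s ⟨hs.1, by linarith [hs.2]⟩ (by rintro rfl; linarith [hs.2])),
    h.eventually_card_regular_le (a' := s₀ + e) (b' := s₀ + r) hC₀ hτ hτ5 hκ5 hd hC hC3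
      (Set.Icc_subset_Icc_left (by linarith)) (by linarith)
      (fun s hs => hW s ⟨by linarith [hs.1], hs.2⟩ (by rintro rfl; linarith [hs.1])),
    eventually_ge_atTop (30 / κ)] with B hp hexc hleft hright hBκ T hT
  have hB := hp.B_pos
  set Tr := T.filter fun x => (8 * C₀ + 1) * B ^ (4 - τ) ≤ |gd 2 (affU x)| with hTr
  set Te := T.filter fun x => |gd 2 (affU x)| < (8 * C₀ + 1) * B ^ (4 - τ) with hTe
  set Tl := Tr.filter fun x => affU x ∈ Set.Icc (s₀ - r) (s₀ - e) with hTl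
  set Tm := Tr.filter fun x => affU x ∈ Set.Icc (s₀ - e) (s₀ + e) with hTm
  set Tu := Tr.filter fun x => affU x ∈ Set.Icc (s₀ + e) (s₀ + r) with hTu
  have hsub : T ⊆ Te ∪ (Tl ∪ (Tm ∪ Tu)) := by
    intro x hx
    have hI := (hT x hx).2.2.2.1
    simp only [Finset.mem_union, hTe, hTl, hTm, hTu, hTr, Finset.mem_filter, hx, true_and]
    rcases lt_or_ge |gd 2 (affU x)| ((8 * C₀ + 1) * B ^ (4 - τ)) with h1 | h1
    · exact Or.inl h1
    · rcases le_total (affU x) (s₀ - e) with h2 | h2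
      · exact Or.inr (Or.inl ⟨h1, hI.1, h2⟩)
      · rcases le_total (affU x) (s₀ + e) with h3 | h3
        · exact Or.inr (Or.inr (Or.inl ⟨h1, h2, h3⟩))
        · exact Or.inr (Or.inr (Or.inr ⟨h1, h3, hI.2⟩))
  have hTrm : ∀ x ∈ Tr, x ∈ T ∧ (8 * C₀ + 1) * B ^ (4 - τ) ≤ |gd 2 (affU x)| := fun x hx =>
    Finset.mem_filter.1 hx
  have c1 := hexc Te (fun x hx => hT x (Finset.mem_filter.1 hx).1)
    (fun x hx => (Finset.mem_filter.1 hx).2)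
  have c2 := hleft Tl (fun x hx => hT x (hTrm x (Finset.mem_filter.1 hx).1).1)
    (fun x hx => (hTrm x (Finset.mem_filter.1 hx).1).2) (fun x hx => (Finset.mem_filter.1 hx).2)
  have c3 := hright Tu (fun x hx => hT x (hTrm x (Finset.mem_filter.1 hx).1).1)
    (fun x hx => (hTrm x (Finset.mem_filter.1 hx).1).2) (fun x hx => (Finset.mem_filter.1 hx).2)
  have c4 := hp.card_regular_le hd hC hC3 (by linarith : s₀ - e ≤ s₀ + e) Tm
    (fun x hx => hT x (hTrm x (Finset.mem_filter.1 hx).1).1)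
    (fun x hx => (hTrm x (Finset.mem_filter.1 hx).1).2) (fun x hx => (Finset.mem_filter.1 hx).2)
  have c4' : (Tm.card : ℝ) ≤ 2 * (κ / 5 * B) := by
    refine c4.trans ?_
    have h1 : (s₀ + e - (s₀ - e)) / (c / B) = 2 * e / c * B := by field_simp; ring
    rw [h1]
    have h2 : 2 * e / c ≤ κ / 30 := by
      rw [div_le_iff₀ hc0]; linarith
    have h3 : 2 * e / c * B ≤ κ / 30 * B := by gcongr
    have h4 : 30 ≤ κ * B := by
      rw [div_le_iff₀ hκ] at hBκ; linarith
    linarith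
  have hcard : (T.card : ℝ) ≤ Te.card + (Tl.card + (Tm.card + Tu.card)) := by
    have h1 := Finset.card_le_card hsub
    have h2 := Finset.card_union_le Te (Tl ∪ (Tm ∪ Tu))
    have h3 := Finset.card_union_le Tl (Tm ∪ Tu)
    have h4 := Finset.card_union_le Tm Tu
    exact_mod_cast (by omega : T.card ≤ Te.card + (Tl.card + (Tm.card + Tu.card)))
  linarith

/-- Analytic functions that at every point have a nontrivial combination vanishing to high order
are linearly dependent. -/
lemma exists_linear_relation_of_order {n : ℕ} (f : Fin n → ℝ → ℝ) {a b : ℝ} (hab : a < b)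
    (hf : ∀ i, AnalyticOnNhd ℝ (f i) (Set.Ioo a b))
    (h : ∀ s ∈ Set.Ioo a b, ∃ c : Fin n → ℝ, c ≠ 0 ∧
      (n : ℕ∞) ≤ analyticOrderAt (fun t => ∑ i, c i * f i t) s) :
    ∃ a' b', a ≤ a' ∧ a' < b' ∧ b' ≤ b ∧ ∃ c : Fin n → ℝ, c ≠ 0 ∧
      ∀ s ∈ Set.Ioo a' b', ∑ i, c i * f i s = 0 := by
  induction n generalizing a b with
  | zero =>
    obtain ⟨c, hc, -⟩ := h ((a + b) / 2) ⟨by linarith, by linarith⟩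
    exact absurd (Subsingleton.elim c 0) hc
  | succ n ih =>
    by_cases h0 : ∀ s ∈ Set.Ioo a b, f 0 s = 0
    · refine ⟨a, b, le_rfl, hab, le_rfl, Pi.single 0 1, by simp, fun s hs => ?_⟩
      simp [Pi.single_apply, h0 s hs]
    push Not at h0
    obtain ⟨s₁, hs₁, hne⟩ := h0
    have hev : ∀ᶠ s in 𝓝 s₁, f 0 s ≠ 0 ∧ s ∈ Set.Ioo a b :=
      ((hf 0 s₁ hs₁).continuousAt.eventually_ne hne).and (isOpen_Ioo.mem_nhds hs₁)
    obtain ⟨a₁, b₁, hs, hsub⟩ := mem_nhds_iff_exists_Ioo_subset.1 hev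
    have hab₁ : a₁ < b₁ := hs.1.trans hs.2
    have hq : ∀ i : Fin n, AnalyticOnNhd ℝ (fun t => f i.succ t * (f 0 t)⁻¹) (Set.Ioo a₁ b₁) :=
      fun i s hs => (hf _ s (hsub hs).2).mul ((hf 0 s (hsub hs).2).inv (hsub hs).1)
    have hord' : ∀ s ∈ Set.Ioo a₁ b₁, ∃ c : Fin n → ℝ, c ≠ 0 ∧ (n : ℕ∞) ≤ analyticOrderAt
        (fun t => ∑ i, c i * deriv (fun t => f i.succ t * (f 0 t)⁻¹) t) s := by
      intro s hs
      obtain ⟨c, hc, hord⟩ := h s (hsub hs).2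
      have hfs := hf 0 s (hsub hs).2
      have hF : AnalyticAt ℝ (fun t => ∑ i, c i * f i t) s :=
        Finset.analyticAt_fun_sum _ fun i _ => analyticAt_const.mul (hf i s (hsub hs).2)
      have hG : AnalyticAt ℝ (fun t => c 0 + ∑ i : Fin n, c i.succ * (f i.succ t * (f 0 t)⁻¹)) s :=
        analyticAt_const.add (Finset.analyticAt_fun_sum _ fun i _ => analyticAt_const.mul (hq i s hs))
      have hFG : (fun t => c 0 + ∑ i : Fin n, c i.succ * (f i.succ t * (f 0 t)⁻¹)) =ᶠ[𝓝 s]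
          (fun t => ∑ i, c i * f i t) * fun t => (f 0 t)⁻¹ := by
        filter_upwards [hfs.continuousAt.eventually_ne (hsub hs).1] with t ht
        simp only [Pi.mul_apply]
        rw [Fin.sum_univ_succ, add_mul, Finset.sum_mul]
        congr 1
        · field_simp
        · exact Finset.sum_congr rfl fun i _ => by ring
      have hordG : ((n + 1 : ℕ) : ℕ∞) ≤ analyticOrderAt
          (fun t => c 0 + ∑ i : Fin n, c i.succ * (f i.succ t * (f 0 t)⁻¹)) s := by
        have hinv : AnalyticAt ℝ (fun t => (f 0 t)⁻¹) s := hfs.inv (hsub hs).1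
        rw [analyticOrderAt_congr hFG, analyticOrderAt_mul hF hinv]
        exact hord.trans le_self_add
      have hG0 := apply_eq_zero_of_analyticOrderAt_ne_zero (f := fun t => c 0 +
        ∑ i : Fin n, c i.succ * (f i.succ t * (f 0 t)⁻¹)) (z₀ := s)
        (by intro h0; rw [h0] at hordG; simp at hordG)
      refine ⟨fun i => c i.succ, ?_, ?_⟩
      · intro h0
        have h0' : ∀ i : Fin n, c i.succ = 0 := fun i => congrFun h0 i
        simp only [h0', zero_mul, Finset.sum_const_zero, add_zero] at hG0
        apply hc
        funext i
        refine Fin.cases hG0 h0' i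
      · have h1 := (analyticOrderAt_deriv_ge_iff hG hG0 (n := n)).2 (by exact_mod_cast hordG)
        refine h1.trans_eq (analyticOrderAt_congr ?_)
        filter_upwards [isOpen_Ioo.mem_nhds hs] with t ht
        have : HasDerivAt (fun t => c 0 + ∑ i : Fin n, c i.succ * (f i.succ t * (f 0 t)⁻¹))
          (∑ i : Fin n, c i.succ * deriv (fun t => f i.succ t * (f 0 t)⁻¹) t) t :=
          (HasDerivAt.fun_sum fun i _ =>
            ((hq i t ht).differentiableAt.hasDerivAt).const_mul (c i.succ)).const_add _
        exact this.deriv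
    obtain ⟨a', b', ha', hab', hb', c, hc, hcz⟩ := ih
      (fun i => deriv fun t => f i.succ t * (f 0 t)⁻¹) hab₁ (fun i s hs => (hq i s hs).deriv) hord'
    · have haa : a ≤ a₁ ∧ b₁ ≤ b := by
        have : Set.Ioo a₁ b₁ ⊆ Set.Ioo a b := fun s hs => (hsub hs).2
        exact (Set.Ioo_subset_Ioo_iff hab₁).1 this
      have hin : ∀ s ∈ Set.Ioo a' b', s ∈ Set.Ioo a₁ b₁ := fun s hs =>
        Set.Ioo_subset_Ioo ha' hb' hs
      have hder : ∀ s ∈ Set.Ioo a' b', HasDerivAt (fun t => ∑ i, c i * (f i.succ t * (f 0 t)⁻¹))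
          0 s := by
        intro s hs
        rw [← hcz s hs]
        exact HasDerivAt.fun_sum fun i _ =>
          ((hq i s (hin s hs)).differentiableAt.hasDerivAt).const_mul (c i)
      obtain ⟨κ, hκ⟩ := isOpen_Ioo.exists_is_const_of_deriv_eq_zero isPreconnected_Ioo
        (fun s hs => (hder s hs).differentiableAt.differentiableWithinAt)
        (fun s hs => (hder s hs).deriv)
      refine ⟨a', b', haa.1.trans ha', hab', hb'.trans haa.2, Fin.cons (-κ) c, ?_, fun s hs => ?_⟩
      · intro h0
        apply hc
        funext i
        simpa using congrFun h0 i.succ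
      · have h1 := hκ s hs
        have h2 : f 0 s ≠ 0 := (hsub (hin s hs)).1
        rw [Fin.sum_univ_succ]
        simp only [Fin.cons_zero, Fin.cons_succ]
        rw [← h1, neg_mul, Finset.sum_mul, neg_add_eq_zero]
        refine Finset.sum_congr rfl fun i _ => ?_
        field_simp

/-- Analytic functions with identically vanishing Wronskian are linearly dependent. -/
lemma exists_linear_relation_of_wronskian {n : ℕ} (f : Fin n → ℝ → ℝ) {a b : ℝ} (hab : a < b)
    (hf : ∀ i, AnalyticOnNhd ℝ (f i) (Set.Ioo a b))
    (h : ∀ s ∈ Set.Ioo a b,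
      Matrix.det (Matrix.of fun i j : Fin n => iteratedDeriv j (f i) s) = 0) :
    ∃ a' b', a ≤ a' ∧ a' < b' ∧ b' ≤ b ∧ ∃ c : Fin n → ℝ, c ≠ 0 ∧
      ∀ s ∈ Set.Ioo a' b', ∑ i, c i * f i s = 0 := by
  refine exists_linear_relation_of_order f hab hf fun s hs => ?_
  obtain ⟨c, hc, hcz⟩ := Matrix.exists_vecMul_eq_zero_iff.2 (h s hs)
  refine ⟨c, hc, ?_⟩
  have hF : AnalyticAt ℝ (fun t => ∑ i, c i * f i t) s :=
    Finset.analyticAt_fun_sum _ fun i _ => analyticAt_const.mul (hf i s hs)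
  rw [natCast_le_analyticOrderAt_iff_iteratedDeriv_eq_zero hF]
  intro j hj
  have h1 := congrFun hcz ⟨j, hj⟩
  simp only [Matrix.vecMul, dotProduct, Matrix.of_apply, Pi.zero_apply] at h1
  rw [← h1, iteratedDeriv_fun_sum]
  · refine Finset.sum_congr rfl fun i _ => ?_
    exact iteratedDeriv_const_mul_field _ _
  · intro i _
    exact contDiffAt_const.mul ((hf i s hs).contDiffAt)

lemma sum_mul_add_ite {R : Type*} [CommRing R] (a b : Fin 3 → R) (P Q : R) (j : Fin 3) :
    (∑ i, a i * b i) * Q + P * a j = ∑ i, a i * (b i * Q + P * (if i = j then 1 else 0)) := by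
  simp only [mul_add, Finset.sum_add_distrib, Finset.sum_mul, mul_ite, mul_one, mul_zero,
      Finset.sum_ite_eq', Finset.mem_univ, if_true]
  congr 1
  · exact Finset.sum_congr rfl fun i _ => by ring
  · ring

/-- Chain rule for a multivariate polynomial evaluated along a polynomial curve. -/
lemma derivative_aeval_curve (F : MvPolynomial (Fin 3) ℤ) (ψ : Fin 3 → Polynomial ℂ) :
    Polynomial.derivative (aeval ψ F) =
      ∑ i, Polynomial.derivative (ψ i) * aeval ψ (pderiv i F) := by
  induction F using MvPolynomial.induction_on with
  | C a =>
    simp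
  | add p q hp hq => simp only [map_add, hp, hq, mul_add, Finset.sum_add_distrib]
  | mul_X p j hp =>
    have h : ∀ i, aeval ψ (pderiv i (p * X j)) =
        aeval ψ (pderiv i p) * ψ j + aeval ψ p * (if i = j then 1 else 0) := by
      intro i
      rw [pderiv_mul, map_add, map_mul, map_mul, aeval_X, pderiv_X]
      congr 2
      rcases eq_or_ne i j with rfl | hij
      · simp
      · simp [hij, hij.symm]
    simp only [h]
    rw [map_mul, aeval_X, Polynomial.derivative_mul, hp]
    exact sum_mul_add_ite _ _ _ _ _

lemma eval_aeval_curve (F : MvPolynomial (Fin 3) ℤ) (ψ : Fin 3 → Polynomial ℂ) (t : ℂ) :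
    (aeval ψ F).eval t = aeval (fun i => (ψ i).eval t) F := by
  induction F using MvPolynomial.induction_on with
  | C a => simp
  | add p q hp hq => simp only [map_add, Polynomial.eval_add, hp, hq]
  | mul_X p j hp => simp only [map_mul, Polynomial.eval_mul, hp, aeval_X]

lemma aeval_smul_of_isHomogeneous {R : Type*} [CommRing R] [Algebra ℤ R]
    {F : MvPolynomial (Fin 3) ℤ} {m : ℕ}
    (hF : F.IsHomogeneous m) (s : R) (p : Fin 3 → R) :
    aeval (fun i => s * p i) F = s ^ m * aeval p F := by
  simp only [aeval_def]
  rw [eval₂_eq', eval₂_eq', Finset.mul_sum]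
  refine Finset.sum_congr rfl fun d hd => ?_
  have hd' : ∑ i, d i = m := by
    have := hF (mem_support_iff.1 hd)
    rwa [Finsupp.weight_apply, Finsupp.sum_fintype _ _ (by simp), Finset.sum_congr rfl
      (fun i _ => by simp : ∀ i ∈ Finset.univ, d i • (1 : Fin 3 → ℕ) i = d i)] at this
  simp only [mul_pow, Finset.prod_mul_distrib, Finset.prod_pow_eq_pow_sum, hd']
  ring

lemma euler_aeval {R : Type*} [CommRing R] [Algebra ℤ R] {F : MvPolynomial (Fin 3) ℤ} {k : ℕ}
    (hF : F.IsHomogeneous k) (ψ : Fin 3 → R) :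
    ∑ i, ψ i * aeval ψ (pderiv i F) = k * aeval ψ F := by
  have := congrArg (aeval ψ) hF.sum_X_mul_pderiv
  simpa [map_sum] using this

/-- A form of degree at least two that takes values of degree at most two in `t` along
`p₀ + t p₁ + t² p₂` vanishes at `p₂`. -/
lemma aeval_eq_zero_of_quadratic {G : MvPolynomial (Fin 3) ℤ} {m : ℕ} (hG : G.IsHomogeneous m)
    (hm : 2 ≤ m) (p₀ p₁ p₂ : Fin 3 → ℂ) (c₀ c₁ c₂ : ℂ)
    (h : ∀ t : ℂ, aeval (fun i => p₀ i + t * p₁ i + t ^ 2 * p₂ i) G = c₀ + c₁ * t + c₂ * t ^ 2) :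
    aeval p₂ G = 0 := by
  obtain ⟨n, rfl⟩ := Nat.exists_eq_add_of_le hm
  set ψ : Fin 3 → Polynomial ℂ := fun i => Polynomial.C (p₂ i) + Polynomial.C (p₁ i) * Polynomial.X
    + Polynomial.C (p₀ i) * Polynomial.X ^ 2 with hψ
  set P := aeval ψ G - Polynomial.X ^ (2 + 2 * n) * (Polynomial.C c₀ * Polynomial.X ^ 2
    + Polynomial.C c₁ * Polynomial.X + Polynomial.C c₂) with hP
  have hroot : ∀ s : ℂ, s ≠ 0 → P.eval s = 0 := by
    intro s hs
    have h1 := h s⁻¹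
    have h2 := aeval_smul_of_isHomogeneous hG (s ^ 2)
      (fun i => p₀ i + s⁻¹ * p₁ i + s⁻¹ ^ 2 * p₂ i)
    rw [h1] at h2
    have h3 : (fun i => (ψ i).eval s) =
        fun i => s ^ 2 * (p₀ i + s⁻¹ * p₁ i + s⁻¹ ^ 2 * p₂ i) := by
      funext i
      simp only [hψ, Polynomial.eval_add, Polynomial.eval_mul, Polynomial.eval_C,
        Polynomial.eval_X, Polynomial.eval_pow]
      field_simp
      ring
    rw [hP, Polynomial.eval_sub, eval_aeval_curve, h3, h2]
    simp only [Polynomial.eval_add, Polynomial.eval_mul, Polynomial.eval_C,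
        Polynomial.eval_X, Polynomial.eval_pow]
    field_simp
    ring
  have hP0 : P = 0 := by
    by_contra hne
    refine (Polynomial.finite_setOfPred_isRoot hne).not_infinite ?_
    refine Set.Infinite.mono (s := {0}ᶜ) (fun s hs => hroot s hs) ?_
    exact (Set.finite_singleton _).infinite_compl
  have h4 : P.eval 0 = 0 := by rw [hP0]; simp
  rw [hP, Polynomial.eval_sub, eval_aeval_curve] at h4
  simpa [hψ] using h4

/-- A vector field of gradients pairing to zero with a basis vanishes. -/
lemma eq_zero_of_pairing_eq_zero {M : Matrix (Fin 3) (Fin 3) ℂ} (hM : M.det ≠ 0) (w : Fin 3 → ℂ)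
    (h : ∀ j, ∑ i, M j i * w i = 0) : w = 0 :=
  Matrix.eq_zero_of_mulVec_eq_zero hM (funext h)

lemma exists_eq_C_of_forall_eval_ne_zero {P : Polynomial ℂ} (h : ∀ t, P.eval t ≠ 0) :
    ∃ c, P = Polynomial.C c := by
  by_contra hne
  have hd : P.degree ≠ 0 := fun hd => hne ⟨_, Polynomial.eq_C_of_degree_eq_zero hd⟩
  obtain ⟨t, ht⟩ := IsAlgClosed.exists_root P hd
  exact h t ht

section

variable {F : MvPolynomial (Fin 3) ℤ} {k : ℕ}

/-- A nonsingular form of degree at least three does not vanish along a nondegenerate conic. -/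
lemma aeval_conic_ne_zero (hk : 3 ≤ k) (hF : F.IsHomogeneous k)
    (hns : ∀ x : Fin 3 → ℂ, x ≠ 0 → ∃ i, aeval x (pderiv i F) ≠ 0)
    (M : Matrix (Fin 3) (Fin 3) ℂ) (hM : M.det ≠ 0) :
    aeval (fun i => Polynomial.C (M 0 i) + Polynomial.C (M 1 i) * Polynomial.X +
      Polynomial.C (M 2 i) * Polynomial.X ^ 2) F ≠ 0 := by
  intro h0
  set ψ : Fin 3 → Polynomial ℂ := fun i => Polynomial.C (M 0 i) +
    Polynomial.C (M 1 i) * Polynomial.X + Polynomial.C (M 2 i) * Polynomial.X ^ 2 with hψ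
  set H : Fin 3 → Polynomial ℂ := fun j => ∑ i, Polynomial.C (M j i) * aeval ψ (pderiv i F) with hH
  have hE := euler_aeval hF ψ
  have hD := derivative_aeval_curve F ψ
  rw [h0] at hE hD
  have hE' : H 0 + Polynomial.X * H 1 + Polynomial.X ^ 2 * H 2 = 0 := by
    rw [mul_zero] at hE
    rw [← hE]
    simp only [hH, hψ, Fin.sum_univ_three]
    ring
  have hD' : H 1 + 2 * Polynomial.X * H 2 = 0 := by
    rw [Polynomial.derivative_zero] at hD
    rw [hD]
    simp only [hH, hψ, Fin.sum_univ_three, Polynomial.derivative_add, Polynomial.derivative_C,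
      Polynomial.derivative_C_mul, Polynomial.derivative_X, Polynomial.derivative_X_pow]
    have h2 : Polynomial.C (2 : ℂ) = 2 := rfl
    simp [h2]
    ring
  have h1 : H 1 = -2 * Polynomial.X * H 2 := by linear_combination hD'
  have h2 : H 0 = Polynomial.X ^ 2 * H 2 := by
    linear_combination hE' - Polynomial.X * hD'
  have hHe : ∀ j t, (H j).eval t = ∑ i, M j i *
      aeval (fun i => M 0 i + t * M 1 i + t ^ 2 * M 2 i) (pderiv i F) := by
    intro j t
    simp only [hH, Polynomial.eval_finsetSum, Polynomial.eval_mul, Polynomial.eval_C,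
      eval_aeval_curve]
    refine Finset.sum_congr rfl fun i _ => ?_
    congr 3
    funext i
    simp [hψ]; ring
  have hψ0 : ∀ t : ℂ, (fun i => M 0 i + t * M 1 i + t ^ 2 * M 2 i) ≠ 0 := by
    intro t ht
    have : Matrix.vecMul ![1, t, t ^ 2] M = 0 := by
      funext i
      have := congrFun ht i
      simpa [Matrix.vecMul, dotProduct, Fin.sum_univ_three] using this
    have := Matrix.eq_zero_of_vecMul_eq_zero hM this
    simpa using congrFun this 0
  have h3 : ∀ t, (H 2).eval t ≠ 0 := by
    intro t ht
    obtain ⟨i, hi⟩ := hns _ (hψ0 t)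
    apply hi
    have := eq_zero_of_pairing_eq_zero hM
      (fun i => aeval (fun i => M 0 i + t * M 1 i + t ^ 2 * M 2 i) (pderiv i F)) (by
        intro j
        rw [← hHe j t]
        fin_cases j
        · simp [h2, ht]
        · simp [h1, ht]
        · exact ht)
    exact congrFun this i
  obtain ⟨c, hc⟩ := exists_eq_C_of_forall_eval_ne_zero h3
  have hM2 : M 2 ≠ 0 := by
    intro h0
    exact hM (Matrix.det_eq_zero_of_row_eq_zero 2 fun j => congrFun h0 j)
  obtain ⟨i, hi⟩ := hns (M 2) hM2
  apply hi
  refine aeval_eq_zero_of_quadratic (m := k - 1) hF.pderiv (by omega) (M 0) (M 1) (M 2)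
    (M⁻¹ i 2 * c) (M⁻¹ i 1 * (-2 * c)) (M⁻¹ i 0 * c) fun t => ?_
  set w : Fin 3 → ℂ := fun i => aeval (fun i => M 0 i + t * M 1 i + t ^ 2 * M 2 i) (pderiv i F)
    with hw
  have h5 : M.mulVec w = fun j => (H j).eval t := funext fun j => (hHe j t).symm
  have h6 : w = M⁻¹.mulVec (M.mulVec w) := by
    rw [Matrix.mulVec_mulVec, Matrix.nonsing_inv_mul _ (isUnit_iff_ne_zero.2 hM),
      Matrix.one_mulVec]
  have h7 := congrFun h6 i
  rw [h5] at h7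
  simp only [Matrix.mulVec, dotProduct, Fin.sum_univ_three] at h7
  rw [h1, h2, hc] at h7
  change w i = _
  rw [h7]
  simp
  ring

/-- A nonsingular form of degree at least three does not vanish along a line. -/
lemma aeval_line_ne_zero (hk : 3 ≤ k) (hF : F.IsHomogeneous k)
    (hns : ∀ x : Fin 3 → ℂ, x ≠ 0 → ∃ i, aeval x (pderiv i F) ≠ 0)
    (M : Matrix (Fin 3) (Fin 3) ℂ) (hM : M.det ≠ 0) :
    aeval (fun i => Polynomial.C (M 0 i) + Polynomial.C (M 1 i) * Polynomial.X) F ≠ 0 := by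
  intro h0
  set ψ : Fin 3 → Polynomial ℂ := fun i => Polynomial.C (M 0 i) +
    Polynomial.C (M 1 i) * Polynomial.X with hψ
  set H : Fin 3 → Polynomial ℂ := fun j => ∑ i, Polynomial.C (M j i) * aeval ψ (pderiv i F) with hH
  have hE := euler_aeval hF ψ
  have hD := derivative_aeval_curve F ψ
  rw [h0] at hE hD
  have hE' : H 0 + Polynomial.X * H 1 = 0 := by
    rw [mul_zero] at hE
    rw [← hE]
    simp only [hH, hψ, Fin.sum_univ_three]
    ring
  have h1 : H 1 = 0 := by
    rw [Polynomial.derivative_zero] at hD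
    rw [hD]
    simp only [hH, hψ, Fin.sum_univ_three, Polynomial.derivative_add, Polynomial.derivative_C,
      Polynomial.derivative_C_mul, Polynomial.derivative_X]
    simp
  have h2 : H 0 = 0 := by
    linear_combination hE' - Polynomial.X * h1
  have hHe : ∀ j t, (H j).eval t = ∑ i, M j i *
      aeval (fun i => M 0 i + t * M 1 i) (pderiv i F) := by
    intro j t
    simp only [hH, Polynomial.eval_finsetSum, Polynomial.eval_mul, Polynomial.eval_C,
      eval_aeval_curve]
    refine Finset.sum_congr rfl fun i _ => ?_
    congr 3
    funext i
    simp [hψ]; ring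
  have hψ0 : ∀ t : ℂ, (fun i => M 0 i + t * M 1 i) ≠ 0 := by
    intro t ht
    have : Matrix.vecMul ![1, t, 0] M = 0 := by
      funext i
      have := congrFun ht i
      simpa [Matrix.vecMul, dotProduct, Fin.sum_univ_three] using this
    have := Matrix.eq_zero_of_vecMul_eq_zero hM this
    simpa using congrFun this 0
  have h3 : ∀ t, (H 2).eval t ≠ 0 := by
    intro t ht
    obtain ⟨i, hi⟩ := hns _ (hψ0 t)
    apply hi
    have := eq_zero_of_pairing_eq_zero hM
      (fun i => aeval (fun i => M 0 i + t * M 1 i) (pderiv i F)) (by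
        intro j
        rw [← hHe j t]
        fin_cases j
        · simp [h2]
        · simp [h1]
        · exact ht)
    exact congrFun this i
  obtain ⟨c, hc⟩ := exists_eq_C_of_forall_eval_ne_zero h3
  have hM1 : M 1 ≠ 0 := by
    intro h0
    exact hM (Matrix.det_eq_zero_of_row_eq_zero 1 fun j => congrFun h0 j)
  obtain ⟨i, hi⟩ := hns (M 1) hM1
  apply hi
  refine aeval_eq_zero_of_quadratic (m := k - 1) hF.pderiv (by omega) (M 0) 0 (M 1)
    (M⁻¹ i 2 * c) 0 0 fun t => ?_
  set w : Fin 3 → ℂ := fun i => aeval (fun i => M 0 i + t ^ 2 * M 1 i) (pderiv i F)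
    with hw
  have h5 : M.mulVec w = fun j => (H j).eval (t ^ 2) := funext fun j => (hHe j _).symm
  have h6 : w = M⁻¹.mulVec (M.mulVec w) := by
    rw [Matrix.mulVec_mulVec, Matrix.nonsing_inv_mul _ (isUnit_iff_ne_zero.2 hM),
      Matrix.one_mulVec]
  have h7 := congrFun h6 i
  rw [h5] at h7
  simp only [Matrix.mulVec, dotProduct, Fin.sum_univ_three] at h7
  rw [h1, h2, hc] at h7
  have h8 : (fun i => M 0 i + t * (0 : Fin 3 → ℂ) i + t ^ 2 * M 1 i) =
      fun i => M 0 i + t ^ 2 * M 1 i := by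
    funext i; simp
  rw [h8]
  change w i = _
  rw [h7]
  simp

end

lemma aeval_ofReal (F : MvPolynomial (Fin 3) ℤ) (x : Fin 3 → ℝ) :
    aeval (fun i => (x i : ℂ)) F = ((aeval x F : ℝ) : ℂ) :=
  aeval_algebraMap_apply ℂ x F

lemma polynomial_eq_zero_of_real_zeros {P : Polynomial ℂ} {S : Set ℝ} (hS : S.Infinite)
    (h : ∀ t ∈ S, P.eval (t : ℂ) = 0) : P = 0 := by
  by_contra hne
  refine (Polynomial.finite_setOfPred_isRoot hne).not_infinite ?_
  refine (hS.image (f := fun t : ℝ => (t : ℂ)) Complex.ofReal_injective.injOn).mono ?_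
  rintro _ ⟨t, ht, rfl⟩
  exact h t ht

lemma not_affine {F : MvPolynomial (Fin 3) ℤ} {k : ℕ} (hk : 3 ≤ k) (hF : F.IsHomogeneous k)
    (hns : ∀ x : Fin 3 → ℂ, x ≠ 0 → ∃ i, aeval x (pderiv i F) ≠ 0)
    {g : ℝ → ℝ} {a b : ℝ} (hab : a < b) (hg0 : ∀ s ∈ Set.Ioo a b, aeval ![1, s, g s] F = (0 : ℝ))
    (α β : ℝ) (h : ∀ s ∈ Set.Ioo a b, g s = α + β * s) : False := by
  refine aeval_line_ne_zero hk hF hns !![1, 0, (α : ℂ); 0, 1, (β : ℂ); 0, 0, 1]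
    (by simp [Matrix.det_fin_three]) ?_
  refine polynomial_eq_zero_of_real_zeros (Set.Ioo_infinite hab) fun t ht => ?_
  rw [eval_aeval_curve]
  have h1 := hg0 t ht
  rw [h t ht] at h1
  have h2 := aeval_ofReal F ![1, t, α + β * t]
  rw [h1] at h2
  rw [Complex.ofReal_zero] at h2
  refine Eq.trans ?_ h2
  congr 2
  funext i
  fin_cases i <;> simp

lemma slopes_infinite {F : MvPolynomial (Fin 3) ℤ} {k : ℕ} (hk : 3 ≤ k) (hF : F.IsHomogeneous k)
    (hns : ∀ x : Fin 3 → ℂ, x ≠ 0 → ∃ i, aeval x (pderiv i F) ≠ 0)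
    {g : ℝ → ℝ} {u b : ℝ} (hab : u < b) (hg0 : ∀ s ∈ Set.Ioo u b, aeval ![1, s, g s] F = (0 : ℝ))
    (hg : ContinuousOn g (Set.Ioo u b)) :
    ((fun s => (g s - g u) / (s - u)) '' Set.Ioo u b).Infinite := by
  have hc : IsPreconnected ((fun s => (g s - g u) / (s - u)) '' Set.Ioo u b) := by
    refine isPreconnected_Ioo.image _ ?_
    refine (hg.sub continuousOn_const).div (continuousOn_id.sub continuousOn_const) ?_
    exact fun s hs => (sub_pos.2 hs.1).ne'
  refine hc.infinite_of_nontrivial ?_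
  by_contra hn
  rw [Set.not_nontrivial_iff] at hn
  have hm : (u + b) / 2 ∈ Set.Ioo u b := ⟨by linarith, by linarith⟩
  set σ := (g ((u + b) / 2) - g u) / ((u + b) / 2 - u)
  refine not_affine hk hF hns hab hg0 (g u - σ * u) σ fun s hs => ?_
  have h1 : (g s - g u) / (s - u) = σ :=
    hn (Set.mem_image_of_mem (fun s => (g s - g u) / (s - u)) hs)
      (Set.mem_image_of_mem (fun s => (g s - g u) / (s - u)) hm)
  rw [div_eq_iff (sub_pos.2 hs.1).ne'] at h1
  linarith

lemma exists_deriv_deriv_ne_zero {F : MvPolynomial (Fin 3) ℤ} {k : ℕ} (hk : 3 ≤ k)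
    (hF : F.IsHomogeneous k)
    (hns : ∀ x : Fin 3 → ℂ, x ≠ 0 → ∃ i, aeval x (pderiv i F) ≠ 0)
    {g : ℝ → ℝ} {a b : ℝ} (hab : a < b) (hg0 : ∀ s ∈ Set.Ioo a b, aeval ![1, s, g s] F = (0 : ℝ))
    (hg : AnalyticOnNhd ℝ g (Set.Ioo a b)) : ∃ u ∈ Set.Ioo a b, deriv (deriv g) u ≠ 0 := by
  by_contra! h
  obtain ⟨β, hβ⟩ := isOpen_Ioo.exists_is_const_of_deriv_eq_zero isPreconnected_Ioo
    (fun s hs => (hg.deriv s hs).differentiableAt.differentiableWithinAt) h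
  have hd : ∀ s ∈ Set.Ioo a b, HasDerivAt (fun s => g s - β * s) 0 s := by
    intro s hs
    have h1 := ((hg s hs).differentiableAt.hasDerivAt).sub ((hasDerivAt_id s).const_mul β)
    rw [hβ s hs] at h1
    exact h1.congr_deriv (by simp)
  obtain ⟨α, hα⟩ := isOpen_Ioo.exists_is_const_of_deriv_eq_zero isPreconnected_Ioo
    (fun s hs => (hd s hs).differentiableAt.differentiableWithinAt) (fun s hs => (hd s hs).deriv)
  refine not_affine hk hF hns hab hg0 α β fun s hs => ?_
  have := hα s hs
  linarith

lemma no_conic_relation {F : MvPolynomial (Fin 3) ℤ} {k : ℕ} (hk : 3 ≤ k) (hF : F.IsHomogeneous k)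
    (hns : ∀ x : Fin 3 → ℂ, x ≠ 0 → ∃ i, aeval x (pderiv i F) ≠ 0)
    {g : ℝ → ℝ} {a₀ b₀ : ℝ} (hab : a₀ < b₀)
    (hg0 : ∀ s ∈ Set.Ioo a₀ b₀, aeval ![1, s, g s] F = (0 : ℝ))
    (hg : AnalyticOnNhd ℝ g (Set.Ioo a₀ b₀)) {q : Fin 6 → ℝ} (hq : q ≠ 0)
    (h : ∀ s ∈ Set.Ioo a₀ b₀, ∑ i, q i * quadMon s (g s) i = 0) : False := by
  obtain ⟨u₁, hu₁, hE⟩ := exists_deriv_deriv_ne_zero hk hF hns hab hg0 hg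
  set v₁ := g u₁ with hv₁
  set D := deriv g u₁ with hD
  obtain ⟨α, hα⟩ : ∃ α, α = q 1 + 2 * q 3 * u₁ + q 4 * v₁ := ⟨_, rfl⟩
  obtain ⟨β, hβ⟩ : ∃ β, β = q 2 + q 4 * u₁ + 2 * q 5 * v₁ := ⟨_, rfl⟩
  obtain ⟨a, ha⟩ : ∃ a, a = q 3 := ⟨_, rfl⟩
  obtain ⟨b, hb⟩ : ∃ b, b = q 4 := ⟨_, rfl⟩
  obtain ⟨c, hc⟩ : ∃ c, c = q 5 := ⟨_, rfl⟩
  have hexp : ∀ s ∈ Set.Ioo a₀ b₀, q 0 + q 1 * s + q 2 * g s + q 3 * s ^ 2 + q 4 * (s * g s) +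
      q 5 * g s ^ 2 = 0 := by
    intro s hs
    have := h s hs
    simp only [quadMon, Fin.sum_univ_succ] at this
    simp at this
    linear_combination this
  have hrel : ∀ s ∈ Set.Ioo a₀ b₀, α * (s - u₁) + β * (g s - v₁) + a * (s - u₁) ^ 2 +
      b * ((s - u₁) * (g s - v₁)) + c * (g s - v₁) ^ 2 = 0 := by
    intro s hs
    have h1 := hexp s hs
    have h2 := hexp u₁ hu₁
    rw [← hv₁] at h2
    rw [hα, hβ, ha, hb, hc]
    linear_combination h1 - h2
  have hgd : ∀ s ∈ Set.Ioo a₀ b₀, HasDerivAt g (deriv g s) s := fun s hs =>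
    (hg s hs).differentiableAt.hasDerivAt
  have hrel' : ∀ s ∈ Set.Ioo a₀ b₀, α + β * deriv g s + 2 * a * (s - u₁) +
      b * ((g s - v₁) + (s - u₁) * deriv g s) + 2 * c * (g s - v₁) * deriv g s = 0 := by
    intro s hs
    have hz := (hgd s hs).sub_const v₁
    have hw := (hasDerivAt_id s).sub_const u₁
    have h1 := ((((hw.const_mul α).add (hz.const_mul β)).add ((hw.pow 2).const_mul a)).add
      ((hw.mul hz).const_mul b)).add ((hz.pow 2).const_mul c)
    have h2 : (fun _ : ℝ => (0 : ℝ)) =ᶠ[𝓝 s] _ :=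
      (isOpen_Ioo.mem_nhds hs : _ ∈ 𝓝 s) |> fun h => Filter.mem_of_superset h
        fun t ht => (hrel t ht).symm
    have h3 := (h1.congr_of_eventuallyEq h2).unique (hasDerivAt_const s (0 : ℝ))
    simp at h3
    linear_combination h3
  have hrel2 : β * deriv (deriv g) u₁ + 2 * (a + b * D + c * D ^ 2) = 0 := by
    have hgdd : HasDerivAt (deriv g) (deriv (deriv g) u₁) u₁ :=
      (hg.deriv u₁ hu₁).differentiableAt.hasDerivAt
    have hz := (hgd u₁ hu₁).sub_const v₁
    have hw := (hasDerivAt_id u₁).sub_const u₁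
    have h1 := ((((hgdd.const_mul β).const_add α).add (hw.const_mul (2 * a))).add
      ((hz.add (hw.mul hgdd)).const_mul b)).add ((hz.const_mul (2 * c)).mul hgdd)
    have h2 : (fun _ : ℝ => (0 : ℝ)) =ᶠ[𝓝 u₁] _ :=
      (isOpen_Ioo.mem_nhds hu₁ : _ ∈ 𝓝 u₁) |> fun h => Filter.mem_of_superset h
        fun t ht => (hrel' t ht).symm
    have h3 := (h1.congr_of_eventuallyEq h2).unique (hasDerivAt_const u₁ (0 : ℝ))
    simp at h3
    rw [← hD, ← hv₁] at h3
    linear_combination h3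
  have hrel1 : α + β * D = 0 := by
    have := hrel' u₁ hu₁
    rw [← hD, ← hv₁] at this
    linear_combination this
  have hsub : Set.Ioo u₁ b₀ ⊆ Set.Ioo a₀ b₀ := Set.Ioo_subset_Ioo_left hu₁.1.le
  have hinf := slopes_infinite hk hF hns hu₁.2 (fun s hs => hg0 s (hsub hs))
    (hg.continuousOn.mono hsub)
  rw [← hv₁] at hinf
  have hslope : ∀ s ∈ Set.Ioo u₁ b₀, α + β * ((g s - v₁) / (s - u₁)) + (s - u₁) *
      (a + b * ((g s - v₁) / (s - u₁)) + c * ((g s - v₁) / (s - u₁)) ^ 2) = 0 := by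
    intro s hs
    have h1 := hrel s (hsub hs)
    have hne : s - u₁ ≠ 0 := (sub_pos.2 hs.1).ne'
    field_simp
    linear_combination h1
  by_cases hβ0 : β = 0
  · have hα0 : α = 0 := by rw [hβ0] at hrel1; simpa using hrel1
    have hP : (Polynomial.C (a : ℂ) + Polynomial.C (b : ℂ) * Polynomial.X +
        Polynomial.C (c : ℂ) * Polynomial.X ^ 2) = 0 := by
      refine polynomial_eq_zero_of_real_zeros hinf ?_
      rintro _ ⟨s, hs, rfl⟩
      have h1 := hslope s hs
      rw [hα0, hβ0] at h1
      have h2 : a + b * ((g s - v₁) / (s - u₁)) + c * ((g s - v₁) / (s - u₁)) ^ 2 = 0 := by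
        have hne : s - u₁ ≠ 0 := (sub_pos.2 hs.1).ne'
        simpa [hne] using h1
      simp only [Polynomial.eval_add, Polynomial.eval_mul, Polynomial.eval_C, Polynomial.eval_X,
        Polynomial.eval_pow]
      exact_mod_cast h2
    have h0 := congrArg (fun P => Polynomial.coeff P 0) hP
    have h1 := congrArg (fun P => Polynomial.coeff P 1) hP
    have h2 := congrArg (fun P => Polynomial.coeff P 2) hP
    simp [Polynomial.coeff_X, Polynomial.coeff_X_pow, Polynomial.coeff_C] at h0 h1 h2
    rw [h0] at ha
    rw [h1] at hb
    rw [h2] at hc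
    have e1 : q 1 = 0 := by rw [hα0, ← ha, ← hb] at hα; linarith
    have e2 : q 2 = 0 := by rw [hβ0, ← hc, ← hb] at hβ; linarith
    have e0 : q 0 = 0 := by
      have := hexp u₁ hu₁
      rw [e1, e2, ← ha, ← hb, ← hc] at this
      linarith
    apply hq
    funext i
    fin_cases i
    · exact e0
    · exact e1
    · exact e2
    · exact ha.symm
    · exact hb.symm
    · exact hc.symm
  · set MR : Matrix (Fin 3) (Fin 3) ℝ := !![a, a * u₁ - α, a * v₁; b, b * u₁ - β, b * v₁ - α;
      c, c * u₁, c * v₁ - β] with hMR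
    have hdet : MR.det ≠ 0 := by
      have : MR.det = - (β ^ 3 * deriv (deriv g) u₁) / 2 := by
        have hα' : α = - (β * D) := by linarith
        rw [hMR, Matrix.det_fin_three]
        simp
        rw [hα']
        linear_combination (β ^ 2 / 2) * hrel2
      rw [this]
      have := mul_ne_zero (pow_ne_zero 3 hβ0) hE
      simpa using this
    set M : Matrix (Fin 3) (Fin 3) ℂ := MR.map (fun x : ℝ => (x : ℂ)) with hM
    have hdetM : M.det ≠ 0 := by
      have : M.det = (MR.det : ℂ) := by
        rw [hM]
        exact (RingHom.map_det Complex.ofRealHom MR).symm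
      rw [this]
      exact_mod_cast hdet
    refine aeval_conic_ne_zero hk hF hns M hdetM ?_
    refine polynomial_eq_zero_of_real_zeros hinf ?_
    rintro _ ⟨s, hs, rfl⟩
    rw [eval_aeval_curve]
    have h1 := hslope s hs
    have hne : s - u₁ ≠ 0 := (sub_pos.2 hs.1).ne'
    have hgt : g s = v₁ + (s - u₁) * ((g s - v₁) / (s - u₁)) := by field_simp; ring
    simp only
    set t := (g s - v₁) / (s - u₁) with ht
    have h2 := aeval_smul_of_isHomogeneous hF (a + b * t + c * t ^ 2) ![1, s, g s]
    rw [hg0 s (hsub hs), mul_zero] at h2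
    have h3 := aeval_ofReal F (fun i => (a + b * t + c * t ^ 2) * ![1, s, g s] i)
    rw [h2, Complex.ofReal_zero] at h3
    refine Eq.trans ?_ h3
    congr 2
    funext i
    have h4 : MR 0 i + MR 1 i * t + MR 2 i * t ^ 2 =
        (a + b * t + c * t ^ 2) * ![1, s, g s] i := by
      fin_cases i
      · simp [hMR]
      · simp [hMR]
        linear_combination -h1
      · simp [hMR]
        rw [hgt]
        linear_combination -t * h1
    rw [← h4]
    simp [hM]

lemma analyticAt_aeval_real (F : MvPolynomial (Fin 3) ℤ) (x : Fin 3 → ℝ) :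
    AnalyticAt ℝ (fun x : Fin 3 → ℝ => aeval x F) x :=
  AnalyticAt.aeval_mvPolynomial (f := fun x : Fin 3 → ℝ => x)
    (fun i => (ContinuousLinearMap.proj (R := ℝ) (φ := fun _ : Fin 3 => ℝ) i).analyticAt x) F

lemma iteratedDeriv_two_or_three_ne_zero {F : MvPolynomial (Fin 3) ℤ} {k : ℕ} (hk : 3 ≤ k)
    (hF : F.IsHomogeneous k)
    (hns : ∀ x : Fin 3 → ℂ, x ≠ 0 → ∃ i, aeval x (pderiv i F) ≠ 0)
    (hν : ∀ p v : Fin 3 → ℂ, p ≠ 0 → aeval p F = 0 → (∀ c : ℂ, v ≠ c • p) →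
      contactOrder F p v ≤ 3)
    {g : ℝ → ℝ} {u : ℝ} (hg : AnalyticAt ℝ g u)
    (hg0 : ∀ᶠ s in 𝓝 u, aeval ![1, s, g s] F = (0 : ℝ)) :
    iteratedDeriv 2 g u ≠ 0 ∨ iteratedDeriv 3 g u ≠ 0 := by
  by_contra! hcon
  obtain ⟨h2, h3⟩ := hcon
  set D := deriv g u with hD
  set p : Fin 3 → ℂ := ![1, (u : ℂ), (g u : ℂ)] with hp
  set v : Fin 3 → ℂ := ![0, 1, (D : ℂ)] with hv
  have hF0 : aeval p F = 0 := by
    have := aeval_ofReal F ![1, u, g u]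
    rw [hg0.self_of_nhds, Complex.ofReal_zero] at this
    refine Eq.trans ?_ this
    congr 2
    funext i
    fin_cases i <;> simp [hp]
  have hp0 : p ≠ 0 := fun h => by simpa [hp] using congrFun h 0
  have hpv : ∀ c : ℂ, v ≠ c • p := by
    intro c hc
    have h0 := congrFun hc 0
    have h1 := congrFun hc 1
    simp [hp, hv] at h0 h1
    rw [← h0] at h1
    simp at h1
  have hmult := hν p v hp0 hF0 hpv
  set Q : Polynomial ℂ := aeval (fun i => Polynomial.C (p i) + Polynomial.C (v i) * Polynomial.X) F
    with hQ
  have hQ0 : Q ≠ 0 := by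
    have := aeval_line_ne_zero hk hF hns !![1, (u : ℂ), (g u : ℂ); 0, 1, (D : ℂ); 0, 0, 1]
      (by simp [Matrix.det_fin_three])
    intro h0
    apply this
    refine Eq.trans ?_ h0
    rw [hQ]
    congr 2
  obtain ⟨R, hR, hRd⟩ := Polynomial.exists_eq_pow_rootMultiplicity_mul_and_not_dvd Q hQ0 0
  rw [Polynomial.dvd_iff_isRoot, Polynomial.IsRoot.def] at hRd
  change Polynomial.rootMultiplicity 0 Q ≤ 3 at hmult
  set m := Polynomial.rootMultiplicity 0 Q with hm
  set f : ℝ → ℝ := fun s => g s - (g u + D * (s - u)) with hf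
  have hfan : AnalyticAt ℝ f u := hg.sub (analyticAt_const.add
    (analyticAt_const.mul (analyticAt_id.sub analyticAt_const)))
  have hf' : deriv f =ᶠ[𝓝 u] fun s => deriv g s - D := by
    filter_upwards [hg.eventually_analyticAt] with s hs
    have := hs.differentiableAt.hasDerivAt.sub
      (((hasDerivAt_id s).sub_const u).const_mul D |>.const_add (g u))
    have h5 : HasDerivAt f (deriv g s - D) s := this.congr_deriv (by simp)
    exact h5.deriv
  have hf'' : deriv (deriv f) =ᶠ[𝓝 u] deriv (deriv g) := by
    filter_upwards [hf'.eventuallyEq_nhds] with s hs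
    rw [hs.deriv_eq, deriv_sub_const]
  have hf''' : deriv (deriv (deriv f)) u = deriv (deriv (deriv g)) u := hf''.deriv_eq
  have hord : ((4 : ℕ) : ℕ∞) ≤ analyticOrderAt f u := by
    rw [natCast_le_analyticOrderAt_iff_iteratedDeriv_eq_zero hfan]
    intro i hi
    simp only [iteratedDeriv_eq_iterate] at h2 h3 ⊢
    interval_cases i
    · simp [hf]
    · have := hf'.self_of_nhds
      simpa [hD] using this
    · exact hf''.self_of_nhds.trans h2
    · exact hf'''.trans h3
  obtain ⟨w, hw, hwe⟩ := (natCast_le_analyticOrderAt hfan).1 hord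
  obtain ⟨K, U, hU, hK⟩ :=
    ((analyticAt_aeval_real F ![1, u, g u]).contDiffAt (n := 1)).exists_lipschitzOnWith
  have hc1 : Tendsto (fun s : ℝ => (![1, s, g s] : Fin 3 → ℝ)) (𝓝 u) (𝓝 ![1, u, g u]) := by
    rw [tendsto_pi_nhds]
    intro i
    fin_cases i
    · simp
    · exact tendsto_id
    · simpa using hg.continuousAt.tendsto
  have hc2 : Tendsto (fun s : ℝ => (![1, s, g u + D * (s - u)] : Fin 3 → ℝ)) (𝓝 u)
      (𝓝 ![1, u, g u]) := by
    rw [tendsto_pi_nhds]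
    intro i
    fin_cases i
    · simp
    · exact tendsto_id
    · have : Continuous fun s : ℝ => g u + D * (s - u) := by fun_prop
      simpa using this.tendsto u
  have hQb : ∀ᶠ s in 𝓝 u, ‖Q.eval ((s - u : ℝ) : ℂ)‖ ≤ K * ‖w s‖ * ‖s - u‖ ^ 4 := by
    filter_upwards [hg0, hwe, hc1 hU, hc2 hU] with s hs1 hs2 hs3 hs4
    have h5 := aeval_ofReal F ![1, s, g u + D * (s - u)]
    have h6 : Q.eval ((s - u : ℝ) : ℂ) = ((aeval ![1, s, g u + D * (s - u)] F : ℝ) : ℂ) := by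
      rw [← h5, hQ, eval_aeval_curve]
      congr 2
      funext i
      fin_cases i <;> simp [hp, hv]
    have h7 := hK.dist_le_mul _ hs4 _ hs3
    rw [hs1, Real.dist_eq, sub_zero] at h7
    rw [h6, Complex.norm_real, Real.norm_eq_abs]
    refine h7.trans ?_
    rw [mul_assoc]
    refine mul_le_mul_of_nonneg_left ?_ K.2
    have h8 : ‖f s‖ = ‖w s‖ * ‖s - u‖ ^ 4 := by
      rw [hs2, norm_smul, norm_pow, mul_comm]
    rw [← h8]
    refine (dist_pi_le_iff (norm_nonneg _)).2 fun i => ?_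
    fin_cases i
    · simp
    · simp
    · rw [dist_comm]
      simp [hf, Real.dist_eq]
  have hRb : ∀ᶠ s in 𝓝[≠] u, ‖R.eval ((s - u : ℝ) : ℂ)‖ ≤ K * ‖w s‖ * ‖s - u‖ ^ (4 - m) := by
    filter_upwards [hQb.filter_mono nhdsWithin_le_nhds, self_mem_nhdsWithin] with s hs hsu
    have hne : 0 < ‖s - u‖ := norm_pos_iff.2 (sub_ne_zero.2 hsu)
    rw [hR] at hs
    simp only [Polynomial.C_0, sub_zero, Polynomial.eval_mul, Polynomial.eval_pow,
      Polynomial.eval_X, norm_mul, norm_pow, Complex.norm_real] at hs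
    have h9 : ‖s - u‖ ^ 4 = ‖s - u‖ ^ m * ‖s - u‖ ^ (4 - m) := by
      rw [← pow_add]; congr 1; omega
    rw [h9] at hs
    refine le_of_mul_le_mul_left (hs.trans_eq ?_) (pow_pos hne m)
    ring
  have hl : Tendsto (fun s : ℝ => ‖R.eval ((s - u : ℝ) : ℂ)‖) (𝓝[≠] u) (𝓝 ‖R.eval 0‖) := by
    have : Continuous fun s : ℝ => ‖R.eval ((s - u : ℝ) : ℂ)‖ := by fun_prop
    have := this.tendsto u
    simp only [sub_self, Complex.ofReal_zero] at this
    exact this.mono_left nhdsWithin_le_nhds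
  have hr : Tendsto (fun s : ℝ => K * ‖w s‖ * ‖s - u‖ ^ (4 - m)) (𝓝[≠] u) (𝓝 0) := by
    have h10 : ContinuousAt (fun s : ℝ => K * ‖w s‖ * ‖s - u‖ ^ (4 - m)) u := by
      have := hw.continuousAt
      fun_prop
    have := h10.tendsto
    rw [sub_self, norm_zero, zero_pow (by omega), mul_zero] at this
    exact this.mono_left nhdsWithin_le_nhds
  have := le_of_tendsto_of_tendsto hl hr hRb
  exact hRd (norm_le_zero_iff.1 this)

lemma analyticAt_iteratedDeriv {g : ℝ → ℝ} {s : ℝ} (hg : AnalyticAt ℝ g s) (j : ℕ) :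
    AnalyticAt ℝ (iteratedDeriv j g) s := by
  rw [iteratedDeriv_eq_iterate]
  exact hg.iterated_deriv j

lemma hasDerivAt_iteratedDeriv {g : ℝ → ℝ} {s : ℝ} (hg : AnalyticAt ℝ g s) (j : ℕ) :
    HasDerivAt (iteratedDeriv j g) (iteratedDeriv (j + 1) g s) s := by
  rw [iteratedDeriv_succ]
  exact (analyticAt_iteratedDeriv hg j).differentiableAt.hasDerivAt

lemma analyticAt_quadMon {g : ℝ → ℝ} {s : ℝ} (hg : AnalyticAt ℝ g s) (i : Fin 6) :
    AnalyticAt ℝ (fun t => quadMon t (g t) i) s := by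
  fin_cases i
  · exact analyticAt_const
  · exact analyticAt_id
  · exact hg
  · exact analyticAt_id.pow 2
  · exact analyticAt_id.mul hg
  · exact hg.pow 2

/-- The quadratic tower of an analytic function on a compact interval. -/
lemma exists_quadTower {g : ℝ → ℝ} {a b : ℝ} (hg : ∀ s ∈ Set.Icc a b, AnalyticAt ℝ g s) :
    ∃ C, QuadTower g (fun i j => iteratedDeriv j (fun t => quadMon t (g t) i)) a b C ∧
      (∀ s ∈ Set.Icc a b, |iteratedDeriv 2 g s| ≤ C) ∧
      ∀ s ∈ Set.Icc a b, |iteratedDeriv 3 g s| ≤ C := by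
  have hcont : ContinuousOn (fun s => (∑ i : Fin 6, ∑ j ∈ Finset.range 7,
      |iteratedDeriv j (fun t => quadMon t (g t) i) s|) + |iteratedDeriv 2 g s| +
      |iteratedDeriv 3 g s|) (Set.Icc a b) := by
    refine ((continuousOn_finsetSum _ fun i _ => continuousOn_finsetSum _ fun j _ => ?_).add
      ?_).add ?_ <;> refine ContinuousOn.abs fun s hs => ContinuousAt.continuousWithinAt ?_
    · exact (analyticAt_iteratedDeriv (analyticAt_quadMon (hg s hs) i) j).continuousAt
    · exact (analyticAt_iteratedDeriv (hg s hs) 2).continuousAt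
    · exact (analyticAt_iteratedDeriv (hg s hs) 3).continuousAt
  obtain ⟨C, hC⟩ := isCompact_Icc.exists_bound_of_continuousOn hcont
  have hS : ∀ s, 0 ≤ ∑ i : Fin 6, ∑ j ∈ Finset.range 7,
      |iteratedDeriv j (fun t => quadMon t (g t) i) s| := fun s =>
    Finset.sum_nonneg fun i _ => Finset.sum_nonneg fun j _ => abs_nonneg _
  have hC' : ∀ s ∈ Set.Icc a b, (∑ i : Fin 6, ∑ j ∈ Finset.range 7,
      |iteratedDeriv j (fun t => quadMon t (g t) i) s|) + |iteratedDeriv 2 g s| +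
      |iteratedDeriv 3 g s| ≤ C := fun s hs => (le_abs_self _).trans (hC s hs)
  refine ⟨C, ⟨fun i j s hs => hasDerivAt_iteratedDeriv (analyticAt_quadMon (hg s hs) i) j,
    fun i s hs => by simp, fun i j hj s hs => ?_⟩, fun s hs => ?_, fun s hs => ?_⟩
  · have h1 : |iteratedDeriv j (fun t => quadMon t (g t) i) s| ≤ ∑ i : Fin 6,
        ∑ j ∈ Finset.range 7, |iteratedDeriv j (fun t => quadMon t (g t) i) s| := by
      refine le_trans ?_ (Finset.single_le_sum (f := fun i : Fin 6 => ∑ j ∈ Finset.range 7,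
        |iteratedDeriv j (fun t => quadMon t (g t) i) s|)
        (fun i _ => Finset.sum_nonneg fun j _ => abs_nonneg _) (Finset.mem_univ i))
      exact Finset.single_le_sum (f := fun j =>
        |iteratedDeriv j (fun t => quadMon t (g t) i) s|) (fun j _ => abs_nonneg _)
        (Finset.mem_range.2 (by omega))
    linarith [hC' s hs, abs_nonneg (iteratedDeriv 2 g s), abs_nonneg (iteratedDeriv 3 g s)]
  · linarith [hC' s hs, hS s, abs_nonneg (iteratedDeriv 2 g s), abs_nonneg (iteratedDeriv 3 g s)]
  · linarith [hC' s hs, hS s, abs_nonneg (iteratedDeriv 2 g s), abs_nonneg (iteratedDeriv 3 g s)]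

lemma eventually_half_abs_le {h : ℝ → ℝ} {u : ℝ} (hh : ContinuousAt h u) (h0 : h u ≠ 0) :
    ∀ᶠ s in 𝓝 u, |h u| / 2 ≤ |h s| := by
  have : |h u| / 2 < |h u| := by linarith [abs_pos.2 h0]
  filter_upwards [hh.abs.eventually (lt_mem_nhds this)] with s hs using hs.le

/-- Primitive points near an analytic branch of a nonsingular curve without lines of contact order
at least four are rare. -/
lemma exists_forall_eventually_nearGraph_card_le {F : MvPolynomial (Fin 3) ℤ} {k : ℕ} (hk : 3 ≤ k)
    (hF : F.IsHomogeneous k)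
    (hns : ∀ x : Fin 3 → ℂ, x ≠ 0 → ∃ i, aeval x (pderiv i F) ≠ 0)
    (hν : ∀ p v : Fin 3 → ℂ, p ≠ 0 → aeval p F = 0 → (∀ c : ℂ, v ≠ c • p) →
      contactOrder F p v ≤ 3)
    {τ : ℝ} (hτ : 9 / 2 < τ) (hτ5 : τ < 5)
    {g : ℝ → ℝ} {u : ℝ} (hg : AnalyticAt ℝ g u)
    (hg0 : ∀ᶠ s in 𝓝 u, aeval ![1, s, g s] F = (0 : ℝ)) {r₁ : ℝ} (hr₁ : 0 < r₁) :
    ∃ r, 0 < r ∧ r ≤ r₁ ∧ ∀ C₀ κ : ℝ, 0 ≤ C₀ → 0 < κ → ∀ᶠ B : ℝ in atTop,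
      ∀ T : Finset (Fin 3 → ℤ), (∀ x ∈ T, NearGraph g (C₀ * B ^ (-τ)) B (u - r) (u + r) x) →
        (T.card : ℝ) ≤ κ * B := by
  obtain ⟨η, hη0, hη⟩ : ∃ η > 0, (∀ᶠ s in 𝓝 u, η ≤ |iteratedDeriv 2 g s|) ∨
      ∀ᶠ s in 𝓝 u, η ≤ |iteratedDeriv 3 g s| := by
    rcases iteratedDeriv_two_or_three_ne_zero hk hF hns hν hg hg0 with h | h
    · exact ⟨_, half_pos (abs_pos.2 h), Or.inl (eventually_half_abs_le
        (analyticAt_iteratedDeriv hg 2).continuousAt h)⟩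
    · exact ⟨_, half_pos (abs_pos.2 h), Or.inr (eventually_half_abs_le
        (analyticAt_iteratedDeriv hg 3).continuousAt h)⟩
  set fd : Fin 6 → ℕ → ℝ → ℝ := fun i j => iteratedDeriv j (fun t => quadMon t (g t) i) with hfd
  have hW : AnalyticAt ℝ (fun s => Matrix.det (Matrix.of fun i j : Fin 6 => fd i j s)) u := by
    simp only [Matrix.det_apply', Matrix.of_apply]
    refine Finset.analyticAt_fun_sum _ fun σ _ => ?_
    refine analyticAt_const.mul ?_
    exact Finset.analyticAt_fun_prod _ fun i _ =>
      analyticAt_iteratedDeriv (analyticAt_quadMon hg _) _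
  have hWne : ∀ᶠ s in 𝓝 u, s ≠ u → Matrix.det (Matrix.of fun i j : Fin 6 => fd i j s) ≠ 0 := by
    rcases hW.eventually_eq_zero_or_eventually_ne_zero with h | h
    · exfalso
      obtain ⟨a, b, hab, hsub⟩ := mem_nhds_iff_exists_Ioo_subset.1
        ((h.and hg0).and hg.eventually_analyticAt)
      obtain ⟨a', b', ha', hab', hb', c, hc, hcz⟩ :=
        exists_linear_relation_of_wronskian (fun i t => quadMon t (g t) i)
          (hab.1.trans hab.2) (fun i s hs => analyticAt_quadMon (hsub hs).2 i)
          (fun s hs => (hsub hs).1.1)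
      have hs' : Set.Ioo a' b' ⊆ Set.Ioo a b := Set.Ioo_subset_Ioo ha' hb'
      exact no_conic_relation hk hF hns hab' (fun s hs => (hsub (hs' hs)).1.2)
        (fun s hs => (hsub (hs' hs)).2) hc hcz
    · exact eventually_nhdsWithin_iff.1 h
  have hall : ∀ᶠ s in 𝓝 u, AnalyticAt ℝ g s ∧
      (s ≠ u → Matrix.det (Matrix.of fun i j : Fin 6 => fd i j s) ≠ 0) :=
    hg.eventually_analyticAt.and hWne
  obtain ⟨r, hr0, hr⟩ := (nhds_basis_Icc_pos u).mem_iff.1 hall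
  obtain ⟨r', hr0', hr'⟩ : ∃ r' > 0, (∀ s ∈ Set.Icc (u - r') (u + r'), η ≤ |iteratedDeriv 2 g s|) ∨
      ∀ s ∈ Set.Icc (u - r') (u + r'), η ≤ |iteratedDeriv 3 g s| := by
    rcases hη with h | h
    · obtain ⟨r, hr0, hr⟩ := (nhds_basis_Icc_pos u).mem_iff.1 h
      exact ⟨r, hr0, Or.inl fun s hs => hr hs⟩
    · obtain ⟨r, hr0, hr⟩ := (nhds_basis_Icc_pos u).mem_iff.1 h
      exact ⟨r, hr0, Or.inr fun s hs => hr hs⟩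
  set ρ := min r₁ (min r r') with hρ
  have hρ0 : 0 < ρ := lt_min hr₁ (lt_min hr0 hr0')
  have hρr : ρ ≤ r := (min_le_right _ _).trans (min_le_left _ _)
  have hρr' : ρ ≤ r' := (min_le_right _ _).trans (min_le_right _ _)
  have hsub : Set.Icc (u - ρ) (u + ρ) ⊆ Set.Icc (u - r) (u + r) :=
    Set.Icc_subset_Icc (by linarith) (by linarith)
  have hsub' : Set.Icc (u - ρ) (u + ρ) ⊆ Set.Icc (u - r') (u + r') :=
    Set.Icc_subset_Icc (by linarith) (by linarith)
  have hgan : ∀ s ∈ Set.Icc (u - ρ) (u + ρ), AnalyticAt ℝ g s := fun s hs => (hr (hsub hs)).1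
  obtain ⟨C, hT, hC2, hC3⟩ := exists_quadTower hgan
  refine ⟨ρ, hρ0, min_le_left _ _, fun C₀ κ hC₀ hκ => ?_⟩
  refine QuadTower.eventually_card_le (gd := fun j => iteratedDeriv j g) (fd := fd) (η := η) (C := C)
    hρ0 (by simpa using hT) hC₀ hτ hτ5 hκ (fun j s hs => hasDerivAt_iteratedDeriv (hgan s hs) j)
    hC2 hC3 hη0 ?_ (fun s hs hne => (hr (hsub hs)).2 hne) |>.mono ?_
  · exact hr'.imp (fun h s hs => h s (hsub' hs)) (fun h s hs => h s (hsub' hs))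
  · intro B hB T hT
    exact hB T (by simpa using hT)

lemma hasDerivAt_aeval_snd (F : MvPolynomial (Fin 3) ℤ) (u v : ℝ) :
    HasDerivAt (fun v : ℝ => aeval ![1, u, v] F) (aeval ![1, u, v] (pderiv 2 F)) v := by
  induction F using MvPolynomial.induction_on with
  | C a => simpa using hasDerivAt_const v ((a : ℝ))
  | add p q hp hq =>
    simp only [map_add]
    exact hp.add hq
  | mul_X p j hp =>
    have hX : HasDerivAt (fun v : ℝ => (![1, u, v] : Fin 3 → ℝ) j)
        (aeval ![1, u, v] (pderiv 2 (X j : MvPolynomial (Fin 3) ℤ))) v := by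
      fin_cases j
      · simpa [pderiv_X] using hasDerivAt_const v (1 : ℝ)
      · simpa [pderiv_X] using hasDerivAt_const v u
      · simpa [pderiv_X] using hasDerivAt_id' v
    have := hp.mul hX
    rw [pderiv_mul, map_add, map_mul, map_mul, aeval_X]
    simp only [map_mul, aeval_X]
    exact this

lemma analyticAt_aeval_pair (F : MvPolynomial (Fin 3) ℤ) (z : ℝ × ℝ) :
    AnalyticAt ℝ (fun z : ℝ × ℝ => aeval ![1, z.1, z.2] F) z := by
  refine AnalyticAt.aeval_mvPolynomial (f := fun z : ℝ × ℝ => ![1, z.1, z.2]) (fun i => ?_) F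
  fin_cases i
  · exact analyticAt_const
  · exact analyticAt_fst
  · exact analyticAt_snd

lemma isInvertible_of_apply_one_ne_zero (L : ℝ →L[ℝ] ℝ) (h : L 1 ≠ 0) : L.IsInvertible := by
  refine ⟨ContinuousLinearEquiv.unitsEquivAut ℝ (Units.mk0 (L 1) h), ?_⟩
  ext
  simp

/-- Near a zero with nonvanishing vertical derivative, the affine curve is an analytic graph, and
the vertical distance to it is controlled by the value of the form. -/
lemma exists_analytic_graph (F : MvPolynomial (Fin 3) ℤ) {u₀ v₀ : ℝ}
    (h0 : aeval ![1, u₀, v₀] F = (0 : ℝ)) (h1 : aeval ![1, u₀, v₀] (pderiv 2 F) ≠ (0 : ℝ)) :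
    ∃ g : ℝ → ℝ, AnalyticAt ℝ g u₀ ∧ (∀ᶠ s in 𝓝 u₀, aeval ![1, s, g s] F = (0 : ℝ)) ∧
      ∃ m r : ℝ, 0 < m ∧ 0 < r ∧ ∀ s v : ℝ, |s - u₀| ≤ r → |v - v₀| ≤ r →
        m * |v - g s| ≤ |aeval ![1, s, v] F| := by
  set f : ℝ × ℝ → ℝ := fun z => aeval ![1, z.1, z.2] F with hf
  have hfan : ContDiffAt ℝ ⊤ f (u₀, v₀) := (analyticAt_aeval_pair F _).contDiffAt
  have hne : (⊤ : WithTop ℕ∞) ≠ 0 := by simp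
  have hinv : (fderiv ℝ f (u₀, v₀) ∘L .inr ℝ ℝ ℝ).IsInvertible := by
    apply isInvertible_of_apply_one_ne_zero
    have h2 : HasDerivAt (fun v : ℝ => f (u₀, v)) (fderiv ℝ f (u₀, v₀) (0, 1)) v₀ := by
      have h3 := (analyticAt_aeval_pair F (u₀, v₀)).differentiableAt.hasFDerivAt
      exact h3.comp_hasDerivAt v₀ ((hasDerivAt_const v₀ u₀).prodMk (hasDerivAt_id v₀))
    have h4 := h2.unique (hasDerivAt_aeval_snd F u₀ v₀)
    simp only [ContinuousLinearMap.comp_apply, ContinuousLinearMap.inr_apply]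
    rwa [h4]
  set g := hfan.implicitFunction hne hinv with hg
  have hgu : g u₀ = v₀ := hfan.implicitFunction_apply_self hne hinv
  have hgan : AnalyticAt ℝ g u₀ := (hfan.contDiffAt_implicitFunction hne hinv).analyticAt
  have hg0 : ∀ᶠ s in 𝓝 u₀, f (s, g s) = f (u₀, v₀) :=
    hfan.eventually_apply_implicitFunction hne hinv
  have hg0' : ∀ᶠ s in 𝓝 u₀, aeval ![1, s, g s] F = (0 : ℝ) := hg0.mono fun s hs => hs.trans h0
  refine ⟨g, hgan, hg0', ?_⟩
  set d : ℝ := aeval ![1, u₀, v₀] (pderiv 2 F) with hd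
  obtain ⟨P, hP⟩ : ∃ P : ℝ × ℝ → ℝ, ∀ z, P z = aeval ![1, z.1, z.2] (pderiv 2 F) :=
    ⟨_, fun z => rfl⟩
  have hcont : ContinuousAt P (u₀, v₀) := by
    rw [show P = _ from funext hP]
    exact (analyticAt_aeval_pair (pderiv 2 F) (u₀, v₀)).continuousAt
  have hPd : P (u₀, v₀) = d := hP _
  have hbig : ∀ᶠ z in 𝓝 ((u₀, v₀) : ℝ × ℝ), |d| / 2 ≤ |P z| := by
    have : |d| / 2 < |P (u₀, v₀)| := by rw [hPd]; linarith [abs_pos.2 h1]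
    filter_upwards [hcont.abs.eventually (lt_mem_nhds this)] with s hs using hs.le
  obtain ⟨δ, hδ0, hδ⟩ := Metric.nhds_basis_closedBall.mem_iff.1 hbig
  have hgc : ∀ᶠ s in 𝓝 u₀, |g s - v₀| < δ := by
    have := hgan.continuousAt.tendsto
    rw [hgu] at this
    filter_upwards [this.eventually (Metric.ball_mem_nhds v₀ hδ0)] with s hs
    rwa [← Real.dist_eq]
  obtain ⟨r, hr0, hr⟩ := Metric.nhds_basis_closedBall.mem_iff.1 (hg0'.and hgc)
  refine ⟨|d| / 2, min r δ, half_pos (abs_pos.2 h1), lt_min hr0 hδ0, fun s v hs hv => ?_⟩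
  obtain ⟨hs1, hs2⟩ := hr (show s ∈ Metric.closedBall u₀ r by
    rw [Metric.mem_closedBall, Real.dist_eq]; exact hs.trans (min_le_left _ _))
  have hsδ : |s - u₀| ≤ δ := hs.trans (min_le_right _ _)
  have hvδ : |v - v₀| ≤ δ := hv.trans (min_le_right _ _)
  have hderiv : ∀ w, |w - v₀| ≤ δ → |d| / 2 ≤ |aeval ![1, s, w] (pderiv 2 F)| := by
    intro w hw
    have hmem : ((s, w) : ℝ × ℝ) ∈ Metric.closedBall (u₀, v₀) δ := by
      rw [Metric.mem_closedBall, Prod.dist_eq, Real.dist_eq, Real.dist_eq]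
      exact max_le hsδ hw
    have h6 : |d| / 2 ≤ |P (s, w)| := hδ hmem
    rwa [hP] at h6
  have key : ∀ a b : ℝ, a < b → |a - v₀| ≤ δ → |b - v₀| ≤ δ →
      |d| / 2 * (b - a) ≤ |(aeval ![1, s, b] F : ℝ) - aeval ![1, s, a] F| := by
    intro a b hab ha hb
    obtain ⟨c, hc, hce⟩ := exists_hasDerivAt_eq_slope (fun v : ℝ => (aeval ![1, s, v] F : ℝ))
      (fun v => aeval ![1, s, v] (pderiv 2 F)) hab
      (fun v _ => (hasDerivAt_aeval_snd F s v).continuousAt.continuousWithinAt)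
      (fun v _ => hasDerivAt_aeval_snd F s v)
    have hcδ : |c - v₀| ≤ δ := by
      rw [abs_le] at ha hb ⊢
      constructor <;> linarith [hc.1, hc.2]
    have h5 := hderiv c hcδ
    have hba : 0 < b - a := sub_pos.2 hab
    rw [hce, abs_div, abs_of_pos hba, le_div_iff₀ hba] at h5
    exact h5
  rcases lt_trichotomy v (g s) with h | h | h
  · have := key _ _ h hvδ hs2.le
    rw [hs1, zero_sub, abs_neg] at this
    rwa [abs_sub_comm, abs_of_pos (sub_pos.2 h)]
  · rw [h]; simp
  · have := key _ _ h hs2.le hvδ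
    rw [hs1, sub_zero] at this
    rwa [abs_of_pos (sub_pos.2 h)]

lemma aeval_eq_of_ne_zero {F : MvPolynomial (Fin 3) ℤ} {k : ℕ} (hF : F.IsHomogeneous k)
    (p : Fin 3 → ℝ) (hp : p 0 ≠ 0) :
    aeval p F = p 0 ^ k * aeval ![1, p 1 / p 0, p 2 / p 0] F := by
  rw [← aeval_smul_of_isHomogeneous hF]
  congr 2
  funext i
  fin_cases i
  · simp
  · simp; field_simp
  · simp; field_simp

/-- Local version of the count, near a zero at which the last partial derivative is nonzero. -/
lemma exists_nhds_eventually_card_le_of_pderiv {F : MvPolynomial (Fin 3) ℤ} {k : ℕ} (hk : 3 ≤ k)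
    (hF : F.IsHomogeneous k)
    (hns : ∀ x : Fin 3 → ℂ, x ≠ 0 → ∃ i, aeval x (pderiv i F) ≠ 0)
    (hν : ∀ p v : Fin 3 → ℂ, p ≠ 0 → aeval p F = 0 → (∀ c : ℂ, v ≠ c • p) →
      contactOrder F p v ≤ 3)
    {τ : ℝ} (hτ : 9 / 2 < τ) (hτ5 : τ < 5) {p : Fin 3 → ℝ} (hp0 : p 0 ≠ 0)
    (hp : aeval p F = (0 : ℝ)) (hp2 : aeval p (pderiv 2 F) ≠ (0 : ℝ)) :
    ∃ V ∈ 𝓝 p, ∀ κ : ℝ, 0 < κ → ∀ᶠ B : ℝ in atTop, ∀ T : Finset (Fin 3 → ℤ),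
      (∀ x ∈ T, (∃ d : Fin 3 → ℤ, ∑ i, d i * x i = 1) ∧
        |(aeval (fun i => (x i : ℝ)) F : ℝ)| ≤ B ^ ((k : ℝ) - τ) ∧ |(x 0 : ℝ)| ≤ B ∧
        (fun i => (x i : ℝ) / B) ∈ V) → (T.card : ℝ) ≤ κ * B := by
  have h0 : aeval ![1, p 1 / p 0, p 2 / p 0] F = (0 : ℝ) := by
    have := aeval_eq_of_ne_zero hF p hp0
    rw [hp] at this
    exact (mul_eq_zero.1 this.symm).resolve_left (pow_ne_zero _ hp0)
  have h1 : aeval ![1, p 1 / p 0, p 2 / p 0] (pderiv 2 F) ≠ (0 : ℝ) := by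
    intro h
    have := aeval_eq_of_ne_zero (hF.pderiv (i := 2)) p hp0
    rw [h, mul_zero] at this
    exact hp2 this
  obtain ⟨g, hg, hg0, m, r₁, hm, hr₁, hgr⟩ := exists_analytic_graph F h0 h1
  obtain ⟨r, hr0, hrr, hr⟩ := exists_forall_eventually_nearGraph_card_le hk hF hns hν hτ hτ5 hg hg0
    hr₁
  have hc0 : ContinuousAt (fun y : Fin 3 → ℝ => y 0) p := (continuous_apply 0).continuousAt
  have hc1 : ContinuousAt (fun y : Fin 3 → ℝ => y 1 / y 0) p :=
    (continuous_apply 1).continuousAt.div hc0 hp0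
  have hc2 : ContinuousAt (fun y : Fin 3 → ℝ => y 2 / y 0) p :=
    (continuous_apply 2).continuousAt.div hc0 hp0
  have hlt : |p 0| / 2 < |p 0| := by linarith [abs_pos.2 hp0]
  refine ⟨{y | |p 0| / 2 < |y 0| ∧ |y 1 / y 0 - p 1 / p 0| ≤ r ∧ |y 2 / y 0 - p 2 / p 0| ≤ r}, ?_,
    fun κ hκ => ?_⟩
  · filter_upwards [hc0.abs.eventually (lt_mem_nhds hlt),
      hc1.eventually (Metric.closedBall_mem_nhds _ hr0),
      hc2.eventually (Metric.closedBall_mem_nhds _ hr0)] with y hy1 hy2 hy3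
    rw [Real.dist_eq] at hy2 hy3
    exact ⟨hy1, hy2, hy3⟩
  have hP : 0 < |p 0| / 2 := half_pos (abs_pos.2 hp0)
  set C₀ := ((|p 0| / 2) ^ k)⁻¹ / m with hC₀
  have hC₀0 : 0 ≤ C₀ := by positivity
  filter_upwards [hr C₀ κ hC₀0 hκ, eventually_gt_atTop 0] with B hB hB0 T hT
  refine hB T fun x hx => ?_
  obtain ⟨hx1, hx2, hx3, hx4, hx5, hx6⟩ := hT x hx
  have hx0 : (x 0 : ℝ) ≠ 0 := by
    intro h
    rw [h] at hx4
    simp at hx4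
    linarith [abs_nonneg (p 0)]
  have hd : ∀ i, (x i : ℝ) / B / ((x 0 : ℝ) / B) = x i / x 0 := fun i => by field_simp
  rw [hd] at hx5 hx6
  have hx00 : x 0 ≠ 0 := by exact_mod_cast hx0
  refine ⟨hx1, hx00, hx3, ?_, ?_⟩
  · rw [abs_le] at hx5
    exact ⟨by unfold affU; linarith [hx5.1], by unfold affU; linarith [hx5.2]⟩
  · have h2 := hgr (affU x) (affV x) (hx5.trans hrr) (hx6.trans hrr)
    have h3 := aeval_eq_of_ne_zero hF (fun i => (x i : ℝ)) hx0
    have h4 : |p 0| / 2 * B ≤ |(x 0 : ℝ)| := by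
      rw [abs_div, abs_of_pos hB0, lt_div_iff₀ hB0] at hx4
      exact hx4.le
    rw [h3, abs_mul, abs_pow] at hx2
    have h5 : (|p 0| / 2 * B) ^ k * (m * |affV x - g (affU x)|) ≤ B ^ ((k : ℝ) - τ) := by
      refine le_trans ?_ hx2
      gcongr
      exact h2
    rw [Real.rpow_sub hB0, Real.rpow_natCast] at h5
    rw [Real.rpow_neg hB0.le, hC₀]
    have h6 : 0 < B ^ τ := Real.rpow_pos_of_pos hB0 τ
    have h7 : 0 < B ^ k := pow_pos hB0 k
    have h8 : 0 < (|p 0| / 2) ^ k := pow_pos hP k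
    rw [mul_pow, le_div_iff₀ h6] at h5
    have h9 : B ^ k * ((|p 0| / 2) ^ k * m * B ^ τ * |affV x - g (affU x)|) ≤ B ^ k * 1 := by
      linarith
    have h10 := le_of_mul_le_mul_left h9 h7
    rw [show ((|p 0| / 2) ^ k)⁻¹ / m * (B ^ τ)⁻¹ = 1 / ((|p 0| / 2) ^ k * m * B ^ τ) by
      field_simp]
    rw [le_div_iff₀ (by positivity)]
    linarith

/-- Primitive integer points in the strip `|F| ≤ B ^ e` whose rescaling lies in `V` are
rare. -/
def RareIn (F : MvPolynomial (Fin 3) ℤ) (e : ℝ) (V : Set (Fin 3 → ℝ)) : Prop :=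
  ∀ κ : ℝ, 0 < κ → ∀ᶠ B : ℝ in atTop, ∀ T : Finset (Fin 3 → ℤ),
    (∀ x ∈ T, (∃ d : Fin 3 → ℤ, ∑ i, d i * x i = 1) ∧
      |(aeval (fun i => (x i : ℝ)) F : ℝ)| ≤ B ^ e ∧ (∀ i, |(x i : ℝ)| ≤ B) ∧
      (fun i => (x i : ℝ) / B) ∈ V) → (T.card : ℝ) ≤ κ * B

lemma RareIn.mono {F : MvPolynomial (Fin 3) ℤ} {e : ℝ} {V W : Set (Fin 3 → ℝ)} (hVW : V ⊆ W)
    (h : RareIn F e W) : RareIn F e V := fun κ hκ => (h κ hκ).mono fun _ hB T hT =>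
  hB T fun x hx => ⟨(hT x hx).1, (hT x hx).2.1, (hT x hx).2.2.1, hVW (hT x hx).2.2.2⟩

lemma RareIn.empty {F : MvPolynomial (Fin 3) ℤ} {e : ℝ} : RareIn F e ∅ := by
  intro κ hκ
  filter_upwards [eventually_ge_atTop 0] with B hB T hT
  rw [Finset.eq_empty_of_forall_notMem fun x hx => (hT x hx).2.2.2]
  simpa using mul_nonneg hκ.le hB

lemma RareIn.union {F : MvPolynomial (Fin 3) ℤ} {e : ℝ} {V W : Set (Fin 3 → ℝ)}
    (hV : RareIn F e V) (hW : RareIn F e W) : RareIn F e (V ∪ W) := by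
  classical
  intro κ hκ
  filter_upwards [hV (κ / 2) (half_pos hκ), hW (κ / 2) (half_pos hκ)] with B h1 h2 T hT
  have h3 := h1 (T.filter fun x => (fun i => (x i : ℝ) / B) ∈ V) fun x hx => by
    rw [Finset.mem_filter] at hx
    exact ⟨(hT x hx.1).1, (hT x hx.1).2.1, (hT x hx.1).2.2.1, hx.2⟩
  have h4 := h2 (T.filter fun x => ¬ (fun i => (x i : ℝ) / B) ∈ V) fun x hx => by
    rw [Finset.mem_filter] at hx
    exact ⟨(hT x hx.1).1, (hT x hx.1).2.1, (hT x hx.1).2.2.1, (hT x hx.1).2.2.2.resolve_left hx.2⟩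
  have h5 := Finset.card_filter_add_card_filter_not (s := T)
    (fun x : Fin 3 → ℤ => (fun i => (x i : ℝ) / B) ∈ V)
  rw [← h5]
  push_cast
  linarith

lemma aeval_div_of_isHomogeneous {F : MvPolynomial (Fin 3) ℤ} {k : ℕ} (hF : F.IsHomogeneous k)
    {B : ℝ} (hB : B ≠ 0) (x : Fin 3 → ℤ) :
    (aeval (fun i => (x i : ℝ)) F : ℝ) = B ^ k * aeval (fun i => (x i : ℝ) / B) F := by
  rw [← aeval_smul_of_isHomogeneous hF]
  congr 2
  funext i
  field_simp

lemma exists_rareIn_of_ne_zero {F : MvPolynomial (Fin 3) ℤ} {k : ℕ} (hF : F.IsHomogeneous k)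
    {τ : ℝ} (hτ : 0 < τ) {p : Fin 3 → ℝ} (hp : aeval p F ≠ (0 : ℝ)) :
    ∃ V ∈ 𝓝 p, RareIn F (k - τ) V := by
  have hlt : |(aeval p F : ℝ)| / 2 < |(aeval p F : ℝ)| := by linarith [abs_pos.2 hp]
  refine ⟨{y | |(aeval p F : ℝ)| / 2 < |(aeval y F : ℝ)|},
    (analyticAt_aeval_real F p).continuousAt.abs.eventually (lt_mem_nhds hlt), fun κ hκ => ?_⟩
  filter_upwards [eventually_mul_rpow_lt 1 (neg_lt_zero.2 hτ) (half_pos (abs_pos.2 hp)),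
    eventually_gt_atTop 0] with B hB hB0 T hT
  have : T = ∅ := by
    refine Finset.eq_empty_of_forall_notMem fun x hx => ?_
    obtain ⟨-, h1, -, h2⟩ := hT x hx
    rw [aeval_div_of_isHomogeneous hF hB0.ne', abs_mul, abs_of_pos (pow_pos hB0 k), sub_eq_add_neg,
      Real.rpow_add hB0, Real.rpow_natCast] at h1
    have h3 := le_of_mul_le_mul_left h1 (pow_pos hB0 k)
    have h4 : |(aeval p F : ℝ)| / 2 < |(aeval (fun i => (x i : ℝ) / B) F : ℝ)| := h2
    linarith
  rw [this]
  simpa using mul_nonneg hκ.le hB0.le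

lemma exists_index_pair {F : MvPolynomial (Fin 3) ℤ} {k : ℕ} (hF : F.IsHomogeneous k)
    (hns : ∀ x : Fin 3 → ℂ, x ≠ 0 → ∃ i, aeval x (pderiv i F) ≠ 0)
    {p : Fin 3 → ℝ} (hp0 : p ≠ 0) (hp : aeval p F = (0 : ℝ)) :
    ∃ i l, i ≠ l ∧ p i ≠ 0 ∧ aeval p (pderiv l F) ≠ (0 : ℝ) := by
  obtain ⟨l, hl⟩ : ∃ l, aeval p (pderiv l F) ≠ (0 : ℝ) := by
    obtain ⟨l, hl⟩ := hns (fun i => (p i : ℂ)) (fun h => hp0 (by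
      funext i
      have := congrFun h i
      simpa using this))
    refine ⟨l, fun h => hl ?_⟩
    rw [aeval_ofReal, h, Complex.ofReal_zero]
  by_cases h : ∃ i, i ≠ l ∧ p i ≠ 0
  · obtain ⟨i, hi, hpi⟩ := h
    exact ⟨i, l, hi, hpi, hl⟩
  · push Not at h
    exfalso
    have hE := euler_aeval hF p
    rw [hp, mul_zero, Finset.sum_eq_single l (fun i _ hi => by rw [h i hi, zero_mul])
      (by simp)] at hE
    have hpl := (mul_eq_zero.1 hE).resolve_right hl
    apply hp0
    funext i
    by_cases hi : i = l
    · rw [hi]; exact hpl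
    · exact h i hi

lemma exists_perm_zero_two {i l : Fin 3} (h : i ≠ l) : ∃ e : Equiv.Perm (Fin 3), e 0 = i ∧ e 2 = l := by
  revert i l
  decide

/-- The count is local around every nonzero real zero. -/
lemma exists_rareIn_of_eq_zero {F : MvPolynomial (Fin 3) ℤ} {k : ℕ} (hk : 3 ≤ k)
    (hF : F.IsHomogeneous k)
    (hns : ∀ x : Fin 3 → ℂ, x ≠ 0 → ∃ i, aeval x (pderiv i F) ≠ 0)
    (hν : ∀ p v : Fin 3 → ℂ, p ≠ 0 → aeval p F = 0 → (∀ c : ℂ, v ≠ c • p) →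
      contactOrder F p v ≤ 3)
    {τ : ℝ} (hτ : 9 / 2 < τ) (hτ5 : τ < 5) {p : Fin 3 → ℝ} (hp0 : p ≠ 0)
    (hp : aeval p F = (0 : ℝ)) : ∃ V ∈ 𝓝 p, RareIn F (k - τ) V := by
  classical
  obtain ⟨i, l, hil, hpi, hpl⟩ := exists_index_pair hF hns hp0 hp
  obtain ⟨e, rfl, rfl⟩ := exists_perm_zero_two hil
  set G := rename e.symm F with hG
  have hcomp : ∀ {R : Type} (x : Fin 3 → R), (x ∘ e) ∘ e.symm = x := fun x => by
    funext i; simp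
  have hpd : ∀ i, pderiv (e.symm i) G = rename e.symm (pderiv i F) := fun i =>
    pderiv_rename e.symm.injective i F
  have hns' : ∀ x : Fin 3 → ℂ, x ≠ 0 → ∃ i, aeval x (pderiv i G) ≠ 0 := by
    intro x hx
    obtain ⟨j, hj⟩ := hns (x ∘ e.symm) (fun h => hx (by
      funext i
      have := congrFun h (e i)
      simpa using this))
    refine ⟨e.symm j, ?_⟩
    rwa [hpd, aeval_rename]
  have hν' : ∀ p v : Fin 3 → ℂ, p ≠ 0 → aeval p G = 0 → (∀ c : ℂ, v ≠ c • p) →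
      contactOrder G p v ≤ 3 := by
    intro p v hp hpG hpv
    rw [hG, aeval_rename] at hpG
    have h1 := hν (p ∘ e.symm) (v ∘ e.symm) (fun h => hp (by
      funext i
      have := congrFun h (e i)
      simpa using this)) hpG (fun c h => hpv c (by
      funext i
      have := congrFun h (e i)
      simpa using this))
    unfold contactOrder at h1 ⊢
    rw [hG, aeval_rename]
    exact h1
  obtain ⟨V, hV, hcard⟩ := exists_nhds_eventually_card_le_of_pderiv hk
    (hF.rename_isHomogeneous (f := e.symm)) hns' hν' hτ hτ5 (p := p ∘ e) hpi
    (by rw [aeval_rename, hcomp, hp]) (by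
      have := hpd (e 2)
      rw [Equiv.symm_apply_apply] at this
      rw [← hG, this, aeval_rename, hcomp]
      exact hpl)
  have hc : Continuous fun y : Fin 3 → ℝ => y ∘ e := by fun_prop
  refine ⟨_, hc.continuousAt.preimage_mem_nhds hV, fun κ hκ => ?_⟩
  filter_upwards [hcard κ hκ] with B hB T hT
  have hinj : Function.Injective fun x : Fin 3 → ℤ => x ∘ e := fun x y h => by
    funext i
    have := congrFun h (e.symm i)
    simpa using this
  have h1 := hB (T.image fun x => x ∘ e) (by
    intro x' hx'
    obtain ⟨x, hx, rfl⟩ := Finset.mem_image.1 hx'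
    obtain ⟨⟨d, hd⟩, h2, h3, h4⟩ := hT x hx
    refine ⟨⟨d ∘ e, ?_⟩, ?_, h3 _, h4⟩
    · rw [← hd]
      exact Equiv.sum_comp e fun i => d i * x i
    · rw [aeval_rename]
      have : (fun i => (((x ∘ e) i : ℤ) : ℝ)) ∘ e.symm = fun i => (x i : ℝ) := by
        funext i; simp
      rw [this]
      exact h2)
  rwa [Finset.card_image_of_injective _ hinj] at h1

lemma rareIn_annulus {F : MvPolynomial (Fin 3) ℤ} {k : ℕ} (hk : 3 ≤ k)
    (hF : F.IsHomogeneous k)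
    (hns : ∀ x : Fin 3 → ℂ, x ≠ 0 → ∃ i, aeval x (pderiv i F) ≠ 0)
    (hν : ∀ p v : Fin 3 → ℂ, p ≠ 0 → aeval p F = 0 → (∀ c : ℂ, v ≠ c • p) →
      contactOrder F p v ≤ 3)
    {τ : ℝ} (hτ : 9 / 2 < τ) (hτ5 : τ < 5) :
    RareIn F (k - τ) {y | 1 / 2 ≤ ‖y‖ ∧ ‖y‖ ≤ 1} := by
  have hK : IsCompact {y : Fin 3 → ℝ | 1 / 2 ≤ ‖y‖ ∧ ‖y‖ ≤ 1} := by
    refine (isCompact_closedBall (0 : Fin 3 → ℝ) 1).of_isClosed_subset ?_ ?_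
    · exact (isClosed_le continuous_const continuous_norm).inter
        (isClosed_le continuous_norm continuous_const)
    · intro y hy
      simpa using hy.2
  refine hK.induction_on RareIn.empty (fun V W h => RareIn.mono h) (fun V W => RareIn.union)
    fun p hp => ?_
  have hp0 : p ≠ 0 := by
    rintro rfl
    have := hp.1
    rw [norm_zero] at this
    norm_num at this
  by_cases h : (aeval p F : ℝ) = 0
  · obtain ⟨V, hV, hVr⟩ := exists_rareIn_of_eq_zero hk hF hns hν hτ hτ5 hp0 h
    exact ⟨V, mem_nhdsWithin_of_mem_nhds hV, hVr⟩
  · obtain ⟨V, hV, hVr⟩ := exists_rareIn_of_ne_zero hF (by linarith : 0 < τ) h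
    exact ⟨V, mem_nhdsWithin_of_mem_nhds hV, hVr⟩

lemma Counted.exists_bezout {F : MvPolynomial (Fin 3) ℤ} {γ B : ℝ} {x : Fin 3 → ℤ}
    (h : Counted F γ B x) : ∃ d : Fin 3 → ℤ, ∑ i, d i * x i = 1 := by
  have h1 := Int.gcd_eq_gcd_ab (x 0) (Int.gcd (x 1) (x 2))
  have h2 := Int.gcd_eq_gcd_ab (x 1) (x 2)
  rw [h.1, Nat.cast_one] at h1
  generalize Int.gcdA (x 0) (Int.gcd (x 1) (x 2)) = A at h1
  generalize Int.gcdB (x 0) (Int.gcd (x 1) (x 2)) = D at h1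
  generalize Int.gcdA (x 1) (x 2) = a at h2
  generalize Int.gcdB (x 1) (x 2) = b at h2
  refine ⟨![A, a * D, b * D], ?_⟩
  rw [Fin.sum_univ_three]
  simp only [Matrix.cons_val]
  rw [h2] at h1
  linear_combination -h1

end

open Asymptotics Filter in
theorem statement3 (F : MvPolynomial (Fin 3) ℤ) (k : ℕ) (hk : 5 ≤ k)
    (hhom : F.IsHomogeneous k)
    (hns : ∀ x : Fin 3 → ℂ, x ≠ 0 → ∃ i, MvPolynomial.aeval x (MvPolynomial.pderiv i F) ≠ 0)
    (hν : ∀ p v : Fin 3 → ℂ, p ≠ 0 → MvPolynomial.aeval p F = 0 →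
      (∀ c : ℂ, v ≠ c • p) → contactOrder F p v ≤ 3)
    (γ : ℝ) (hγ0 : 0 ≤ γ) (hγk : γ ≤ (k : ℝ) - 2)
    (τ : ℝ) (hτ : τ = (k : ℝ) - γ)
    (hcase : (k ≤ 9 ∧ (9 : ℝ) / 2 < τ) ∨ (9 < k ∧ (3 : ℝ) / 2 * Real.sqrt k < τ)) :
    (fun B : ℝ => (Set.ncard {x : Fin 3 → ℤ | Counted F γ B x} : ℝ))
      =o[atTop] (fun B : ℝ => B) := by
  have hτ9 : 9 / 2 < τ := by
    rcases hcase with h | ⟨h1, h2⟩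
    · exact h.2
    · have : 3 < Real.sqrt k := by
        rw [Real.lt_sqrt (by norm_num)]
        have : (9 : ℝ) < k := by exact_mod_cast h1
        linarith
      linarith
  have hτ₀ : 9 / 2 < min τ (19 / 4) := lt_min hτ9 (by norm_num)
  have hτ₀5 : min τ (19 / 4) < 5 := (min_le_right _ _).trans_lt (by norm_num)
  have hrare := rareIn_annulus (by omega) hhom hns hν hτ₀ hτ₀5
  rw [isLittleO_iff]
  intro c hc
  filter_upwards [hrare c hc, eventually_ge_atTop 1] with B hB hB1
  have hB0 : 0 < B := by linarith
  rw [Real.norm_of_nonneg (Nat.cast_nonneg _), Real.norm_of_nonneg hB0.le]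
  by_cases hfin : {x : Fin 3 → ℤ | Counted F γ B x}.Finite
  · rw [Set.ncard_eq_toFinset_card _ hfin]
    refine hB _ fun x hx => ?_
    have hx' : Counted F γ B x := (Set.Finite.mem_toFinset hfin).1 hx
    have hd := hx'.exists_bezout
    obtain ⟨h1, h2, h3, h4⟩ := hx'
    have h5 : ∀ i, |(x i : ℝ)| ≤ B := by
      intro i
      fin_cases i
      · exact (le_max_left _ _).trans h4
      · exact ((le_max_left _ _).trans (le_max_right _ _)).trans h4
      · exact ((le_max_right _ _).trans (le_max_right _ _)).trans h4
    refine ⟨hd, ?_, h5, ?_, ?_⟩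
    · have h6 : (aeval (fun i => (x i : ℝ)) F : ℝ) = ((eval x F : ℤ) : ℝ) := by
        have := aeval_algebraMap_apply ℝ x F
        have h7 : (aeval x F : ℤ) = eval x F := by simp [aeval_eq_eval]
        rw [h7] at this
        exact this
      rw [h6, ← Int.cast_abs]
      refine h2.trans (Real.rpow_le_rpow_of_exponent_le hB1 ?_)
      linarith [min_le_left τ (19 / 4)]
    · by_contra hlt
      rw [not_le, pi_norm_lt_iff (by norm_num)] at hlt
      have h7 : ∀ i, |(x i : ℝ)| < B / 2 := by
        intro i
        have := hlt i
        rw [norm_div, Real.norm_of_nonneg hB0.le, Real.norm_eq_abs, div_lt_iff₀ hB0] at this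
        linarith
      exact absurd h3 (not_lt.2 (max_le (h7 0).le (max_le (h7 1).le (h7 2).le)))
    · rw [pi_norm_le_iff_of_nonneg zero_le_one]
      intro i
      rw [norm_div, Real.norm_of_nonneg hB0.le, Real.norm_eq_abs, div_le_one hB0]
      exact h5 i
  · rw [Set.Infinite.ncard hfin]
    simpa using mul_nonneg hc.le hB0.le
end

section
/- Let n ≥ 2 and let F ∈ ℤ[x_1,…,x_n] be a non-singular homogeneous form of degree k. Then there exist a positive integer M_0 and constants c_1, c_2 > 0, depending only on F, with the following property: for every positive integer M, consider the covering of [−1,1]^{n−1} by the closed cubes C_a = [a_1, a_1+(M_0M)^{−1}] × ⋯ × [a_{n−1}, a_{n−1}+(M_0M)^{−1}] with corners a on the grid of mesh (M_0M)^{−1}. Then the number of cubes C_a containing a real point t = (t_1,…,t_{n−1}) with |F(t_1,…,t_{n−1},1)| ≤ (M_0M)^{−1} is at most c_1·M^{n−2}; moreover, for each such cube there is an index i ∈ {1,…,n−1} such that |∂F/∂x_i(t_1,…,t_{n−1},1)| ≥ c_2 for all t in the cube. -/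
open MvPolynomial

/-- The point `t` lies in the closed cube with corner `a / N` and sidelength `1 / N`. -/
def inCube (m : ℕ) (N : ℕ) (a : Fin m → ℤ) (t : Fin m → ℝ) : Prop :=
  ∀ i, (a i : ℝ) / N ≤ t i ∧ t i ≤ (a i : ℝ) / N + 1 / N

/-- The cube `C_a` (of mesh `1/N`) meets `[-1,1]^m` appropriately and contains a real
solution of `|F(t₁,…,t_m,1)| ≤ 1/N`. -/
def cubeHasSolution (m : ℕ) (F : MvPolynomial (Fin (m + 1)) ℤ) (N : ℕ) (a : Fin m → ℤ) : Prop :=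
  (∀ i, -(N : ℤ) ≤ a i ∧ a i ≤ (N : ℤ) - 1) ∧
  ∃ t : Fin m → ℝ, inCube m N a t ∧
    |MvPolynomial.aeval (Fin.snoc t (1 : ℝ)) F| ≤ 1 / (N : ℝ)

/-- Coordinatewise derivatives of a polynomial function are given by `MvPolynomial.pderiv`. -/
theorem hasDerivAt_aeval_update {σ : Type*} [DecidableEq σ] (F : MvPolynomial σ ℤ) (x : σ → ℝ)
    (i : σ) (s : ℝ) :
    HasDerivAt (fun s => aeval (Function.update x i s) F)
      (aeval (Function.update x i s) (pderiv i F)) s := by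
  induction F using MvPolynomial.induction_on with
  | C c => simpa using hasDerivAt_const s (c : ℝ)
  | add p q hp hq => simpa only [map_add] using hp.fun_add hq
  | mul_X p j hp =>
    have hX : HasDerivAt (fun s => Function.update x i s j) (if j = i then 1 else 0) s := by
      by_cases h : j = i
      · subst h; simpa using hasDerivAt_id' s
      · simpa [h] using hasDerivAt_const s (x j)
    simp only [map_mul, aeval_X]
    refine (hp.fun_mul hX).congr_deriv ?_
    rw [pderiv_mul]
    by_cases h : j = i
    · subst h; simp
    · simp [pderiv_X_of_ne h, h]

theorem contDiff_aeval_comp {σ E : Type*} [NormedAddCommGroup E] [NormedSpace ℝ E]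
    (F : MvPolynomial σ ℤ) {g : E → σ → ℝ} (hg : ∀ j, ContDiff ℝ 1 fun t => g t j) :
    ContDiff ℝ 1 (fun t => aeval (g t) F) := by
  induction F using MvPolynomial.induction_on with
  | C c => simpa using contDiff_const
  | add p q hp hq => simpa using hp.add hq
  | mul_X p j hp => simpa using hp.mul (hg j)

theorem contDiff_snoc_one {m : ℕ} (j : Fin (m + 1)) :
    ContDiff ℝ 1 fun t : Fin m → ℝ => (Fin.snoc t (1 : ℝ) : Fin (m + 1) → ℝ) j := by
  refine Fin.lastCases ?_ (fun j => ?_) j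
  · simpa using contDiff_const
  · simpa using contDiff_apply ℝ ℝ j

/-- The value of a form at `(t, 1)`, together with its partial derivatives in the coordinates
of `t`. -/
noncomputable def affineJet {m : ℕ} (F : MvPolynomial (Fin (m + 1)) ℤ) (t : Fin m → ℝ) :
    ℝ × (Fin m → ℝ) :=
  (aeval (Fin.snoc t (1 : ℝ)) F, fun i => aeval (Fin.snoc t (1 : ℝ)) (pderiv (Fin.castSucc i) F))

theorem contDiff_affineJet {m : ℕ} (F : MvPolynomial (Fin (m + 1)) ℤ) :
    ContDiff ℝ 1 (affineJet F) :=
  (contDiff_aeval_comp F contDiff_snoc_one).prodMk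
    (contDiff_pi.2 fun _ => contDiff_aeval_comp _ contDiff_snoc_one)

/-- By Euler's identity, the affine hypersurface `F(t, 1) = 0` of a non-singular form is
non-singular. -/
theorem affineJet_ne_zero {m k : ℕ} {F : MvPolynomial (Fin (m + 1)) ℤ} (hhom : F.IsHomogeneous k)
    (hns : ∀ x : Fin (m + 1) → ℂ, x ≠ 0 → ∃ i, aeval x (pderiv i F) ≠ 0) (t : Fin m → ℝ) :
    affineJet F t ≠ 0 := by
  intro h
  set x : Fin (m + 1) → ℝ := Fin.snoc t (1 : ℝ) with hx
  have h0 : aeval x F = 0 := congrArg Prod.fst h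
  have h1 (i : Fin m) : aeval x (pderiv (Fin.castSucc i) F) = 0 :=
    congrFun (congrArg Prod.snd h) i
  have hlast : x (Fin.last m) = 1 := by simp [hx]
  have euler := congrArg (aeval x) hhom.sum_X_mul_pderiv
  rw [Fin.sum_univ_castSucc, map_add, map_sum] at euler
  simp only [map_mul, aeval_X, h1, map_nsmul, h0, mul_zero,
    Finset.sum_const_zero, hlast, one_mul, zero_add, smul_zero] at euler
  obtain ⟨i, hi⟩ := hns (fun j => algebraMap ℝ ℂ (x j))
    (fun h => by simpa [hlast] using congrFun h (Fin.last m))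
  refine hi ((aeval_algebraMap_apply ℂ x (pderiv i F)).trans ?_)
  rw [map_eq_zero]
  exact Fin.lastCases (motive := fun i => aeval x (pderiv i F) = 0) euler h1 i

theorem exists_le_abs_of_le_norm {ι : Type*} [Fintype ι] {δ : ℝ} (hδ : 0 < δ) {x : ℝ × (ι → ℝ)}
    (hx : δ ≤ ‖x‖) (h : |x.1| < δ) : ∃ i, δ ≤ |x.2 i| := by
  by_contra! hlt
  exact hx.not_gt (max_lt h ((pi_norm_lt_iff hδ).2 hlt))

/-- A function whose derivative is at least `c` in absolute value between two points separates
them by at least `c` times their distance. -/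
theorem mul_abs_sub_le_of_le_abs_deriv {g g' : ℝ → ℝ} {a b c : ℝ}
    (hg : ∀ s, HasDerivAt g (g' s) s) (hc : ∀ s ∈ Set.uIcc a b, c ≤ |g' s|) :
    c * |a - b| ≤ |g a - g b| := by
  wlog hab : a ≤ b generalizing a b
  · rw [abs_sub_comm a, abs_sub_comm (g a)]
    exact this (by rwa [Set.uIcc_comm]) (le_of_not_ge hab)
  rcases hab.eq_or_lt with rfl | hlt
  · simp
  obtain ⟨ξ, hξ, h⟩ := exists_hasDerivAt_eq_slope g g' hlt
    (fun s _ => (hg s).continuousAt.continuousWithinAt) (fun s _ => hg s)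
  rw [eq_div_iff (sub_ne_zero.2 hlt.ne')] at h
  rw [abs_sub_comm a, abs_sub_comm (g a), ← h, abs_mul]
  exact mul_le_mul_of_nonneg_right
    (hc ξ (by rw [Set.uIcc_of_le hab]; exact Set.Ioo_subset_Icc_self hξ)) (abs_nonneg _)

/-- A set of lattice points in a box of side `2 M₀ M`, in which points of the same type on a common
line at distance less than `M` are in fact at distance less than `D`, is small. -/
theorem ncard_le_of_abs_sub_lt {m M₀ M D : ℕ} (hM : 0 < M) (hD : 0 < D)
    {S : Set (Fin (m + 1) → ℤ)} (P : Fin (m + 1) → (Fin (m + 1) → ℤ) → Prop)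
    (hbox : ∀ a ∈ S, ∀ i, -((M₀ * M : ℕ) : ℤ) ≤ a i ∧ a i ≤ ((M₀ * M : ℕ) : ℤ) - 1)
    (htype : ∀ a ∈ S, ∃ i, P i a)
    (hsep : ∀ i, ∀ a ∈ S, ∀ b ∈ S, P i a → P i b → i.removeNth a = i.removeNth b →
      |a i - b i| < M → |a i - b i| < D) :
    S.ncard ≤ (m + 1) * ((2 * (M₀ * M)) ^ m * (2 * M₀ * D)) := by
  have htype' (a) : ∃ i, a ∈ S → P i a := by
    by_cases ha : a ∈ S
    · exact (htype a ha).imp fun _ h _ => h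
    · exact ⟨0, fun h => absurd h ha⟩
  choose ι hι using htype'
  let f (a : Fin (m + 1) → ℤ) : Fin (m + 1) × (Fin m → ℤ) × ℤ × ℤ :=
    (ι a, (ι a).removeNth a, a (ι a) / M, a (ι a) % D)
  let T : Finset (Fin (m + 1) × (Fin m → ℤ) × ℤ × ℤ) :=
    Finset.univ ×ˢ Fintype.piFinset (fun _ => Finset.Ico (-((M₀ * M : ℕ) : ℤ)) (M₀ * M : ℕ)) ×ˢ
      Finset.Ico (-(M₀ : ℤ)) M₀ ×ˢ Finset.Ico (0 : ℤ) D
  have hM' : (0 : ℤ) < M := by exact_mod_cast hM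
  have hD' : (0 : ℤ) < D := by exact_mod_cast hD
  have hT : T.card = (m + 1) * ((2 * (M₀ * M)) ^ m * (2 * M₀ * D)) := by
    have e (x : ℕ) : ((x : ℤ) - -(x : ℤ)).toNat = 2 * x := by omega
    simp only [T, Finset.card_product, Fintype.card_piFinset, Int.card_Ico, e, Finset.card_univ,
      Fintype.card_fin, Finset.prod_const, sub_zero, Int.toNat_natCast]
  rw [← hT, ← Set.ncard_coe_finset]
  refine Set.ncard_le_ncard_of_injOn f (fun a ha => ?_) (fun a ha b hb hab => ?_)
    T.finite_toSet
  · have hb := hbox a ha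
    simp only [T, f, Finset.coe_product, Set.mem_prod, Finset.mem_coe, Finset.mem_univ, true_and,
      Fintype.mem_piFinset, Finset.mem_Ico]
    refine ⟨fun j => ?_, ⟨?_, ?_⟩, Int.emod_nonneg _ hD'.ne', Int.emod_lt_of_pos _ hD'⟩
    · have := hb ((ι a).succAbove j)
      exact ⟨this.1, by simp only [Fin.removeNth]; omega⟩
    · rw [Int.le_ediv_iff_mul_le hM']
      simpa using (hb (ι a)).1
    · rw [Int.ediv_lt_iff_lt_mul hM']
      have := (hb (ι a)).2
      push_cast at this
      omega
  · simp only [f, Prod.mk.injEq] at hab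
    obtain ⟨hi, hrem, hdiv, hmod⟩ := hab
    have hPa := hι a ha
    have hPb := hι b hb
    rw [← hi] at hPb hrem hdiv hmod
    have hlt : |a (ι a) - b (ι a)| < M := by
      have h1 := Int.emod_add_mul_ediv (a (ι a)) M
      have h2 := Int.emod_add_mul_ediv (b (ι a)) M
      have h3 := Int.emod_nonneg (a (ι a)) hM'.ne'
      have h4 := Int.emod_nonneg (b (ι a)) hM'.ne'
      have h5 := Int.emod_lt_of_pos (a (ι a)) hM'
      have h6 := Int.emod_lt_of_pos (b (ι a)) hM'
      rw [hdiv] at h1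
      rw [abs_lt]
      constructor <;> linarith
    have hcoord : a (ι a) = b (ι a) := by
      have hdvd : (D : ℤ) ∣ a (ι a) - b (ι a) := Int.ModEq.dvd (Eq.symm hmod)
      exact sub_eq_zero.1 (Int.eq_zero_of_abs_lt_dvd hdvd (hsep _ a ha b hb hPa hPb hrem hlt))
    rw [← Fin.insertNth_self_removeNth (ι a) a, ← Fin.insertNth_self_removeNth (ι a) b, hrem,
      hcoord]

theorem dist_le_of_inCube {m N : ℕ} {a : Fin m → ℤ} {t u : Fin m → ℝ} (ht : inCube m N a t)
    (hu : inCube m N a u) : dist t u ≤ 1 / N := by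
  refine (dist_pi_le_iff (by positivity)).2 fun i => ?_
  rw [Real.dist_eq, abs_le]
  constructor <;> linarith [(ht i).1, (ht i).2, (hu i).1, (hu i).2]

theorem inCube_corner (m N : ℕ) (a : Fin m → ℤ) : inCube m N a fun i => (a i : ℝ) / N :=
  fun _ => ⟨le_rfl, le_add_of_nonneg_right (by positivity)⟩

theorem mem_Icc_of_inCube {m N : ℕ} (hN : 0 < N) {a : Fin m → ℤ}
    (ha : ∀ i, -(N : ℤ) ≤ a i ∧ a i ≤ (N : ℤ) - 1) {t : Fin m → ℝ} (ht : inCube m N a t) :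
    t ∈ Set.Icc (-1 : Fin m → ℝ) 1 := by
  have hN' : (0 : ℝ) < N := by exact_mod_cast hN
  refine ⟨fun i => le_trans ?_ (ht i).1, fun i => (ht i).2.trans ?_⟩
  · have h : (-(N : ℝ)) ≤ a i := by exact_mod_cast (ha i).1
    rw [le_div_iff₀ hN']
    simpa using h
  · have h : (a i : ℝ) ≤ N - 1 := by exact_mod_cast (ha i).2
    rw [← add_div, div_le_iff₀ hN']
    simp only [Pi.one_apply]
    linarith


theorem statement5 (m : ℕ) (hm : 1 ≤ m) (F : MvPolynomial (Fin (m + 1)) ℤ) (k : ℕ)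
    (hhom : F.IsHomogeneous k)
    (hns : ∀ x : Fin (m + 1) → ℂ, x ≠ 0 →
      ∃ i, MvPolynomial.aeval x (MvPolynomial.pderiv i F) ≠ 0) :
    ∃ (M₀ : ℕ) (c₁ c₂ : ℝ), 0 < M₀ ∧ 0 < c₁ ∧ 0 < c₂ ∧ ∀ M : ℕ, 0 < M →
      ((Set.ncard {a : Fin m → ℤ | cubeHasSolution m F (M₀ * M) a} : ℝ)
          ≤ c₁ * (M : ℝ) ^ (m - 1)) ∧
      ∀ a : Fin m → ℤ, cubeHasSolution m F (M₀ * M) a →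
        ∃ i : Fin m, ∀ t : Fin m → ℝ, inCube m (M₀ * M) a t →
          c₂ ≤ |MvPolynomial.aeval (Fin.snoc t (1 : ℝ))
            (MvPolynomial.pderiv (Fin.castSucc i) F)| := by
  obtain ⟨m, rfl⟩ : ∃ m', m = m' + 1 := ⟨m - 1, by omega⟩
  set K : Set (Fin (m + 1) → ℝ) := Set.Icc (-1) 1
  have hK : IsCompact K := isCompact_Icc
  obtain ⟨δ, hδ, hδK⟩ : ∃ δ : ℝ, 0 < δ ∧ ∀ t ∈ K, δ ≤ ‖affineJet F t‖ := by
    obtain ⟨t₀, -, hmin⟩ := hK.exists_isMinOn ⟨0, by simp [K]⟩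
      (contDiff_affineJet F).continuous.norm.continuousOn
    exact ⟨_, norm_pos_iff.2 (affineJet_ne_zero hhom hns t₀), hmin⟩
  obtain ⟨L, hL, hlip⟩ : ∃ L : ℝ, 0 < L ∧ ∀ t ∈ K, ∀ u ∈ K,
      ‖affineJet F t - affineJet F u‖ ≤ L * dist t u := by
    obtain ⟨L, h⟩ := (contDiff_affineJet F).contDiffOn.exists_lipschitzOnWith one_ne_zero
      (convex_Icc (-1) 1) hK
    refine ⟨L + 1, by positivity, fun t ht u hu => ?_⟩
    rw [← dist_eq_norm]
    exact (h.dist_le_mul t ht u hu).trans (by gcongr; simp)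
  have hlip₁ : ∀ t ∈ K, ∀ u ∈ K, |(affineJet F t).1 - (affineJet F u).1| ≤ L * dist t u :=
    fun t ht u hu => (norm_fst_le _).trans (hlip t ht u hu)
  have hlip₂ : ∀ i, ∀ t ∈ K, ∀ u ∈ K,
      |(affineJet F t).2 i - (affineJet F u).2 i| ≤ L * dist t u :=
    fun i t ht u hu => (norm_le_pi_norm _ i).trans ((norm_snd_le _).trans (hlip t ht u hu))
  obtain ⟨M₀, hM₀⟩ := exists_nat_gt (max (1 / δ) (4 * L / δ))
  obtain ⟨D, hD⟩ := exists_nat_gt (4 * (1 + L) / δ)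
  have hM₀pos : (0 : ℝ) < M₀ := (by positivity : 0 < 1 / δ).trans ((le_max_left _ _).trans_lt hM₀)
  have hDpos : (0 : ℝ) < D := (by positivity : 0 < 4 * (1 + L) / δ).trans hD
  have hM₀δ : 1 / (M₀ : ℝ) < δ := by
    have := (le_max_left _ _).trans_lt hM₀
    rw [div_lt_iff₀ hδ] at this
    rw [div_lt_iff₀ hM₀pos]
    linarith
  have hM₀L : L * (1 / (M₀ : ℝ)) ≤ δ / 4 := by
    have := (le_max_right _ _).trans_lt hM₀
    rw [div_lt_iff₀ hδ] at this
    rw [mul_one_div, div_le_iff₀ hM₀pos]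
    linarith
  rw [div_lt_iff₀ hδ] at hD
  refine ⟨M₀, (m + 1) * ((2 * M₀) ^ m * (2 * M₀ * D)), δ / 2, by exact_mod_cast hM₀pos,
    by positivity, by positivity, fun M hM => ?_⟩
  have hMpos : (0 : ℝ) < M := by exact_mod_cast hM
  have hNpos : 0 < M₀ * M := Nat.mul_pos (by exact_mod_cast hM₀pos) hM
  set N := M₀ * M with hN
  have hNpos' : (0 : ℝ) < N := by exact_mod_cast hNpos
  have hNM₀ : 1 / (N : ℝ) ≤ 1 / M₀ :=
    one_div_le_one_div_of_le hM₀pos (by exact_mod_cast Nat.le_mul_of_pos_right M₀ hM)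
  have hderiv : ∀ a, cubeHasSolution (m + 1) F N a → ∃ i, ∀ t, inCube (m + 1) N a t →
      3 * δ / 4 ≤ |(affineJet F t).2 i| := by
    rintro a ⟨ha, t₀, ht₀, hF⟩
    have ht₀K := mem_Icc_of_inCube hNpos ha ht₀
    obtain ⟨i, hi⟩ := exists_le_abs_of_le_norm hδ (hδK t₀ ht₀K)
      (hF.trans_lt (hNM₀.trans_lt hM₀δ))
    refine ⟨i, fun t ht => ?_⟩
    have h1 := hlip₂ i t₀ ht₀K t (mem_Icc_of_inCube hNpos ha ht)
    have h2 : L * dist t₀ t ≤ L * (1 / M₀) :=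
      mul_le_mul_of_nonneg_left ((dist_le_of_inCube ht₀ ht).trans hNM₀) hL.le
    linarith [abs_sub_abs_le_abs_sub ((affineJet F t₀).2 i) ((affineJet F t).2 i)]
  refine ⟨?_, fun a ha => (hderiv a ha).imp fun i h t ht => le_trans (by linarith) (h t ht)⟩
  have hcorner : ∀ a, cubeHasSolution (m + 1) F N a →
      |(affineJet F fun i => (a i : ℝ) / N).1| ≤ (1 + L) / N := by
    rintro a ⟨ha, t₀, ht₀, hF⟩
    have hc := inCube_corner (m + 1) N a
    have h1 := hlip₁ _ (mem_Icc_of_inCube hNpos ha hc) t₀ (mem_Icc_of_inCube hNpos ha ht₀)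
    have h2 := mul_le_mul_of_nonneg_left (dist_le_of_inCube hc ht₀) hL.le
    have h3 : |(affineJet F t₀).1| ≤ 1 / N := hF
    rw [add_div, ← mul_one_div L]
    linarith [abs_sub_abs_le_abs_sub (affineJet F fun i => (a i : ℝ) / N).1 (affineJet F t₀).1]
  have hcount := ncard_le_of_abs_sub_lt (m := m) (M₀ := M₀) hM
    (by exact_mod_cast hDpos : 0 < D) (S := {a | cubeHasSolution (m + 1) F N a})
    (fun i a => ∀ t, inCube (m + 1) N a t → 3 * δ / 4 ≤ |(affineJet F t).2 i|)
    (fun a ha => ha.1) hderiv (fun i a ha b hb hPa _ hrem hlt => ?_)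
  · have hcount' : (Set.ncard {a | cubeHasSolution (m + 1) F N a} : ℝ) ≤
        (m + 1) * ((2 * (M₀ * M)) ^ m * (2 * M₀ * D)) := by exact_mod_cast hcount
    refine hcount'.trans_eq ?_
    rw [Nat.add_sub_cancel, ← mul_assoc 2 (M₀ : ℝ), mul_pow _ (M : ℝ)]
    ring
  set p : Fin (m + 1) → ℝ := fun j => (a j : ℝ) / N
  have hpK : p ∈ K := mem_Icc_of_inCube hNpos ha.1 (inCube_corner _ N a)
  have hqK := mem_Icc_of_inCube hNpos hb.1 (inCube_corner _ N b)
  have hq : (fun j => (b j : ℝ) / N) = Function.update p i ((b i : ℝ) / N) := by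
    ext j
    by_cases h : j = i
    · subst h; simp
    · obtain ⟨j, rfl⟩ := Fin.exists_succAbove_eq h
      have : a (i.succAbove j) = b (i.succAbove j) := congrFun hrem j
      simp [p, this]
  have hseg : ∀ s ∈ Set.uIcc (p i) ((b i : ℝ) / N),
      δ / 2 ≤ |(affineJet F (Function.update p i s)).2 i| := by
    intro s hs
    have hsK : Function.update p i s ∈ K := by
      have hs' := Set.uIcc_subset_Icc (a₂ := (-1 : ℝ)) (b₂ := 1) ⟨hpK.1 i, hpK.2 i⟩
        ⟨hqK.1 i, hqK.2 i⟩ hs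
      refine ⟨fun j => ?_, fun j => ?_⟩ <;> by_cases h : j = i
      · subst h; simpa using hs'.1
      · simpa [h] using hpK.1 j
      · subst h; simpa using hs'.2
      · simpa [h] using hpK.2 j
    have hdist : dist p (Function.update p i s) ≤ 1 / M₀ := by
      refine (dist_pi_le_iff (by positivity)).2 fun j => ?_
      by_cases h : j = i
      · subst h
        have h1 := Set.abs_sub_left_of_mem_uIcc hs
        have h2 : |(b j : ℝ) / N - p j| ≤ 1 / M₀ := by
          have h3 : |(a j : ℝ) - b j| ≤ M := by exact_mod_cast hlt.le
          rw [← sub_div, abs_div, abs_of_pos hNpos', abs_sub_comm, div_le_div_iff₀ hNpos' hM₀pos,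
            hN]
          push_cast
          nlinarith
        rw [Function.update_self, dist_comm, Real.dist_eq]
        exact h1.trans h2
      · simp [h]
    have h1 := hlip₂ i p hpK _ hsK
    have h2 := mul_le_mul_of_nonneg_left hdist hL.le
    have h3 := hPa p (inCube_corner _ N a)
    linarith [abs_sub_abs_le_abs_sub ((affineJet F p).2 i)
      ((affineJet F (Function.update p i s)).2 i)]
  have hg (s : ℝ) : HasDerivAt (fun s => (affineJet F (Function.update p i s)).1)
      ((affineJet F (Function.update p i s)).2 i) s := by
    simpa only [affineJet, Fin.snoc_update] using
      hasDerivAt_aeval_update F (Fin.snoc p (1 : ℝ)) i.castSucc s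
  have hmvt := mul_abs_sub_le_of_le_abs_deriv hg hseg
  rw [← hq, Function.update_eq_self] at hmvt
  have hsum := hmvt.trans ((abs_sub _ _).trans (add_le_add (hcorner a ha) (hcorner b hb)))
  rw [← sub_div, abs_div, abs_of_pos hNpos', ← add_div, ← mul_div_assoc,
    div_le_div_iff_of_pos_right hNpos'] at hsum
  have : |(a i : ℝ) - b i| < D := by
    by_contra! hge
    nlinarith
  exact_mod_cast this
end

section
/- Let m ≥ 1 be an integer and α ∈ [1,∞). Then there is a constant C = C(m,α) such that for all ν ≥ 1 the number Σ_{m,α,ν} of lattice points in Δ_{m,α,ν} satisfies |Σ_{m,α,ν} − ν^m/(α·m!)| ≤ C·ν^{m−1}. -/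
lemma pow_succ_sub_pow_succ_le {a b : ℝ} (hb : 0 ≤ b) (hab : b ≤ a) (m : ℕ) :
    a ^ (m + 1) - b ^ (m + 1) ≤ (m + 1) * (a - b) * a ^ m := by
  induction m with
  | zero => simp
  | succ m ih =>
    have ha : 0 ≤ a := hb.trans hab
    have h₁ := mul_le_mul_of_nonneg_left ih ha
    have h₂ := mul_le_mul_of_nonneg_left (pow_le_pow_left₀ hb hab (m + 1)) (sub_nonneg.2 hab)
    push_cast
    calc a ^ (m + 1 + 1) - b ^ (m + 1 + 1)
        = a * (a ^ (m + 1) - b ^ (m + 1)) + (a - b) * b ^ (m + 1) := by ring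
      _ ≤ a * ((m + 1) * (a - b) * a ^ m) + (a - b) * a ^ (m + 1) := add_le_add h₁ h₂
      _ = _ := by ring

lemma le_pow_succ_sub_pow_succ {a b : ℝ} (hb : 0 ≤ b) (hab : b ≤ a) (m : ℕ) :
    (m + 1) * (a - b) * b ^ m ≤ a ^ (m + 1) - b ^ (m + 1) := by
  induction m with
  | zero => simp
  | succ m ih =>
    have h₁ := mul_le_mul_of_nonneg_left ih hb
    have h₂ := mul_le_mul_of_nonneg_left (pow_le_pow_left₀ hb hab (m + 1)) (sub_nonneg.2 hab)
    push_cast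
    calc (m + 1 + 1) * (a - b) * b ^ (m + 1)
        = b * ((m + 1) * (a - b) * b ^ m) + (a - b) * b ^ (m + 1) := by ring
      _ ≤ b * (a ^ (m + 1) - b ^ (m + 1)) + (a - b) * a ^ (m + 1) := add_le_add h₁ h₂
      _ = _ := by ring

/-- A left Riemann sum of a decreasing power dominates the integral. -/
lemma pow_succ_sub_le_sum {w t : ℝ} (hw : 0 ≤ w) (m n : ℕ) (hn : w * n ≤ t) :
    t ^ (m + 1) - (t - w * n) ^ (m + 1) ≤
      (m + 1) * w * ∑ k ∈ Finset.range n, (t - w * k) ^ m := by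
  induction n with
  | zero => simp
  | succ n ih =>
    push_cast at hn ⊢
    have h := pow_succ_sub_pow_succ_le (a := t - w * n) (b := t - w * (n + 1))
      (by linarith) (by linarith) m
    have ih := ih (by linarith)
    rw [Finset.sum_range_succ, mul_add (_ * w)]
    have e : t - w * n - (t - w * (n + 1)) = w := by ring
    rw [e] at h
    linarith

/-- A left Riemann sum of a decreasing power is dominated by the shifted integral. -/
lemma sum_le_pow_succ_sub {w t : ℝ} (hw : 0 ≤ w) (m n : ℕ) (hn : w * n ≤ t + w) :
    (m + 1) * w * ∑ k ∈ Finset.range n, (t - w * k) ^ m ≤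
      (t + w) ^ (m + 1) - (t + w - w * n) ^ (m + 1) := by
  induction n with
  | zero => simp
  | succ n ih =>
    push_cast at hn ⊢
    have h := le_pow_succ_sub_pow_succ (a := t + w - w * n) (b := t - w * n)
      (by linarith) (by linarith) m
    have ih := ih (by linarith)
    rw [Finset.sum_range_succ, mul_add]
    have e : t + w - w * n - (t - w * n) = w := by ring
    have e' : t + w - w * (n + 1) = t - w * n := by ring
    rw [e] at h
    rw [e']
    linarith

/-- The lattice points of the simplex `∑ i, w i * x i ≤ ν` in the positive orthant form a finite
set, whose cardinality lies between the volume of that simplex and the volume of its dilate with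
`ν` replaced by `ν + ∑ i, w i`. -/
lemma exists_finset_lattice_simplex (m : ℕ) (w : Fin m → ℝ) (hw : ∀ i, 0 < w i) (ν : ℝ)
    (hν : 0 ≤ ν) :
    ∃ s : Finset (Fin m → ℤ),
      (∀ x, x ∈ s ↔ (∀ i, 0 ≤ x i) ∧ ∑ i, w i * (x i : ℝ) ≤ ν) ∧
      ν ^ m ≤ m.factorial * (∏ i, w i) * s.card ∧
      m.factorial * (∏ i, w i) * s.card ≤ (ν + ∑ i, w i) ^ m := by
  induction m generalizing ν with
  | zero =>
    refine ⟨Finset.univ, fun x => iff_of_true (Finset.mem_univ x) ⟨fun i => i.elim0, by simpa⟩,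
      by simp, by simp⟩
  | succ m ih =>
    have hw₀ : 0 < w 0 := hw 0
    set K := ⌊ν / w 0⌋₊
    have hKν : w 0 * K ≤ ν := by
      have := Nat.floor_le (div_nonneg hν hw₀.le)
      rw [le_div_iff₀ hw₀] at this
      linarith
    have hνK : ν < w 0 * (K + 1) := by
      have := Nat.lt_floor_add_one (ν / w 0)
      rw [div_lt_iff₀ hw₀] at this
      linarith
    have hk : ∀ k : ℕ, k ∈ Finset.range (K + 1) → 0 ≤ ν - w 0 * k := fun k hk => by
      have h : (k : ℝ) ≤ K := by exact_mod_cast Nat.lt_succ_iff.1 (Finset.mem_range.1 hk)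
      nlinarith
    have ih' : ∀ k : ℕ, ∃ s : Finset (Fin m → ℤ), k ∈ Finset.range (K + 1) → _ := fun k => by
      by_cases h : k ∈ Finset.range (K + 1)
      · obtain ⟨s, hs⟩ := ih (fun i => w i.succ) (fun i => hw _) _ (hk k h)
        exact ⟨s, fun _ => hs⟩
      · exact ⟨∅, fun h' => absurd h' h⟩
    choose s hs using ih'
    classical
    have hcard : ((Finset.range (K + 1)).biUnion fun k =>
        (s k).image (Fin.cons (α := fun _ => ℤ) (k : ℤ))).card =
          ∑ k ∈ Finset.range (K + 1), (s k).card := by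
      rw [Finset.card_biUnion]
      · exact Finset.sum_congr rfl fun k _ =>
          Finset.card_image_of_injective _ (Fin.cons_right_injective _)
      · intro k _ l _ hkl
        rw [Function.onFun, Finset.disjoint_left]
        intro x hx hx'
        obtain ⟨y, -, rfl⟩ := Finset.mem_image.1 hx
        obtain ⟨z, -, hz⟩ := Finset.mem_image.1 hx'
        have := congrFun hz 0
        simp only [Fin.cons_zero, Nat.cast_inj] at this
        exact hkl this.symm
    have hS : 0 ≤ ∑ i : Fin m, w i.succ := Finset.sum_nonneg fun i _ => (hw _).le
    have hm : (0 : ℝ) ≤ (m + 1) * w 0 := by positivity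
    have hfac : ((m + 1).factorial : ℝ) * (∏ i, w i) *
        ((∑ k ∈ Finset.range (K + 1), (s k).card : ℕ) : ℝ) = (m + 1) * w 0 *
          ∑ k ∈ Finset.range (K + 1), m.factorial * (∏ i : Fin m, w i.succ) * (s k).card := by
      rw [Fin.prod_univ_succ, Nat.factorial_succ, ← Finset.mul_sum]
      push_cast
      ring
    refine ⟨(Finset.range (K + 1)).biUnion fun k =>
      (s k).image (Fin.cons (α := fun _ => ℤ) (k : ℤ)), fun x => ?_, ?_, ?_⟩
    · simp only [Finset.mem_biUnion, Finset.mem_image]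
      constructor
      · rintro ⟨k, hkK, y, hy, rfl⟩
        obtain ⟨hy₀, hy₁⟩ := ((hs k hkK).1 y).1 hy
        refine ⟨Fin.cases (by simp) (by simpa using hy₀), ?_⟩
        rw [Fin.sum_univ_succ]
        simp only [Fin.cons_zero, Fin.cons_succ, Int.cast_natCast]
        linarith
      · rintro ⟨hx₀, hx₁⟩
        rw [Fin.sum_univ_succ] at hx₁
        obtain ⟨k, hkx⟩ := Int.eq_ofNat_of_zero_le (hx₀ 0)
        have hx0 : ((x 0 : ℤ) : ℝ) = k := by rw [hkx]; simp
        rw [hx0] at hx₁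
        have hrest : 0 ≤ ∑ i : Fin m, w i.succ * (x i.succ : ℝ) := Finset.sum_nonneg fun i _ =>
          mul_nonneg (hw _).le (by exact_mod_cast hx₀ _)
        have hkK : k ∈ Finset.range (K + 1) := by
          have h : (k : ℝ) < (K + 1 : ℕ) := by
            push_cast
            exact lt_of_mul_lt_mul_left (by linarith) hw₀.le
          exact Finset.mem_range.2 (by exact_mod_cast h)
        refine ⟨k, hkK, Fin.tail x, ((hs k hkK).1 _).2 ⟨fun i => hx₀ _, ?_⟩, ?_⟩
        · simp only [Fin.tail]
          linarith
        · rw [← hkx]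
          exact Fin.cons_self_tail x
    · rw [hcard, hfac]
      refine le_trans ?_ (mul_le_mul_of_nonneg_left
        (Finset.sum_le_sum fun k hk' => (hs k hk').2.1) hm)
      have h₁ := pow_succ_sub_le_sum hw₀.le m K hKν
      have h₂ := pow_succ_sub_pow_succ_le le_rfl (sub_nonneg.2 hKν) m
      have h₃ : (m + 1) * (ν - w 0 * K - 0) * (ν - w 0 * K) ^ m ≤
          (m + 1) * w 0 * (ν - w 0 * K) ^ m := by
        have := pow_nonneg (sub_nonneg.2 hKν) m
        gcongr
        linarith
      rw [zero_pow (Nat.succ_ne_zero m)] at h₂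
      rw [Finset.sum_range_succ, mul_add]
      linarith
    · rw [hcard, hfac]
      refine le_trans (mul_le_mul_of_nonneg_left
        (Finset.sum_le_sum fun k hk' => (hs k hk').2.2) hm) ?_
      have h := sum_le_pow_succ_sub (t := ν + ∑ i : Fin m, w i.succ) hw₀.le m (K + 1)
        (by push_cast; linarith)
      have h₀ : 0 ≤ (ν + ∑ i : Fin m, w i.succ + w 0 - w 0 * (K + 1 : ℕ)) ^ (m + 1) :=
        pow_nonneg (by push_cast; linarith) _
      have e : ∀ k : ℕ, ν - w 0 * k + ∑ i : Fin m, w i.succ =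
          ν + ∑ i : Fin m, w i.succ - w 0 * k := fun k => by ring
      have e' : ν + ∑ i, w i = ν + ∑ i : Fin m, w i.succ + w 0 := by
        rw [Fin.sum_univ_succ]; ring
      simp only [e]
      rw [e']
      linarith

theorem statement7 (m : ℕ) (hm : 1 ≤ m) (α : ℝ) (hα : 1 ≤ α) :
    ∃ C : ℝ, ∀ ν : ℝ, 1 ≤ ν →
      |(Set.ncard {x : Fin m → ℤ | (∀ i, 0 ≤ x i) ∧
            (∑ i, (x i : ℝ)) + (α - 1) * ((x ⟨m - 1, by omega⟩ : ℤ) : ℝ) ≤ ν} : ℝ)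
          - ν ^ m / (α * (m.factorial : ℝ))| ≤ C * ν ^ (m - 1) := by
  obtain ⟨n, rfl⟩ : ∃ n, m = n + 1 := ⟨m - 1, by omega⟩
  have hα₀ : 0 < α := by linarith
  set w : Fin (n + 1) → ℝ := Function.update 1 (Fin.last n) α with hwdef
  have hw : ∀ i, 0 < w i := fun i => by
    rcases eq_or_ne i (Fin.last n) with rfl | h
    · simpa [hwdef] using hα₀
    · simp [hwdef, h]
  have hprod : ∏ i, w i = α := by
    simp [hwdef, Finset.prod_update_of_mem]
  have hsum : ∀ x : Fin (n + 1) → ℤ,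
      ∑ i, w i * (x i : ℝ) = (∑ i, (x i : ℝ)) + (α - 1) * (x (Fin.last n) : ℝ) := fun x => by
    rw [Fin.sum_univ_castSucc, Fin.sum_univ_castSucc]
    simp [hwdef, (Fin.castSucc_lt_last _).ne]
    ring
  set S := ∑ i, w i
  have hS : 0 ≤ S := Finset.sum_nonneg fun i _ => (hw i).le
  set D := α * ((n + 1).factorial : ℝ) with hD
  have hD₀ : 0 < D := by positivity
  refine ⟨(n + 1) * S * (1 + S) ^ n / D, fun ν hν => ?_⟩
  obtain ⟨s, hs, hl, hu⟩ := exists_finset_lattice_simplex (n + 1) w hw ν (by linarith)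
  have hset : {x : Fin (n + 1) → ℤ | (∀ i, 0 ≤ x i) ∧
      (∑ i, (x i : ℝ)) + (α - 1) * ((x ⟨n + 1 - 1, by omega⟩ : ℤ) : ℝ) ≤ ν} = s := by
    ext x
    rw [Finset.mem_coe, hs x, hsum x]
    rfl
  rw [hset, Set.ncard_coe_finset]
  rw [hprod, mul_comm _ α, ← hD] at hl hu
  have h₁ := pow_succ_sub_pow_succ_le (a := ν + S) (b := ν) (by linarith) (by linarith) n
  have h₂ : (ν + S) ^ n ≤ (1 + S) ^ n * ν ^ n := by
    rw [← mul_pow]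
    exact pow_le_pow_left₀ (by linarith) (by nlinarith) n
  have h₃ : (n + 1) * (ν + S - ν) * (ν + S) ^ n ≤ (n + 1) * S * ((1 + S) ^ n * ν ^ n) := by
    rw [add_sub_cancel_left]
    exact mul_le_mul_of_nonneg_left h₂ (by positivity)
  have e₁ : (s.card : ℝ) - ν ^ (n + 1) / D = (D * s.card - ν ^ (n + 1)) / D := by
    field_simp
  have e₂ : (n + 1) * S * (1 + S) ^ n / D * ν ^ (n + 1 - 1) =
      (n + 1) * S * ((1 + S) ^ n * ν ^ n) / D := by
    rw [Nat.add_sub_cancel]; ring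
  rw [e₁, e₂, abs_of_nonneg (div_nonneg (by linarith) hD₀.le)]
  gcongr
  linarith
end
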